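/- Suppose 0 < 1/n < 1/q ≪ c ≪ δ ≪ ε_0 ≤ 1 and k ∈ ℕ∖{1}. Suppose R = (2ε_0/3, a, d_{a,k}) is a regularity instance. Let H be a k-graph on a vertex set V with |V| = n, and let Q be chosen uniformly at random from the q-element subsets of V. Then with probability at least 1 − e^{−cq} the following both hold: (Q1) if there exists an (ε_0, a, d_{a,k})-equitable partition of H, then there exists an (ε_0+δ, a, d_{a,k})-equitable partition of the induced k-graph H[Q]; (Q2) if there exists an (ε_0, a, d_{a,k})-equitable partition of H[Q], then there exists an (ε_0+δ, a, d_{a,k})-equitable partition of H. -/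

import Mathlib

namespace HypReg

open Finset

attribute [local instance 10] Classical.propDecidable

noncomputable section

variable {V : Type*} [DecidableEq V]

/-- Representation of a 1-graph: the set of singletons of `U`. -/
def sing (U : Finset V) : Finset (Finset V) :=
  U.image fun v => ({v} : Finset V)

/-- `Kset W j i B`: the i-element subsets of `W` all of whose j-element subsets lie in `B`. -/
def Kset (W : Finset V) (j i : ℕ) (B : Finset (Finset V)) : Finset (Finset V) :=
  (W.powersetCard i).filter fun S => ∀ T ∈ S.powersetCard j, T ∈ B

/-- Clique operator which, at level 1, uses the ambient family `cr` of crossing i-sets. -/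
def KsetC (W : Finset V) (cr : Finset (Finset V)) (j i : ℕ) (B : Finset (Finset V)) :
    Finset (Finset V) :=
  if j = 1 then cr.filter fun S => ∀ v ∈ S, ({v} : Finset V) ∈ B
  else Kset W j i B

/-- `A` (a (j+1)-graph) is (ε,d)-regular with respect to the j-graph `B` (plain clique sets). -/
def RegPair (W : Finset V) (j : ℕ) (ε d : ℝ) (A B : Finset (Finset V)) : Prop :=
  ∀ Q ⊆ B, ε * ((Kset W j (j+1) B).card : ℝ) ≤ ((Kset W j (j+1) Q).card : ℝ) →
    |((A ∩ Kset W j (j+1) Q).card : ℝ) - d * ((Kset W j (j+1) Q).card : ℝ)|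
      ≤ ε * ((Kset W j (j+1) Q).card : ℝ)

/-- (ε,d)-regularity with crossing-aware clique sets. -/
def RegPairC (W : Finset V) (cr : Finset (Finset V)) (j : ℕ) (ε d : ℝ)
    (A B : Finset (Finset V)) : Prop :=
  ∀ Q ⊆ B, ε * ((KsetC W cr j (j+1) B).card : ℝ) ≤ ((KsetC W cr j (j+1) Q).card : ℝ) →
    |((A ∩ KsetC W cr j (j+1) Q).card : ℝ) - d * ((KsetC W cr j (j+1) Q).card : ℝ)|
      ≤ ε * ((KsetC W cr j (j+1) Q).card : ℝ)

/-- Relative density `d(A | B)` of the (j+1)-graph `A` w.r.t. the j-graph `B`. -/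
def dens (W : Finset V) (cr : Finset (Finset V)) (j : ℕ) (A B : Finset (Finset V)) : ℝ :=
  if (KsetC W cr j (j+1) B).card = 0 then 0
  else ((A ∩ KsetC W cr j (j+1) B).card : ℝ) / ((KsetC W cr j (j+1) B).card : ℝ)

/-- `H` is a k-graph on the vertex set `W`. -/
def IsKGraph (W : Finset V) (k : ℕ) (H : Finset (Finset V)) : Prop :=
  ∀ e ∈ H, e ⊆ W ∧ e.card = k

/-- symmetric difference of two hypergraphs -/
def sd (A B : Finset (Finset V)) : Finset (Finset V) := (A \ B) ∪ (B \ A)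

/-- A (candidate) family of partitions: the ground set, the class of each vertex and,
for each level `j ≥ 2`, the class of each crossing j-set. -/
structure PartFam (V : Type*) [DecidableEq V] where
  gnd : Finset V
  vClass : V → Finset V
  cls : ℕ → Finset V → Finset (Finset V)

namespace PartFam

variable (F : PartFam V)

/-- crossing i-sets -/
def cross (i : ℕ) : Finset (Finset V) :=
  (F.gnd.powersetCard i).filter fun S =>
    ∀ u ∈ S, ∀ v ∈ S, u ≠ v → F.vClass u ≠ F.vClass v

/-- the level-j polyad of a vertex set `J` -/
def polyad (j : ℕ) (J : Finset V) : Finset (Finset V) :=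
  if j = 1 then sing (J.sup F.vClass) else (J.powersetCard j).sup (F.cls j)

/-- the clique set `K_j(P̂^{(j-1)}(J))` of the (j−1)-polyad of a crossing j-set `J` -/
def polyCliques (j : ℕ) (J : Finset V) : Finset (Finset V) :=
  KsetC F.gnd (F.cross j) (j-1) j (F.polyad (j-1) J)

/-- `F` is a family of partitions `P(k−1, a)`. -/
def IsFamily (k : ℕ) (a : ℕ → ℕ) : Prop :=
  (∀ v ∈ F.gnd, v ∈ F.vClass v) ∧
  (∀ v ∈ F.gnd, F.vClass v ⊆ F.gnd) ∧
  (∀ u ∈ F.gnd, ∀ v ∈ F.gnd, u ∈ F.vClass v → F.vClass u = F.vClass v) ∧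
  (F.gnd.image F.vClass).card = a 1 ∧ k ≤ a 1 ∧
  ∀ j, 2 ≤ j → j ≤ k - 1 →
    (∀ J ∈ F.cross j, J ∈ F.cls j J) ∧
    (∀ J ∈ F.cross j, ∀ I ∈ F.cls j J, F.cls j I = F.cls j J) ∧
    (∀ J ∈ F.cross j, F.cls j J ⊆ F.polyCliques j J) ∧
    (∀ J ∈ F.cross j, F.polyCliques j J ⊆ F.cross j) ∧
    (∀ J ∈ F.cross j, ((F.polyCliques j J).image (F.cls j)).card = a j)

/-- the regularity condition in the definition of an equitable family of partitions:
all polyad complexes of crossing k-sets are (ε, (1/a_2, …, 1/a_{k−1}))-regular. -/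
def PolyadReg (k : ℕ) (a : ℕ → ℕ) (ε : ℝ) : Prop :=
  ∀ K ∈ F.cross k, ∀ j, 2 ≤ j → j ≤ k - 1 → ∀ J ∈ K.powersetCard j,
    RegPairC F.gnd (F.cross j) (j-1) ε (1 / (a j : ℝ)) (F.polyad j K) (F.polyad (j-1) J)

/-- `(η, ε, a, λ)`-equitable family of partitions -/
def IsEquitable (k : ℕ) (a : ℕ → ℕ) (η ε lam : ℝ) : Prop :=
  1 ≤ η * (a 1 : ℝ) ∧
  (∀ v ∈ F.gnd, |((F.vClass v).card : ℝ) - (F.gnd.card : ℝ) / (a 1 : ℝ)|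
      ≤ lam * (F.gnd.card : ℝ) / (a 1 : ℝ)) ∧
  F.PolyadReg k a ε

/-- `(η, ε, a)`-equitable family of partitions (classes of size ⌊n/a₁⌋ or ⌊n/a₁⌋+1) -/
def IsEquitableE (k : ℕ) (a : ℕ → ℕ) (η ε : ℝ) : Prop :=
  1 ≤ η * (a 1 : ℝ) ∧
  (∀ v ∈ F.gnd, (F.vClass v).card = F.gnd.card / a 1 ∨
      (F.vClass v).card = F.gnd.card / a 1 + 1) ∧
  F.PolyadReg k a ε

/-- `G` is perfectly ε-regular with respect to `F`. -/
def PerfectlyRegular (k : ℕ) (ε : ℝ) (G : Finset (Finset V)) : Prop :=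
  ∀ K ∈ F.cross k, ∃ d : ℝ, 0 ≤ d ∧
    RegPairC F.gnd (F.cross k) (k-1) ε d G (F.polyad (k-1) K)

end PartFam

/-- `a` is a T-bounded vector of length k−1. -/
def BoundedVec (k T : ℕ) (a : ℕ → ℕ) : Prop := ∀ j, 1 ≤ j → j ≤ k - 1 → a j ≤ T

/-- level-j refinement `F^{(j)} ≺ P^{(j)}` between two families of partitions -/
def RefinesAt (F P : PartFam V) (j : ℕ) : Prop :=
  if j = 1 then ∀ v ∈ F.gnd, F.vClass v ⊆ P.vClass v
  else ∀ I ∈ F.cross j,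
    (∃ J ∈ P.cross j, F.cls j I ⊆ P.cls j J) ∨ ∀ S ∈ F.cls j I, S ∉ P.cross j

/-- level-j approximate refinement `F^{(j)} ≺_ν P^{(j)}` -/
def RefinesApproxAt (F P : PartFam V) (j : ℕ) (ν : ℝ) : Prop :=
  if j = 1 then
    ∃ f : Finset V → Finset V,
      (∀ v ∈ F.gnd, f (F.vClass v) ∈ F.gnd.image P.vClass) ∧
      ∑ C ∈ F.gnd.image F.vClass, ((C \ f C).card : ℝ) ≤ ν * (F.gnd.card : ℝ)
  else
    ∃ f : Finset (Finset V) → Finset (Finset V),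
      (∀ I ∈ F.cross j,
        f (F.cls j I) ∈ ((P.cross j).image (P.cls j)) ∪ {F.cross j \ P.cross j}) ∧
      ∑ C ∈ (F.cross j).image (F.cls j), ((C \ f C).card : ℝ) ≤ ν * ((F.cross j).card : ℝ)

/-- The address space: a base set (of class indices) together with a labelling of its subsets. -/
abbrev Addr := Finset ℕ × (Finset ℕ → ℕ)

/-- `x` is an element of the address space `Â(l, j, a)`. -/
def IsAddress (l j : ℕ) (a : ℕ → ℕ) (x : Addr) : Prop :=
  x.1.card = l ∧ (∀ i ∈ x.1, 1 ≤ i ∧ i ≤ a 1) ∧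
  (∀ L : Finset ℕ, L ⊆ x.1 → 2 ≤ L.card → L.card ≤ j → 1 ≤ x.2 L ∧ x.2 L ≤ a L.card) ∧
  (∀ L : Finset ℕ, ¬(L ⊆ x.1 ∧ 2 ≤ L.card ∧ L.card ≤ j) → x.2 L = 0)

/-- restriction `ŷ ≤ x̂` of an address to the base `B`, keeping levels up to `j`. -/
def restrictA (x : Addr) (j : ℕ) (B : Finset ℕ) : Addr :=
  (B, fun L => if L ⊆ B ∧ 2 ≤ L.card ∧ L.card ≤ j then x.2 L else 0)

/-- `d` is a density function of `Â(k, k−1, a)`. -/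
def DensityFun (k : ℕ) (a : ℕ → ℕ) (d : Addr → ℝ) : Prop :=
  ∀ x : Addr, IsAddress k (k-1) a x → 0 ≤ d x ∧ d x ≤ 1

/-- A family of partitions together with an `a`-labelling. -/
structure LabFam (V : Type*) [DecidableEq V] extends PartFam V where
  vIdx : V → ℕ
  lbl : ℕ → Finset V → ℕ

namespace LabFam

variable (F : LabFam V)

/-- `F` is a family of partitions with a legitimate `a`-labelling. -/
def IsLabeled (k : ℕ) (a : ℕ → ℕ) : Prop :=
  F.toPartFam.IsFamily k a ∧
  (∀ v ∈ F.gnd, 1 ≤ F.vIdx v ∧ F.vIdx v ≤ a 1) ∧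
  (∀ u ∈ F.gnd, ∀ v ∈ F.gnd, (F.vIdx u = F.vIdx v ↔ F.vClass u = F.vClass v)) ∧
  ∀ j, 2 ≤ j → j ≤ k - 1 →
    (∀ I ∈ F.toPartFam.cross j, 1 ≤ F.lbl j I ∧ F.lbl j I ≤ a j) ∧
    (∀ I ∈ F.toPartFam.cross j, ∀ I' ∈ F.cls j I, F.lbl j I' = F.lbl j I) ∧
    (∀ I ∈ F.toPartFam.cross j, ∀ I' ∈ F.toPartFam.cross j,
      F.toPartFam.polyad (j-1) I = F.toPartFam.polyad (j-1) I' →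
      F.lbl j I = F.lbl j I' → F.cls j I = F.cls j I')

/-- the address `x̂(L)` (up to level j) of a crossing set `L` -/
def addrOf (j : ℕ) (L : Finset V) : Addr :=
  (L.image F.vIdx,
   fun M => if M ⊆ L.image F.vIdx ∧ 2 ≤ M.card ∧ M.card ≤ j
     then F.lbl M.card (L.filter fun v => F.vIdx v ∈ M) else 0)

/-- the part `P^{(j)}(x̂, b)` -/
def partAt (j : ℕ) (x : Addr) (b : ℕ) : Finset (Finset V) :=
  if j ≤ 1 then (if x.1 = {b} then sing (F.gnd.filter fun v => F.vIdx v = b) else ∅)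
  else (F.toPartFam.cross j).filter fun I => F.addrOf (j-1) I = x ∧ F.lbl j I = b

/-- the polyad `P̂^{(j)}(x̂)` -/
def polyAt (j : ℕ) (x : Addr) : Finset (Finset V) :=
  if j = 1 then sing (F.gnd.filter fun v => F.vIdx v ∈ x.1)
  else (x.1.powersetCard j).sup fun B => F.partAt j (restrictA x (j-1) B) (x.2 B)

/-- `F` is an `(ε, d)`-partition of `H`. -/
def IsDensPartition (k : ℕ) (a : ℕ → ℕ) (ε : ℝ) (d : Addr → ℝ)
    (H : Finset (Finset V)) : Prop :=
  ∀ x : Addr, IsAddress k (k-1) a x →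
    RegPairC F.gnd (F.toPartFam.cross k) (k-1) ε (d x) H (F.polyAt (k-1) x)

/-- `F` is an `(ε, a, d)`-equitable partition of `H`. -/
def IsEquitPartition (k : ℕ) (a : ℕ → ℕ) (ε : ℝ) (d : Addr → ℝ)
    (H : Finset (Finset V)) : Prop :=
  F.IsLabeled k a ∧ F.toPartFam.IsEquitableE k a (1 / (a 1 : ℝ)) ε ∧
  F.IsDensPartition k a ε d H

end LabFam

/-- An ℓ-partite complex: vertex classes and, for each level, a partite graph. -/
structure Cx (V : Type*) [DecidableEq V] (l : ℕ) where
  C : Fin l → Finset V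
  G : ℕ → Finset (Finset V)

namespace Cx

variable {l : ℕ} (X : Cx V l)

def gnd : Finset V := Finset.univ.sup X.C

/-- crossing i-sets with respect to the classes of `X` -/
def cross (i : ℕ) : Finset (Finset V) :=
  (X.gnd.powersetCard i).filter fun S => ∀ t : Fin l, (S ∩ X.C t).card ≤ 1

/-- restriction of the level-j graph to the classes indexed by `L` -/
def restr (j : ℕ) (L : Finset (Fin l)) : Finset (Finset V) :=
  if j = 1 then sing (L.sup X.C) else (X.G j).filter fun e => e ⊆ L.sup X.C

/-- `X` is a complex with levels up to `k`. -/
def IsComplex (k : ℕ) : Prop :=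
  (∀ s t : Fin l, s ≠ t → Disjoint (X.C s) (X.C t)) ∧
  (∀ j, 2 ≤ j → j ≤ k → X.G j ⊆ X.cross j) ∧
  (∀ j, 3 ≤ j → j ≤ k → X.G j ⊆ Kset X.gnd (j-1) j (X.G (j-1)))

/-- `X` is an (ε, (d_2, …, d_k))-regular complex. -/
def IsRegular (k : ℕ) (ε : ℝ) (d : ℕ → ℝ) : Prop :=
  ∀ j, 2 ≤ j → j ≤ k → ∀ L ∈ (Finset.univ : Finset (Fin l)).powersetCard j,
    RegPairC X.gnd (X.cross j) (j-1) ε (d j) (X.G j) (X.restr (j-1) L)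

/-- The restricted complex `X[L]` is (ε, (d_2, …, d_{k−1}, p))-regular. -/
def RestrRegular (k : ℕ) (ε : ℝ) (d : ℕ → ℝ) (L : Finset (Fin l)) (p : ℝ) : Prop :=
  ∀ j, 2 ≤ j → j ≤ k → ∀ L' ∈ L.powersetCard j,
    RegPairC X.gnd (X.cross j) (j-1) ε (if j = k then p else d j)
      (X.restr j L) (X.restr (j-1) L')

/-- clique set `K_i` of the level-j graph of the complex (level 1: crossing sets). -/
def KsetLvl (j i : ℕ) : Finset (Finset V) :=
  if j ≤ 1 then X.cross i else Kset X.gnd j i (X.G j)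

end Cx

/-- `eCL`, `mCL` satisfy the counting lemma of Kohayakawa–Rödl–Skokan. -/
def CountingProp (eCL : ℝ → ℝ → ℕ → ℕ → ℝ) (mCL : ℝ → ℝ → ℕ → ℕ → ℕ) : Prop :=
  ∀ γ d₀ : ℝ, 0 < γ → 0 < d₀ → ∀ k l : ℕ, 2 ≤ k → k ≤ l →
    (0 < eCL γ d₀ k l ∧ eCL γ d₀ k l ≤ 1) ∧
    ∀ (V₀ : Type) [DecidableEq V₀], ∀ (X : Cx V₀ l) (m : ℕ) (lam ε : ℝ) (d : ℕ → ℝ),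
      0 ≤ lam → lam < 1/4 → 0 < ε → ε ≤ eCL γ d₀ k l → mCL γ d₀ k l ≤ m →
      (∀ j, 2 ≤ j → j ≤ k → d₀ ≤ d j) →
      X.IsComplex k →
      (∀ i, |((X.C i).card : ℝ) - (m : ℝ)| ≤ lam * m) →
      X.IsRegular k ε d →
      |((Kset X.gnd k l (X.G k)).card : ℝ) -
        (∏ j ∈ Finset.Icc 2 k, d j ^ (l.choose j)) * ∏ i, ((X.C i).card : ℝ)|
        ≤ γ * ((∏ j ∈ Finset.Icc 2 k, d j ^ (l.choose j)) * ∏ i, ((X.C i).card : ℝ))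

/-- `eRI` is a legitimate function for defining regularity instances. -/
def GoodERI (eRI : ℕ → ℕ → ℝ) : Prop :=
  (∀ t k : ℕ, 1 ≤ t → 2 ≤ k → 0 < eRI t k ∧ eRI t k ≤ 1) ∧
  (∀ k t t' : ℕ, 1 ≤ t → t ≤ t' → eRI t' k ≤ eRI t k) ∧
  (∀ t k k' : ℕ, 2 ≤ k → k ≤ k' → eRI t k' ≤ eRI t k) ∧
  (∀ k : ℕ, Filter.Tendsto (fun t => eRI t k) Filter.atTop (nhds 0)) ∧
  ∃ (eCL : ℝ → ℝ → ℕ → ℕ → ℝ) (mCL : ℝ → ℝ → ℕ → ℕ → ℕ),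
    CountingProp eCL mCL ∧
    ∀ t k : ℕ, 1 ≤ t → 2 ≤ k →
      eRI t k < eCL (1/(t:ℝ)) (1/(t:ℝ)) (k-1) k / (4 * (t:ℝ) ^ (4^k))

/-- `max_i a_i` over `i ∈ [k−1]` -/
def maxA (k : ℕ) (a : ℕ → ℕ) : ℕ := (Finset.Icc 1 (k-1)).sup a

/-- `(ε, a, d)` is a regularity instance. -/
def RegInstance (eRI : ℕ → ℕ → ℝ) (k : ℕ) (ε : ℝ) (a : ℕ → ℕ) (d : Addr → ℝ) : Prop :=
  2 ≤ k ∧ (∀ j, 1 ≤ j → j ≤ k - 1 → 1 ≤ a j) ∧ 0 < ε ∧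
  ε ≤ eRI (maxA k a) k ∧ DensityFun k a d

section Counting

variable {W : Type} [Fintype W] [DecidableEq W]

/-- `S` spans an induced copy of `Fg` in `H` (both k-graphs). -/
def InducedCopy (Fg : Finset (Finset W)) (H : Finset (Finset V)) (k : ℕ) (S : Finset V) :
    Prop :=
  ∃ e : W → V, Function.Injective e ∧ Finset.univ.image e = S ∧
    ∀ A : Finset W, A.card = k → (A.image e ∈ H ↔ A ∈ Fg)

/-- the size of the automorphism group of `Fg` -/
def AutCount (Fg : Finset (Finset W)) : ℕ :=
  Nat.card {π : W ≃ W // ∀ A : Finset W, A.image π ∈ Fg ↔ A ∈ Fg}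

/-- the number `IC_σ(F, H)` of σ-induced copies of `Fg` in the complex `X` -/
def ICosig {l : ℕ} (X : Cx V l) (k : ℕ) (Fg : Finset (Finset W)) (σ : W ≃ Fin l) : ℕ :=
  Set.ncard {e : W → V |
    (∀ v, e v ∈ X.C (σ v)) ∧
    Finset.univ.image e ∈ X.KsetLvl (k-1) l ∧
    ∀ A : Finset W, A.card = k → (A.image e ∈ X.G k ↔ A ∈ Fg)}

/-- `IC(F, d, x̂, σ)` -/
def ICs (Fg : Finset (Finset W)) (k l : ℕ) (a : ℕ → ℕ) (d : Addr → ℝ)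
    (x : Addr) (σ : W → ℕ) : ℝ :=
  (∏ B ∈ x.1.powersetCard k,
    if ∃ A ∈ Fg, A.image σ = B then d (restrictA x (k-1) B)
    else 1 - d (restrictA x (k-1) B)) *
  ∏ j ∈ Finset.Icc 2 (k-1), ((a j : ℝ) ^ (l.choose j))⁻¹

/-- `IC(F, d, x̂)` -/
def ICa (Fg : Finset (Finset W)) (k l : ℕ) (a : ℕ → ℕ) (d : Addr → ℝ) (x : Addr) : ℝ :=
  (AutCount Fg : ℝ)⁻¹ *
    ∑ᶠ σ ∈ {σ : W → ℕ | Set.BijOn σ Set.univ ↑x.1}, ICs Fg k l a d x σ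

/-- `IC(F, d)` -/
def IC (Fg : Finset (Finset W)) (k l : ℕ) (a : ℕ → ℕ) (d : Addr → ℝ) : ℝ :=
  (((a 1).choose l : ℝ))⁻¹ * ∑ᶠ x ∈ {x : Addr | IsAddress l (k-1) a x}, ICa Fg k l a d x

end Counting

end

end HypReg

namespace HypReg

open Finset

open scoped BigOperators

attribute [local instance 10] Classical.propDecidable

section Expectation

variable {I J V : Type} [Fintype I] [Fintype J] [Fintype V] [Nonempty V]

theorem expect_comp_injective [DecidableEq I] [DecidableEq J] (κ : J → I)
    (hκ : Function.Injective κ) (f : (J → V) → ℝ) :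
    𝔼 ψ : I → V, f (ψ ∘ κ) = 𝔼 ψ : J → V, f ψ := by
  classical
  let e : (I → V) ≃ (J → V) × ({x // ¬ x ∈ Set.range κ} → V) :=
    (Equiv.piEquivPiSubtypeProd (fun x => x ∈ Set.range κ) (fun _ => V)).trans
      (Equiv.prodCongr ((Equiv.ofInjective κ hκ).arrowCongr (Equiv.refl V)).symm (Equiv.refl _))
  have h1 : 𝔼 ψ : I → V, f (ψ ∘ κ) =
      𝔼 p : (J → V) × ({x // ¬ x ∈ Set.range κ} → V), f p.1 := by
    refine Fintype.expect_equiv e _ _ fun ψ => ?_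
    rfl
  rw [h1, ← univ_product_univ, expect_product]
  simp only [Fintype.expect_const]

theorem expect_le_of_forall_le {Ω : Type} [Fintype Ω] [Nonempty Ω] (f : Ω → ℝ) (b : ℝ)
    (h : ∀ x, f x ≤ b) : 𝔼 x, f x ≤ b :=
  expect_le univ_nonempty fun x _ => h x

theorem abs_expect_le' {Ω : Type} [Fintype Ω] (f : Ω → ℝ) :
    |𝔼 x, f x| ≤ 𝔼 x, |f x| := abs_expect_le _ _

theorem expect_not_injective_le [DecidableEq I] :
    𝔼 ψ : I → V, (if Function.Injective ψ then (0:ℝ) else 1) ≤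
      (Fintype.card I : ℝ) ^ 2 / Fintype.card V := by
  classical
  have hV : (0:ℝ) < Fintype.card V := by exact_mod_cast Fintype.card_pos
  have hpair : ∀ i j : I, i ≠ j →
      𝔼 ψ : I → V, (if ψ i = ψ j then (1:ℝ) else 0) = 1 / Fintype.card V := by
    intro i j hij
    have hinj : Function.Injective (fun b : Bool => if b then i else j) := by
      intro a b h
      cases a <;> cases b <;> simp_all
    have := expect_comp_injective (V := V) _ hinj
      (fun ψ => if ψ true = ψ false then (1:ℝ) else 0)
    simp only [Function.comp, if_true] at this
    have h2 : 𝔼 ψ : Bool → V, (if ψ true = ψ false then (1:ℝ) else 0) =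
        𝔼 p : V × V, (if p.1 = p.2 then (1:ℝ) else 0) :=
      Fintype.expect_equiv (Equiv.boolArrowEquivProd V) _ _ (fun ψ => by
        simp only [Equiv.boolArrowEquivProd, Equiv.coe_fn_mk, eq_comm]; congr)
    rw [h2, ← univ_product_univ, expect_product] at this
    simp only [Bool.false_eq_true, if_false] at this
    rw [this]
    simp only [Fintype.expect_eq_sum_div_card]
    simp
  have hle : ∀ ψ : I → V, (if Function.Injective ψ then (0:ℝ) else 1) ≤
      ∑ i : I, ∑ j : I, if i ≠ j ∧ ψ i = ψ j then (1:ℝ) else 0 := by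
    intro ψ
    split_ifs with h
    · positivity
    · simp only [Function.Injective, not_forall] at h
      obtain ⟨i, j, hij, hne⟩ := h
      calc (1:ℝ) = if i ≠ j ∧ ψ i = ψ j then (1:ℝ) else 0 := by simp [hij, hne]
        _ ≤ ∑ j : I, if i ≠ j ∧ ψ i = ψ j then (1:ℝ) else 0 :=
          single_le_sum (f := fun j => if i ≠ j ∧ ψ i = ψ j then (1:ℝ) else 0)
            (fun _ _ => by positivity) (mem_univ j)
        _ ≤ _ := single_le_sum (f := fun i => ∑ j : I, if i ≠ j ∧ ψ i = ψ j then (1:ℝ) else 0)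
            (fun _ _ => by positivity) (mem_univ i)
  calc _ ≤ 𝔼 ψ : I → V, ∑ i : I, ∑ j : I, (if i ≠ j ∧ ψ i = ψ j then (1:ℝ) else 0) :=
        expect_le_expect fun ψ _ => hle ψ
    _ = ∑ i : I, ∑ j : I, 𝔼 ψ : I → V, (if i ≠ j ∧ ψ i = ψ j then (1:ℝ) else 0) := by
        rw [expect_sum_comm]
        exact sum_congr rfl fun i _ => expect_sum_comm _ _ _
    _ ≤ ∑ i : I, ∑ j : I, 1 / (Fintype.card V : ℝ) := by
        refine sum_le_sum fun i _ => sum_le_sum fun j _ => ?_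
        by_cases hij : i = j
        · simp [hij]
        · simp only [ne_eq, hij, not_false_eq_true, true_and]
          exact (hpair i j hij).le
    _ = _ := by simp; ring

end Expectation

section Conditioning

variable {Ω χ : Type} [Fintype Ω]

/-- conditional probability of `C = c` given the `r`-class of `ω` -/
noncomputable def condProb (r : Setoid Ω) (C : Ω → χ) (c : χ) (ω : Ω) : ℝ :=
  (#{ω' | r ω' ω ∧ C ω' = c} : ℝ) / (#{ω' | r ω' ω} : ℝ)

theorem condProb_nonneg (r : Setoid Ω) (C : Ω → χ) (c : χ) (ω : Ω) : 0 ≤ condProb r C c ω := by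
  unfold condProb; positivity

theorem condProb_le_one (r : Setoid Ω) (C : Ω → χ) (c : χ) (ω : Ω) : condProb r C c ω ≤ 1 := by
  unfold condProb
  refine div_le_one_of_le₀ ?_ (by positivity)
  exact_mod_cast card_le_card fun x => by simp +contextual

theorem condProb_congr (r : Setoid Ω) (C : Ω → χ) (c : χ) {ω ω' : Ω} (h : r ω ω') :
    condProb r C c ω = condProb r C c ω' := by
  have : ∀ x, r x ω ↔ r x ω' := fun x => ⟨fun hx => r.trans hx h, fun hx => r.trans hx (r.symm h)⟩
  simp only [condProb, this]

theorem card_class_pos (r : Setoid Ω) (ω : Ω) : (0:ℝ) < (#{ω' | r ω' ω} : ℝ) := by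
  have : 0 < #{ω' | r ω' ω} := card_pos.mpr ⟨ω, by simp⟩
  exact_mod_cast this

theorem sum_condProb [Fintype χ] (r : Setoid Ω) (C : Ω → χ) (ω : Ω) :
    ∑ c, condProb r C c ω = 1 := by
  unfold condProb
  rw [← sum_div, div_eq_one_iff_eq (card_class_pos r ω).ne']
  rw [← Nat.cast_sum]
  congr 1
  rw [card_eq_sum_card_fiberwise (f := C) (t := univ) (fun _ _ => by simp)]
  simp [filter_filter]

/-- Tower property. -/
theorem expect_indicator_mul (r : Setoid Ω) (C : Ω → χ) (c : χ) (g : Ω → ℝ)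
    (hg : ∀ ω ω', r ω ω' → g ω = g ω') :
    𝔼 ω, (if C ω = c then (1:ℝ) else 0) * g ω = 𝔼 ω, condProb r C c ω * g ω := by
  simp only [Fintype.expect_eq_sum_div_card]
  congr 1
  have h1 : ∀ ω, (if C ω = c then (1:ℝ) else 0) * g ω =
      ∑ ω', (if r ω' ω then (if C ω = c then (1:ℝ) else 0) * g ω / (#{x | r x ω} : ℝ) else 0) := by
    intro ω
    rw [← sum_filter, sum_const, nsmul_eq_mul]
    field_simp [(card_class_pos r ω).ne']
  have h2 : ∀ ω', condProb r C c ω' * g ω' =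
      ∑ ω, (if r ω' ω then (if C ω = c then (1:ℝ) else 0) * g ω / (#{x | r x ω} : ℝ) else 0) := by
    intro ω'
    have : ∀ ω, (if r ω' ω then (if C ω = c then (1:ℝ) else 0) * g ω / (#{x | r x ω} : ℝ) else 0)
        = (if r ω ω' ∧ C ω = c then 1 else 0) * (g ω' / (#{x | r x ω'} : ℝ)) := by
      intro ω
      by_cases h : r ω' ω
      · have hs : ∀ x, r x ω ↔ r x ω' :=
          fun x => ⟨fun hx => r.trans hx (r.symm h), fun hx => r.trans hx h⟩
        simp only [h, r.symm h, hg _ _ h, hs, if_true, true_and]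
        ring
      · have h' : ¬ r ω ω' := fun h' => h (r.symm h')
        simp [h, h']
    simp only [this]
    rw [← sum_mul, ← sum_filter, sum_const, nsmul_eq_mul, mul_one, condProb]
    ring
  rw [sum_congr rfl fun ω _ => h1 ω, sum_congr rfl fun ω _ => h2 ω, sum_comm]

/-- expected conditional probability of the true colour -/
noncomputable def energy (r : Setoid Ω) (C : Ω → χ) : ℝ := 𝔼 ω, condProb r C (C ω) ω

theorem energy_nonneg (r : Setoid Ω) (C : Ω → χ) : 0 ≤ energy r C :=
  expect_nonneg fun _ _ => condProb_nonneg _ _ _ _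

theorem energy_le_one [Nonempty Ω] (r : Setoid Ω) (C : Ω → χ) : energy r C ≤ 1 :=
  expect_le_of_forall_le _ _ fun _ => condProb_le_one _ _ _ _

theorem sum_expect_condProb_mul [Fintype χ] {r r' : Setoid Ω} (h : r' ≤ r) (C : Ω → χ) :
    ∑ c, 𝔼 ω, condProb r' C c ω * condProb r C c ω = energy r C := by
  have h1 : ∀ c, 𝔼 ω, condProb r' C c ω * condProb r C c ω =
      𝔼 ω, (if C ω = c then (1:ℝ) else 0) * condProb r C c ω := by
    intro c
    rw [expect_indicator_mul r' C c]
    exact fun ω ω' hω => condProb_congr r C c (h hω)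
  rw [sum_congr rfl fun c _ => h1 c, ← expect_sum_comm]
  simp [energy]

theorem energy_sub_energy [Fintype χ] {r r' : Setoid Ω} (h : r' ≤ r) (C : Ω → χ) :
    ∑ c, 𝔼 ω, (condProb r' C c ω - condProb r C c ω) ^ 2 = energy r' C - energy r C := by
  have h1 := sum_expect_condProb_mul h C
  have h2 := sum_expect_condProb_mul (le_refl r) C
  have h3 := sum_expect_condProb_mul (le_refl r') C
  have : ∀ c, 𝔼 ω, (condProb r' C c ω - condProb r C c ω) ^ 2 =
      𝔼 ω, condProb r' C c ω * condProb r' C c ω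
      - 2 * 𝔼 ω, condProb r' C c ω * condProb r C c ω
      + 𝔼 ω, condProb r C c ω * condProb r C c ω := by
    intro c
    rw [mul_expect, ← expect_sub_distrib, ← expect_add_distrib]
    exact expect_congr rfl fun ω _ => by ring
  simp only [this, sum_add_distrib, sum_sub_distrib, ← mul_sum, h1, h2, h3]
  ring

theorem energy_mono [Fintype χ] {r r' : Setoid Ω} (h : r' ≤ r) (C : Ω → χ) :
    energy r C ≤ energy r' C := by
  have := energy_sub_energy h C
  have h0 : 0 ≤ ∑ c, 𝔼 ω, (condProb r' C c ω - condProb r C c ω) ^ 2 :=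
    sum_nonneg fun c _ => expect_nonneg fun ω _ => sq_nonneg _
  linarith

theorem expect_abs_sq_le [Nonempty Ω] (f : Ω → ℝ) : (𝔼 ω, |f ω|) ^ 2 ≤ 𝔼 ω, f ω ^ 2 := by
  have h : ∀ m : ℝ, 0 ≤ 𝔼 ω, f ω ^ 2 - 2 * m * 𝔼 ω, |f ω| + m ^ 2 := by
    intro m
    have : 𝔼 ω, (|f ω| - m) ^ 2 = 𝔼 ω, f ω ^ 2 - 2 * m * 𝔼 ω, |f ω| + m ^ 2 := by
      rw [mul_expect, ← expect_sub_distrib]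
      conv_rhs => rw [← Fintype.expect_const (ι := Ω) (m ^ 2)]
      rw [← expect_add_distrib]
      exact expect_congr rfl fun ω _ => by rw [← sq_abs (f ω)]; ring
    rw [← this]
    exact expect_nonneg fun ω _ => sq_nonneg _
  have := h (𝔼 ω, |f ω|)
  nlinarith

theorem sum_expect_abs_le [Nonempty Ω] [Fintype χ] {r r' : Setoid Ω} (h : r' ≤ r) (C : Ω → χ)
    {η : ℝ} (hη : energy r' C - energy r C ≤ η ^ 2) (h0 : 0 ≤ η) :
    ∑ c, 𝔼 ω, |condProb r' C c ω - condProb r C c ω| ≤ Fintype.card χ * η := by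
  have h1 : ∀ c, 𝔼 ω, |condProb r' C c ω - condProb r C c ω| ≤ η := by
    intro c
    have h2 := expect_abs_sq_le (fun ω => condProb r' C c ω - condProb r C c ω)
    have h3 : 𝔼 ω, (condProb r' C c ω - condProb r C c ω) ^ 2 ≤ η ^ 2 := by
      refine le_trans ?_ hη
      rw [← energy_sub_energy h C]
      exact single_le_sum (f := fun c => 𝔼 ω, (condProb r' C c ω - condProb r C c ω) ^ 2)
        (fun c _ => expect_nonneg fun ω _ => sq_nonneg _) (mem_univ c)
    exact le_of_sq_le_sq (h2.trans h3) h0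
  calc _ ≤ ∑ c : χ, η := sum_le_sum fun c _ => h1 c
    _ = _ := by simp

/-- Replacing the true colour by an independent sample from its conditional law given a coarser
relation costs little if the energies are close. -/
theorem abs_expect_sub_resample_le [Nonempty Ω] [Fintype χ] {r r' : Setoid Ω} (h : r' ≤ r)
    (C : Ω → χ) {η : ℝ} (hη : energy r' C - energy r C ≤ η ^ 2) (h0 : 0 ≤ η)
    (g : Ω → χ → ℝ) (hg : ∀ c ω ω', r' ω ω' → g ω c = g ω' c)
    (hg0 : ∀ ω c, 0 ≤ g ω c) (hg1 : ∀ ω c, g ω c ≤ 1) :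
    |𝔼 ω, g ω (C ω) - 𝔼 ω, ∑ c, condProb r C c ω * g ω c| ≤ Fintype.card χ * η := by
  have h1 : 𝔼 ω, g ω (C ω) = ∑ c, 𝔼 ω, condProb r' C c ω * g ω c := by
    have : ∀ c, 𝔼 ω, condProb r' C c ω * g ω c =
        𝔼 ω, (if C ω = c then (1:ℝ) else 0) * g ω c := fun c => by
      rw [expect_indicator_mul r' C c]
      exact hg c
    rw [sum_congr rfl fun c _ => this c, ← expect_sum_comm]
    simp
  rw [h1, expect_sum_comm, ← sum_sub_distrib]
  refine (abs_sum_le_sum_abs _ _).trans (le_trans (sum_le_sum fun c _ => ?_)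
    (sum_expect_abs_le h C hη h0))
  rw [← expect_sub_distrib]
  refine (abs_expect_le' _).trans (expect_le_expect fun ω _ => ?_)
  rw [← sub_mul, abs_mul, abs_of_nonneg (hg0 ω c)]
  exact mul_le_of_le_one_right (abs_nonneg _) (hg1 ω c)

end Conditioning

end HypReg

namespace HypReg

open Finset

open scoped BigOperators

attribute [local instance 10] Classical.propDecidable

section ProductWeights

variable {E E' χ : Type} [Fintype E] [Fintype E'] [Fintype χ] [DecidableEq E]

theorem sum_prod_weights_eq_one (w : E → χ → ℝ) (hw : ∀ e, ∑ x, w e x = 1) :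
    ∑ c : E → χ, ∏ e, w e (c e) = 1 := by
  have := Finset.prod_univ_sum (fun _ : E => (univ : Finset χ)) w
  rw [Fintype.piFinset_univ] at this
  rw [← this]
  simp [hw]

theorem sum_prod_weights_update (w : E → χ → ℝ) (hw : ∀ e, ∑ x, w e x = 1) (e : E)
    (F : (E → χ) → ℝ) :
    ∑ c : E → χ, (∏ i, w i (c i)) * F c =
      ∑ c : E → χ, (∏ i, w i (c i)) * ∑ x, w e x * F (Function.update c e x) := by
  have hinv : Function.Involutive
      (fun p : (E → χ) × χ => (Function.update p.1 e p.2, p.1 e)) := by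
    rintro ⟨c, x⟩
    simp
  have hprod : ∀ (c : E → χ) (x : χ),
      (∏ i, w i (Function.update c e x i)) * w e (c e) = (∏ i, w i (c i)) * w e x := by
    intro c x
    rw [← mul_prod_erase univ (fun i => w i (c i)) (mem_univ e),
      ← mul_prod_erase univ (fun i => w i (Function.update c e x i)) (mem_univ e)]
    have : ∏ i ∈ univ.erase e, w i (Function.update c e x i) = ∏ i ∈ univ.erase e, w i (c i) :=
      prod_congr rfl fun i hi => by
        rw [Function.update_of_ne (ne_of_mem_erase hi)]
    rw [this]
    simp only [Function.update_self]
    ring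
  calc ∑ c : E → χ, (∏ i, w i (c i)) * F c
      = ∑ c : E → χ, ∑ x, (∏ i, w i (c i)) * w e x * F c := by
        refine sum_congr rfl fun c _ => ?_
        rw [← sum_mul, ← mul_sum, hw e, mul_one]
    _ = ∑ p : (E → χ) × χ, (∏ i, w i (p.1 i)) * w e p.2 * F p.1 := by
        rw [Fintype.sum_prod_type]
    _ = ∑ p : (E → χ) × χ, (∏ i, w i (p.1 i)) * w e p.2 * F (Function.update p.1 e p.2) := by
        refine Fintype.sum_equiv hinv.toPerm _ _ fun p => ?_
        simp only [Function.Involutive.coe_toPerm, hprod, Function.update_idem,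
          Function.update_eq_self]
    _ = _ := by
        rw [Fintype.sum_prod_type]
        refine sum_congr rfl fun c _ => ?_
        rw [mul_sum]
        exact sum_congr rfl fun x _ => by ring

theorem sum_prod_weights_comp [DecidableEq E'] (w : E' → χ → ℝ) (hw : ∀ e, ∑ x, w e x = 1)
    (κ : E → E') (hκ : Function.Injective κ) (F : (E → χ) → ℝ) :
    ∑ c : E' → χ, (∏ i, w i (c i)) * F (c ∘ κ) =
      ∑ c : E → χ, (∏ i, w (κ i) (c i)) * F c := by
  classical
  let eq1 := Equiv.ofInjective κ hκ
  let e : (E' → χ) ≃ (E → χ) × ({x // ¬ x ∈ Set.range κ} → χ) :=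
    (Equiv.piEquivPiSubtypeProd (fun x => x ∈ Set.range κ) (fun _ => χ)).trans
      (Equiv.prodCongr (eq1.arrowCongr (Equiv.refl χ)).symm (Equiv.refl _))
  have h1 : ∑ c : E' → χ, (∏ i, w i (c i)) * F (c ∘ κ) =
      ∑ p : (E → χ) × ({x // ¬ x ∈ Set.range κ} → χ),
        ((∏ i, w (κ i) (p.1 i)) * ∏ i, w i.1 (p.2 i)) * F p.1 := by
    refine Fintype.sum_equiv e _ _ fun c => ?_
    have hF : (e c).1 = c ∘ κ := rfl
    have h2 : (e c).2 = fun i => c i.1 := rfl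
    have h3 := Fintype.prod_subtype_mul_prod_subtype (fun x => x ∈ Set.range κ)
      (fun i => w i (c i))
    have h4 : ∏ i, w (κ i) (c (κ i)) = ∏ i : {x // x ∈ Set.range κ}, w i.1 (c i.1) :=
      Fintype.prod_equiv eq1 _ _ fun i => rfl
    rw [hF, h2, ← h3]
    congr 2
    exact Eq.trans (by congr!) h4.symm
  rw [h1, Fintype.sum_prod_type]
  refine sum_congr rfl fun c _ => ?_
  dsimp only
  rw [← sum_mul, ← mul_sum,
    sum_prod_weights_eq_one (fun i : {x // ¬ x ∈ Set.range κ} => w i.1) fun i => hw i.1, mul_one]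

end ProductWeights

section Resample

variable {Ω E χ : Type} [Fintype Ω] [Nonempty Ω] [Fintype E] [DecidableEq E] [Fintype χ]

/-- Almost conditionally independent colours can be replaced by independent ones. -/
theorem abs_expect_sub_resample_all_le (r r' : E → Setoid Ω) (C : E → Ω → χ) {η : ℝ}
    (h0 : 0 ≤ η) (hle : ∀ e, r' e ≤ r e)
    (hη : ∀ e, energy (r' e) (C e) - energy (r e) (C e) ≤ η ^ 2)
    (hC : ∀ e e' ω ω', e' ≠ e → r' e ω ω' → C e' ω = C e' ω')
    (hr : ∀ e e' ω ω', r' e ω ω' → r e' ω ω')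
    (Ψ : Ω → (E → χ) → ℝ) (hΨ : ∀ e ω ω', r' e ω ω' → Ψ ω = Ψ ω')
    (hΨ0 : ∀ ω c, 0 ≤ Ψ ω c) (hΨ1 : ∀ ω c, Ψ ω c ≤ 1) :
    |𝔼 ω, Ψ ω (fun e => C e ω) -
      𝔼 ω, ∑ c : E → χ, (∏ e, condProb (r e) (C e) (c e) ω) * Ψ ω c| ≤
      Fintype.card E * (Fintype.card χ * η) := by
  let W : Ω → (E → χ) → ℝ := fun ω c => ∏ e, condProb (r e) (C e) (c e) ω
  have hW0 : ∀ ω c, 0 ≤ W ω c := fun ω c => prod_nonneg fun e _ => condProb_nonneg _ _ _ _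
  have hW1 : ∀ ω, ∑ c, W ω c = 1 := fun ω =>
    sum_prod_weights_eq_one (fun e x => condProb (r e) (C e) x ω) fun e => sum_condProb _ _ _
  let mix : Finset E → (E → χ) → Ω → E → χ := fun J c ω e => if e ∈ J then c e else C e ω
  have key : ∀ J : Finset E,
      |𝔼 ω, Ψ ω (fun e => C e ω) - 𝔼 ω, ∑ c, W ω c * Ψ ω (mix J c ω)| ≤
        (#J : ℝ) * (Fintype.card χ * η) := by
    intro J
    induction J using Finset.induction_on with
    | empty =>
      have : ∀ ω, ∑ c, W ω c * Ψ ω (mix ∅ c ω) = Ψ ω (fun e => C e ω) := by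
        intro ω
        have : ∀ c, mix ∅ c ω = fun e => C e ω := fun c => by funext e; simp [mix]
        simp only [this, ← sum_mul, hW1, one_mul]
      simp [this]
    | insert e J he ih =>
      let g : Ω → χ → ℝ := fun ω x =>
        ∑ c, W ω c * Ψ ω (Function.update (mix J c ω) e x)
      have hg0 : ∀ ω x, 0 ≤ g ω x := fun ω x =>
        sum_nonneg fun c _ => mul_nonneg (hW0 _ _) (hΨ0 _ _)
      have hg1 : ∀ ω x, g ω x ≤ 1 := fun ω x => by
        rw [← hW1 ω]
        exact sum_le_sum fun c _ => mul_le_of_le_one_right (hW0 _ _) (hΨ1 _ _)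
      have hg : ∀ x ω ω', r' e ω ω' → g ω x = g ω' x := by
        intro x ω ω' hω
        refine sum_congr rfl fun c _ => ?_
        have h1 : W ω c = W ω' c :=
          prod_congr rfl fun e' _ => condProb_congr _ _ _ (hr e e' _ _ hω)
        have h2 : Function.update (mix J c ω) e x = Function.update (mix J c ω') e x := by
          funext e'
          by_cases hee : e' = e
          · subst hee; simp
          · rw [Function.update_of_ne hee, Function.update_of_ne hee]
            simp only [mix]
            rw [hC e e' ω ω' hee hω]
        rw [h1, h2, hΨ e ω ω' hω]
      have hstep := abs_expect_sub_resample_le (hle e) (C e) (hη e) h0 g hg hg0 hg1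
      have hA : ∀ ω, g ω (C e ω) = ∑ c, W ω c * Ψ ω (mix J c ω) := by
        intro ω
        refine sum_congr rfl fun c _ => ?_
        congr 2
        funext e'
        by_cases hee : e' = e
        · subst hee; simp [mix, he]
        · rw [Function.update_of_ne hee]
      have hB : ∀ ω, ∑ x, condProb (r e) (C e) x ω * g ω x =
          ∑ c, W ω c * Ψ ω (mix (insert e J) c ω) := by
        intro ω
        rw [sum_prod_weights_update (fun e x => condProb (r e) (C e) x ω)
          (fun e => sum_condProb _ _ _) e]
        simp only [g, mul_sum]
        rw [sum_comm]
        refine sum_congr rfl fun c _ => sum_congr rfl fun x _ => ?_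
        have : mix (insert e J) (Function.update c e x) ω = Function.update (mix J c ω) e x := by
          funext e'
          by_cases hee : e' = e
          · subst hee; simp [mix]
          · simp [mix, hee]
        rw [this]
        ring
      simp only [hA, hB] at hstep
      rw [card_insert_of_notMem he]
      push_cast
      have := abs_sub_le (𝔼 ω, Ψ ω (fun e => C e ω)) (𝔼 ω, ∑ c, W ω c * Ψ ω (mix J c ω))
        (𝔼 ω, ∑ c, W ω c * Ψ ω (mix (insert e J) c ω))
      linarith
  have := key univ
  simpa [mix] using this

end Resample

end HypReg

namespace HypReg

open Finset

open scoped BigOperators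

attribute [local instance 10] Classical.propDecidable

set_option linter.unusedSectionVars false

section Patterns

variable {V I J S α β κ : Type} [Fintype V] [DecidableEq V] [Fintype I] [DecidableEq I]
  [Fintype J] [DecidableEq J] [DecidableEq S]

/-- The colour pattern on index sets induced by a map into the vertex set. -/
def pat (Z : Finset V → κ) (ψ : I → V) : Finset I → κ := fun D => Z (D.image ψ)

theorem pat_comp (Z : Finset V → κ) (ψ : I → V) (f : J → I) (D : Finset J) :
    pat Z (ψ ∘ f) D = pat Z ψ (D.image f) := by
  simp [pat, image_image]

/-- Two maps are related if their patterns agree, except possibly the `B`-colours above `e`. -/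
def patSetoid (A : Finset V → α) (B : Finset V → β) (e : Finset I) : Setoid (I → V) where
  r ψ ψ' := ∀ D, pat A ψ D = pat A ψ' D ∧ (¬ e ⊆ D → pat B ψ D = pat B ψ' D)
  iseqv := ⟨fun _ _ => ⟨rfl, fun _ => rfl⟩,
    fun h D => ⟨(h D).1.symm, fun hD => ((h D).2 hD).symm⟩,
    fun h h' D => ⟨(h D).1.trans (h' D).1, fun hD => ((h D).2 hD).trans ((h' D).2 hD)⟩⟩

/-- The `B`-colours of the sets consisting of `e` and a subset of the base `s`. -/
def tgt (B : Finset V → β) (s : S → I) (e : Finset I) (ψ : I → V) : Finset S → β :=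
  fun D => B ((D.image s ∪ e).image ψ)

theorem tgt_comp (B : Finset V → β) (s : S → J) (e : Finset J) (f : J → I) (ψ : I → V) :
    tgt B s e (ψ ∘ f) = tgt B (f ∘ s) (e.image f) ψ := by
  funext D
  simp [tgt, image_union, image_image, Function.comp_assoc]

theorem expect_card_filter {Ω : Type} [Fintype Ω] (P : Ω → Prop) [DecidablePred P] :
    𝔼 ω, (if P ω then (1:ℝ) else 0) = (#{ω | P ω} : ℝ) / Fintype.card Ω := by
  rw [Fintype.expect_eq_sum_div_card]
  simp

theorem condProb_eq_expect_div {Ω χ : Type} [Fintype Ω] (r : Setoid Ω) (C : Ω → χ) (c : χ)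
    (ω : Ω) : condProb r C c ω = (𝔼 ω', (if r ω' ω ∧ C ω' = c then (1:ℝ) else 0)) /
      𝔼 ω', (if r ω' ω then (1:ℝ) else 0) := by
  have : (Fintype.card Ω : ℝ) ≠ 0 := by
    have : Nonempty Ω := ⟨ω⟩
    exact_mod_cast Fintype.card_ne_zero
  rw [expect_card_filter, expect_card_filter, div_div_div_cancel_right₀ this, condProb]

theorem condProb_comap [Nonempty V] {χ : Type} (f : J → I) (hf : Function.Injective f)
    (r : Setoid (J → V)) (C : (J → V) → χ) (c : χ) (ψ : I → V) :
    condProb (r.comap fun ψ : I → V => ψ ∘ f) (fun ψ => C (ψ ∘ f)) c ψ =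
      condProb r C c (ψ ∘ f) := by
  rw [condProb_eq_expect_div, condProb_eq_expect_div]
  congr 1
  · exact expect_comp_injective f hf fun ψ' => if r ψ' (ψ ∘ f) ∧ C ψ' = c then (1:ℝ) else 0
  · exact expect_comp_injective f hf fun ψ' => if r ψ' (ψ ∘ f) then (1:ℝ) else 0

theorem energy_comap [Nonempty V] {χ : Type} (f : J → I) (hf : Function.Injective f)
    (r : Setoid (J → V)) (C : (J → V) → χ) :
    energy (r.comap fun ψ : I → V => ψ ∘ f) (fun ψ => C (ψ ∘ f)) = energy r C := by
  unfold energy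
  simp only [condProb_comap f hf]
  exact expect_comp_injective f hf fun ψ => condProb r C (C ψ) ψ

theorem patSetoid_le_comap (A : Finset V → α) (B : Finset V → β) (e : Finset J) (f : J → I)
    (hf : Function.Injective f) :
    patSetoid A B (e.image f) ≤ (patSetoid A B e).comap fun ψ : I → V => ψ ∘ f := by
  intro ψ ψ' h D
  simp only [pat_comp]
  refine ⟨(h _).1, fun hD => (h _).2 ?_⟩
  rwa [image_subset_image_iff hf]

theorem energy_patSetoid_le [Nonempty V] [Fintype S] [Fintype β]
    (A : Finset V → α) (B : Finset V → β)
    (e : Finset J) (s : S → J) (f : J → I) (hf : Function.Injective f) :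
    energy (patSetoid A B e) (tgt B s e) ≤
      energy (patSetoid A B (e.image f)) (tgt B (f ∘ s) (e.image f)) := by
  rw [← energy_comap f hf]
  simp only [tgt_comp]
  exact energy_mono (patSetoid_le_comap A B e f hf) _

/-- Agreement of a map with a prescribed pattern, except for the `B`-colours above `e`. -/
def Agrees (A : Finset V → α) (B : Finset V → β) (e : Finset I) (a : Finset I → α)
    (b : Finset I → β) (ψ : I → V) : Prop :=
  ∀ D, pat A ψ D = a D ∧ (¬ e ⊆ D → pat B ψ D = b D)

/-- The law of `tgt` conditioned on a prescribed pattern. -/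
noncomputable def maskProb (A : Finset V → α) (B : Finset V → β) (s : S → I) (e : Finset I)
    (a : Finset I → α) (b : Finset I → β) (c₀ c : Finset S → β) : ℝ :=
  if #{ψ | Agrees A B e a b ψ} = 0 then (if c = c₀ then 1 else 0)
  else (#{ψ | Agrees A B e a b ψ ∧ tgt B s e ψ = c} : ℝ) / #{ψ | Agrees A B e a b ψ}

theorem maskProb_nonneg (A : Finset V → α) (B : Finset V → β) (s : S → I) (e : Finset I)
    (a : Finset I → α) (b : Finset I → β) (c₀ c : Finset S → β) :
    0 ≤ maskProb A B s e a b c₀ c := by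
  unfold maskProb; split_ifs <;> positivity

theorem sum_maskProb [Fintype S] [Fintype β] (A : Finset V → α) (B : Finset V → β) (s : S → I)
    (e : Finset I) (a : Finset I → α) (b : Finset I → β) (c₀ : Finset S → β) :
    ∑ c, maskProb A B s e a b c₀ c = 1 := by
  unfold maskProb
  split_ifs with h
  · refine (sum_eq_single c₀ (fun c _ hc => ?_) (fun h => absurd (mem_univ _) h)).trans ?_
    · exact if_neg hc
    · exact if_pos rfl
  · rw [← sum_div, div_eq_one_iff_eq (by exact_mod_cast h), ← Nat.cast_sum]
    congr 1
    rw [card_eq_sum_card_fiberwise (f := tgt B s e) (t := univ) (fun _ _ => by simp)]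
    refine sum_congr rfl fun c _ => ?_
    rw [filter_filter]
    congr!

theorem condProb_eq_maskProb (A : Finset V → α) (B : Finset V → β) (s : S → I) (e : Finset I)
    (c₀ c : Finset S → β) (ψ : I → V) (b : Finset I → β) (hb : ∀ D, ¬ e ⊆ D → b D = pat B ψ D) :
    condProb (patSetoid A B e) (tgt B s e) c ψ = maskProb A B s e (pat A ψ) b c₀ c := by
  have h : ∀ ψ', Agrees A B e (pat A ψ) b ψ' ↔ patSetoid A B e ψ' ψ := by
    intro ψ'
    refine forall_congr' fun D => and_congr Iff.rfl (forall_congr' fun hD => ?_)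
    rw [hb D hD]
  have h0 : #{ψ' | patSetoid A B e ψ' ψ} ≠ 0 := by
    have := card_class_pos (patSetoid A B e) ψ
    exact_mod_cast this.ne'
  unfold maskProb
  simp only [h]
  rw [if_neg h0, condProb]

theorem maskProb_congr (A : Finset V → α) (B : Finset V → β) (s : S → I) (e : Finset I)
    (a a' : Finset I → α) (b b' : Finset I → β) (c₀ c : Finset S → β) (ha : ∀ D, a D = a' D)
    (hb : ∀ D, ¬ e ⊆ D → b D = b' D) :
    maskProb A B s e a b c₀ c = maskProb A B s e a' b' c₀ c := by
  have h : ∀ ψ', Agrees A B e a b ψ' ↔ Agrees A B e a' b' ψ' := by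
    intro ψ'
    refine forall_congr' fun D => and_congr (by rw [ha]) (forall_congr' fun hD => ?_)
    rw [hb D hD]
  unfold maskProb
  simp only [h]

theorem maskProb_reindex (A : Finset V → α) (B : Finset V → β) (f : J ≃ I) (s : S → J)
    (e : Finset J) (a : Finset I → α) (b : Finset I → β) (c₀ c : Finset S → β) :
    maskProb A B s e (fun D => a (D.image f)) (fun D => b (D.image f)) c₀ c =
      maskProb A B (f ∘ s) (e.image f) a b c₀ c := by
  have h : ∀ ψ : I → V, Agrees A B e (fun D => a (D.image f)) (fun D => b (D.image f)) (ψ ∘ f) ↔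
      Agrees A B (e.image f) a b ψ := by
    intro ψ
    simp only [Agrees, pat_comp]
    constructor
    · intro h D
      have := h (D.image f.symm)
      simp only [image_image, Equiv.self_comp_symm, image_id] at this
      refine ⟨this.1, fun hD => this.2 fun hD' => hD ?_⟩
      have := image_subset_image (f := f) hD'
      simpa [image_image] using this
    · intro h D
      refine ⟨(h _).1, fun hD => (h _).2 ?_⟩
      rwa [image_subset_image_iff f.injective]
  have hcard : ∀ (P : (J → V) → Prop) [DecidablePred P],
      #{ψ : J → V | P ψ} = #{ψ : I → V | P (ψ ∘ f)} := by
    intro P _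
    symm
    refine card_equiv (f.symm.arrowCongr (Equiv.refl V)) fun ψ => ?_
    simp only [mem_filter, mem_univ, true_and]
    rfl
  unfold maskProb
  rw [hcard, hcard]
  simp only [h, tgt_comp]

end Patterns

end HypReg

namespace HypReg

open Finset

open scoped BigOperators

attribute [local instance 10] Classical.propDecidable

set_option linter.unusedSectionVars false

section SumIndex

variable {S S' R R' : Type} [DecidableEq S] [DecidableEq R] [DecidableEq S'] [DecidableEq R']

theorem toRight_image_map (f : S → S') (g : R → R') (D : Finset (S ⊕ R)) :
    (D.image (Sum.map f g)).toRight = D.toRight.image g := by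
  ext x; simp

theorem toLeft_image_map (f : S → S') (g : R → R') (D : Finset (S ⊕ R)) :
    (D.image (Sum.map f g)).toLeft = D.toLeft.image f := by
  ext x; simp

theorem image_inr_subset_iff (e : Finset R) (D : Finset (S ⊕ R)) :
    e.image Sum.inr ⊆ D ↔ e ⊆ D.toRight := by
  simp [Finset.subset_iff]

theorem image_map_inl (T : Type) [DecidableEq T] (D : Finset (S ⊕ R)) :
    (D.toLeft.image (Sum.inl ∘ Sum.inl : S → (S ⊕ T) ⊕ R)) ∪ D.toRight.image Sum.inr =
      D.image (Sum.map Sum.inl id) := by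
  ext x
  simp

end SumIndex

/-- `A` and `A'` have nearly the same statistics of `M`-vertex samples. -/
def Close {V V' α : Type} [Fintype V] [Fintype V'] [DecidableEq V] [DecidableEq V'] (M : ℕ)
    (γ : ℝ) (A : Finset V → α) (A' : Finset V' → α) : Prop :=
  ∀ Φ : (Finset (Fin M) → α) → ℝ, (∀ p, 0 ≤ Φ p) → (∀ p, Φ p ≤ 1) →
    |𝔼 ψ : Fin M → V, Φ (pat A ψ) - 𝔼 ψ : Fin M → V', Φ (pat A' ψ)| ≤ γ

section Close

variable {V V' α : Type} [Fintype V] [Fintype V'] [DecidableEq V] [DecidableEq V']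
  [Nonempty V] [Nonempty V']

theorem Close.apply {M : ℕ} {γ : ℝ} {A : Finset V → α} {A' : Finset V' → α}
    (h : Close M γ A A') {I : Type} [Fintype I] [DecidableEq I] (hI : Fintype.card I ≤ M)
    (Φ : (Finset I → α) → ℝ) (h0 : ∀ p, 0 ≤ Φ p) (h1 : ∀ p, Φ p ≤ 1) :
    |𝔼 ψ : I → V, Φ (pat A ψ) - 𝔼 ψ : I → V', Φ (pat A' ψ)| ≤ γ := by
  obtain ⟨f⟩ : Nonempty (I ↪ Fin M) := by
    rw [Function.Embedding.nonempty_iff_card_le]; simpa using hI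
  have key := h (fun p => Φ fun D => p (D.image f)) (fun _ => h0 _) (fun _ => h1 _)
  rw [← expect_comp_injective f f.injective, ← expect_comp_injective f f.injective]
  have e1 : ∀ ψ : Fin M → V, pat A (ψ ∘ f) = fun D => pat A ψ (D.image f) :=
    fun ψ => funext fun D => pat_comp _ _ _ _
  have e2 : ∀ ψ : Fin M → V', pat A' (ψ ∘ f) = fun D => pat A' ψ (D.image f) :=
    fun ψ => funext fun D => pat_comp _ _ _ _
  simpa only [e1, e2] using key

theorem Close.mono {M M' : ℕ} {γ γ' : ℝ} {A : Finset V → α} {A' : Finset V' → α}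
    (h : Close M γ A A') (hM : M' ≤ M) (hγ : γ ≤ γ') : Close M' γ' A A' :=
  fun Φ h0 h1 => (h.apply (by simpa using hM) Φ h0 h1).trans hγ

theorem Close.symm {M : ℕ} {γ : ℝ} {A : Finset V → α} {A' : Finset V' → α}
    (h : Close M γ A A') : Close M γ A' A := fun Φ h0 h1 => by
  rw [abs_sub_comm]; exact h Φ h0 h1

end Close

section Lift

variable {S R T β : Type}

/-- Forget the colours of the sets with at least `j` elements in the right component. -/
def truncR [Inhabited β] (j : ℕ) (b : Finset (S ⊕ R) → β) : Finset (S ⊕ R) → β :=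
  fun D => if #D.toRight < j then b D else default

/-- Extend a truncated pattern by colours for the sets with exactly `j` elements in the right
component. -/
noncomputable def comb [Inhabited β] (j : ℕ) (b : Finset (S ⊕ R) → β)
    (c : {e : Finset R // #e = j} → Finset S → β) : Finset (S ⊕ R) → β :=
  fun D => if #D.toRight < j then b D
    else if h : #D.toRight = j then c ⟨D.toRight, h⟩ D.toLeft else default

variable [Fintype S] [Fintype R] [Fintype T] [DecidableEq S] [DecidableEq R] [DecidableEq T]

/-- The embedding used to look at the base together with a set of right indices. -/
def baseEmb (S : Type) {R : Type} (e : Finset R) : S ⊕ e → S ⊕ R := Sum.map id Subtype.val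

theorem baseEmb_injective (e : Finset R) : Function.Injective (baseEmb S e) :=
  Function.injective_id.sumMap Subtype.val_injective

theorem image_baseEmb (e : Finset R) :
    ((univ : Finset e).image (Sum.inr : e → S ⊕ e)).image (baseEmb S e) = e.image Sum.inr := by
  ext x
  simp [baseEmb]

variable {V V' α : Type} [Fintype V] [Fintype V'] [DecidableEq V] [DecidableEq V']
  [Nonempty V] [Nonempty V'] [Fintype β] [Inhabited β]

theorem comb_tgt (B : Finset V → β) (j : ℕ) (ψ : (S ⊕ T) ⊕ R → V) :
    comb j (fun D => pat B ψ (D.image (Sum.map Sum.inl id)))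
      (fun e : {e : Finset R // #e = j} => tgt B (Sum.inl ∘ Sum.inl) (e.1.image Sum.inr) ψ) =
    truncR (j + 1) (fun D : Finset (S ⊕ R) => pat B ψ (D.image (Sum.map Sum.inl id))) := by
  funext D
  unfold comb truncR
  by_cases h1 : #D.toRight < j
  · rw [if_pos h1, if_pos (by omega)]
  · rw [if_neg h1]
    by_cases h2 : #D.toRight = j
    · rw [dif_pos h2, if_pos (by omega)]
      simp only [tgt, pat]
      rw [image_map_inl]
    · rw [dif_neg h2, if_neg (by omega)]

/-- The conditional law of the colours above a right set `e` given a pattern. -/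
noncomputable def kern (A : Finset V → α) (B : Finset V → β) (e : Finset R)
    (a : Finset ((S ⊕ T) ⊕ R) → α) (b : Finset ((S ⊕ T) ⊕ R) → β) (c : Finset S → β) : ℝ :=
  maskProb A B (Sum.inl ∘ Sum.inl) ((univ : Finset e).image Sum.inr)
    (fun D => a (D.image (baseEmb (S ⊕ T) e))) (fun D => b (D.image (baseEmb (S ⊕ T) e)))
    default c

theorem kern_nonneg (A : Finset V → α) (B : Finset V → β) (e : Finset R)
    (a : Finset ((S ⊕ T) ⊕ R) → α) (b : Finset ((S ⊕ T) ⊕ R) → β) (c : Finset S → β) :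
    0 ≤ kern A B e a b c := maskProb_nonneg _ _ _ _ _ _ _ _

theorem sum_kern (A : Finset V → α) (B : Finset V → β) (e : Finset R)
    (a : Finset ((S ⊕ T) ⊕ R) → α) (b : Finset ((S ⊕ T) ⊕ R) → β) :
    ∑ c : Finset S → β, kern A B e a b c = 1 := sum_maskProb _ _ _ _ _ _ _

/-- Replace the colours of rank `j` by samples from their conditional laws. -/
noncomputable def resample (A : Finset V → α) (B : Finset V → β) (j : ℕ)
    (Φ : (Finset (S ⊕ R) → α) → (Finset (S ⊕ R) → β) → ℝ)
    (a : Finset ((S ⊕ T) ⊕ R) → α) (b : Finset ((S ⊕ T) ⊕ R) → β) : ℝ :=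
  ∑ c : {e : Finset R // #e = j} → Finset S → β, (∏ e, kern A B e.1 a b (c e)) *
    Φ (fun D => a (D.image (Sum.map Sum.inl id)))
      (comb j (fun D => b (D.image (Sum.map Sum.inl id))) c)

theorem resample_nonneg (A : Finset V → α) (B : Finset V → β) (j : ℕ)
    (Φ : (Finset (S ⊕ R) → α) → (Finset (S ⊕ R) → β) → ℝ) (h0 : ∀ a b, 0 ≤ Φ a b)
    (a : Finset ((S ⊕ T) ⊕ R) → α) (b : Finset ((S ⊕ T) ⊕ R) → β) :
    0 ≤ resample A B j Φ a b :=
  sum_nonneg fun _ _ => mul_nonneg (prod_nonneg fun _ _ => kern_nonneg _ _ _ _ _ _) (h0 _ _)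

theorem resample_le_one (A : Finset V → α) (B : Finset V → β) (j : ℕ)
    (Φ : (Finset (S ⊕ R) → α) → (Finset (S ⊕ R) → β) → ℝ) (h1 : ∀ a b, Φ a b ≤ 1)
    (a : Finset ((S ⊕ T) ⊕ R) → α) (b : Finset ((S ⊕ T) ⊕ R) → β) :
    resample A B j Φ a b ≤ 1 := by
  refine le_trans (sum_le_sum fun c _ => mul_le_of_le_one_right
    (prod_nonneg fun _ _ => kern_nonneg _ _ _ _ _ _) (h1 _ _)) (le_of_eq ?_)
  exact sum_prod_weights_eq_one (fun (e : {e : Finset R // #e = j}) => kern A B e.1 a b)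
    fun e => sum_kern _ _ _ _ _

/-- The energy of the rank `j` colours given the lower rank pattern on the base `S ⊕ T`. -/
noncomputable def levelEnergy (S T : Type) [Fintype S] [Fintype T] [DecidableEq S]
    [DecidableEq T] (A : Finset V → α) (B : Finset V → β) (X : Type) [Fintype X]
    [DecidableEq X] : ℝ :=
  energy (patSetoid A B ((univ : Finset X).image (Sum.inr : X → (S ⊕ T) ⊕ X)))
    (tgt B (Sum.inl ∘ Sum.inl : S → (S ⊕ T) ⊕ X) ((univ : Finset X).image Sum.inr))

theorem source_resample (A : Finset V → α) (B : Finset V → β) (j : ℕ) {η : ℝ} (hη0 : 0 ≤ η)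
    (hη : ∀ e : Finset R, #e = j →
      energy (patSetoid A B (e.image (Sum.inr : R → (S ⊕ T) ⊕ R)))
        (tgt B (Sum.inl ∘ Sum.inl : S → (S ⊕ T) ⊕ R) (e.image Sum.inr)) -
        levelEnergy S T A B e ≤ η ^ 2)
    (Φ : (Finset (S ⊕ R) → α) → (Finset (S ⊕ R) → β) → ℝ)
    (h0 : ∀ a b, 0 ≤ Φ a b) (h1 : ∀ a b, Φ a b ≤ 1) :
    |𝔼 ψ : S ⊕ R → V, Φ (pat A ψ) (truncR (j + 1) (pat B ψ)) -
      𝔼 ψ : (S ⊕ T) ⊕ R → V, resample A B j Φ (pat A ψ) (truncR j (pat B ψ))| ≤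
      Fintype.card {e : Finset R // #e = j} * (Fintype.card (Finset S → β) * η) := by
  have hι : Function.Injective (Sum.map Sum.inl id : S ⊕ R → (S ⊕ T) ⊕ R) :=
    Sum.inl_injective.sumMap Function.injective_id
  rw [← expect_comp_injective _ hι]
  let E := {e : Finset R // #e = j}
  let r : E → Setoid ((S ⊕ T) ⊕ R → V) := fun e =>
    (patSetoid A B ((univ : Finset e.1).image Sum.inr)).comap fun ψ => ψ ∘ baseEmb (S ⊕ T) e.1
  let r' : E → Setoid ((S ⊕ T) ⊕ R → V) := fun e => patSetoid A B (e.1.image Sum.inr)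
  let C : E → ((S ⊕ T) ⊕ R → V) → (Finset S → β) := fun e =>
    tgt B (Sum.inl ∘ Sum.inl) (e.1.image Sum.inr)
  let Ψ : ((S ⊕ T) ⊕ R → V) → (E → Finset S → β) → ℝ := fun ψ c =>
    Φ (fun D => pat A ψ (D.image (Sum.map Sum.inl id)))
      (comb j (fun D => pat B ψ (D.image (Sum.map Sum.inl id))) c)
  have hCe : ∀ e : E, C e = fun ψ => tgt B (Sum.inl ∘ Sum.inl)
      ((univ : Finset e.1).image Sum.inr) (ψ ∘ baseEmb (S ⊕ T) e.1) := by
    intro e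
    funext ψ
    rw [tgt_comp, image_baseEmb]
    rfl
  have hlow : ∀ (e : E) (D : Finset ((S ⊕ T) ⊕ R)), ¬ D.toRight = e.1 → #D.toRight ≤ j →
      ¬ e.1.image Sum.inr ⊆ D := by
    intro e D h1 h2 h3
    rw [image_inr_subset_iff] at h3
    exact h1 (eq_of_subset_of_card_le h3 (by rw [e.2]; exact h2)).symm
  have hlow' : ∀ (e : E) (D : Finset ((S ⊕ T) ⊕ R)), #D.toRight < j →
      ¬ e.1.image Sum.inr ⊆ D := by
    intro e D h1 h3
    rw [image_inr_subset_iff] at h3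
    have := card_le_card h3
    rw [e.2] at this
    omega
  have hsub : ∀ (e : E) (D : Finset ((S ⊕ T) ⊕ e.1)), ¬ (univ : Finset e.1).image Sum.inr ⊆ D →
      #(D.image (baseEmb _ e.1)).toRight < j := by
    intro e D hD
    rw [baseEmb, toRight_image_map, card_image_of_injective _ Subtype.val_injective]
    have h3 : #D.toRight < Fintype.card e.1 := by
      refine lt_of_le_of_ne (card_le_univ _) fun h4 => hD ?_
      rw [image_inr_subset_iff, (card_eq_iff_eq_univ _).1 h4]
    rwa [Fintype.card_coe, e.2] at h3
  have main := abs_expect_sub_resample_all_le r r' C hη0 ?_ ?_ ?_ ?_ Ψ ?_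
    (fun _ _ => h0 _ _) (fun _ _ => h1 _ _)
  · have e1 : ∀ ψ : (S ⊕ T) ⊕ R → V, Φ (pat A (ψ ∘ Sum.map Sum.inl id))
        (truncR (j + 1) (pat B (ψ ∘ Sum.map Sum.inl id))) = Ψ ψ fun e => C e ψ := by
      intro ψ
      simp only [Ψ, C]
      rw [comb_tgt]
      congr 1
      · exact funext fun D => pat_comp _ _ _ _
      · congr 1
        exact funext fun D => pat_comp _ _ _ _
    have e2 : ∀ ψ : (S ⊕ T) ⊕ R → V, resample A B j Φ (pat A ψ) (truncR j (pat B ψ)) =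
        ∑ c : E → Finset S → β, (∏ e, condProb (r e) (C e) (c e) ψ) * Ψ ψ c := by
      intro ψ
      refine sum_congr rfl fun c _ => ?_
      congr 1
      · refine prod_congr rfl fun e _ => ?_
        rw [hCe e, condProb_comap _ (baseEmb_injective e.1),
          condProb_eq_maskProb _ _ _ _ default _ _
          (fun D => truncR j (pat B ψ) (D.image (baseEmb _ e.1)))]
        · exact maskProb_congr _ _ _ _ _ _ _ _ _ _ (fun D => (pat_comp _ _ _ _).symm)
            fun _ _ => rfl
        · intro D hD
          rw [pat_comp, truncR, if_pos (hsub e D hD)]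
      · simp only [Ψ]
        congr 1
        funext D
        unfold comb
        split_ifs with h
        · refine if_pos ?_
          rwa [toRight_image_map, image_id]
        · rfl
        · rfl
    simp only [e1, e2]
    exact main
  · intro e
    have := patSetoid_le_comap A B ((univ : Finset e.1).image Sum.inr) (baseEmb (S ⊕ T) e.1)
      (baseEmb_injective e.1)
    rwa [image_baseEmb] at this
  · intro e
    have h3 : energy (r e) (C e) = levelEnergy S T A B e.1 := by
      rw [hCe e]
      exact energy_comap _ (baseEmb_injective e.1) _ _
    rw [h3]
    exact hη e.1 e.2
  · intro e e' ψ ψ' hne h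
    funext D
    refine (h _).2 (hlow e _ ?_ ?_)
    · intro h3
      apply hne
      apply Subtype.ext
      rw [← h3]
      ext x; simp
    · have : (D.image (Sum.inl ∘ Sum.inl : S → (S ⊕ T) ⊕ R) ∪ e'.1.image Sum.inr).toRight
        = e'.1 := by ext x; simp
      rw [this, e'.2]
  · intro e e' ψ ψ' h D
    simp only [pat_comp]
    exact ⟨(h _).1, fun hD => (h _).2 (hlow' e _ (hsub e' D hD))⟩
  · intro e ψ ψ' h
    funext c
    simp only [Ψ]
    congr 1
    · exact funext fun D => (h _).1
    · funext D
      unfold comb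
      split_ifs with h3
      · refine (h _).2 (hlow' e _ ?_)
        rwa [toRight_image_map, image_id]
      · rfl
      · rfl

end Lift

end HypReg

namespace HypReg

open Finset

open scoped BigOperators

attribute [local instance 10] Classical.propDecidable

set_option linter.unusedSectionVars false

section Target

variable {S R T α β V V' : Type} [Fintype S] [Fintype R] [Fintype T] [DecidableEq S]
  [DecidableEq R] [DecidableEq T] [Fintype V] [Fintype V'] [DecidableEq V] [DecidableEq V']
  [Nonempty V] [Nonempty V'] [Fintype β] [Inhabited β]

/-- The conditional law of the colours above a set `e` of target vertices. -/
noncomputable def targetKern (A : Finset V → α) (B : Finset V → β) (A' : Finset V' → α)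
    (σ : S ⊕ T → V') (b' : Finset V' → Finset (S ⊕ T) → β) (e : Finset V')
    (c : Finset S → β) : ℝ :=
  maskProb A B (Sum.inl ∘ Sum.inl) ((univ : Finset e).image Sum.inr)
    (fun D : Finset ((S ⊕ T) ⊕ e) => A' (D.image (Sum.elim σ Subtype.val)))
    (fun D => b' (D.toRight.image Subtype.val) D.toLeft) default c

/-- Add the colours of rank `j` to a colouring. -/
noncomputable def extendAt (j : ℕ) (b' : Finset V' → Finset (S ⊕ T) → β)
    (c : {e : Finset V' // #e = j} → Finset S → β) : Finset V' → Finset S → β :=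
  fun e D => if h : #e = j then c ⟨e, h⟩ D else b' e (D.image Sum.inl)

theorem kern_eq_targetKern (A : Finset V → α) (B : Finset V → β) (A' : Finset V' → α)
    (σ : S ⊕ T → V') (b' : Finset V' → Finset (S ⊕ T) → β) (e : Finset R) (φ : R → V')
    (hφ : Function.Injective φ) (c : Finset S → β) :
    kern A B e (pat A' (Sum.elim σ φ)) (truncR #e fun D => b' (D.toRight.image φ) D.toLeft) c =
      targetKern A B A' σ b' (e.image φ) c := by
  let g : e ≃ (e.image φ : Finset V') := Equiv.ofBijective
    (fun x => ⟨φ x, mem_image_of_mem φ x.2⟩) ⟨fun x y h => by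
      exact Subtype.ext (hφ (Subtype.ext_iff.1 h)), fun y => by
      obtain ⟨y, hy⟩ := y
      obtain ⟨x, hx, rfl⟩ := mem_image.1 hy
      exact ⟨⟨x, hx⟩, rfl⟩⟩
  let f : (S ⊕ T) ⊕ e ≃ (S ⊕ T) ⊕ (e.image φ : Finset V') := Equiv.sumCongr (Equiv.refl _) g
  have key := maskProb_reindex A B f (Sum.inl ∘ Sum.inl : S → (S ⊕ T) ⊕ e)
    ((univ : Finset e).image Sum.inr)
    (fun D => A' (D.image (Sum.elim σ Subtype.val)))
    (fun D => b' (D.toRight.image Subtype.val) D.toLeft) default c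
  have h1 : ((univ : Finset e).image (Sum.inr : e → (S ⊕ T) ⊕ e)).image f =
      univ.image Sum.inr := by
    ext x
    rcases x with x | x
    · simp [f]
    · simp only [mem_image, mem_univ, true_and, exists_exists_eq_and, Sum.inr.injEq, exists_eq,
        iff_true]
      exact ⟨g.symm x, by simp [f]⟩
  have h2 : f ∘ (Sum.inl ∘ Sum.inl : S → (S ⊕ T) ⊕ e) = Sum.inl ∘ Sum.inl := rfl
  rw [h1, h2] at key
  rw [targetKern, ← key, kern]
  refine maskProb_congr _ _ _ _ _ _ _ _ _ _ (fun D => ?_) fun D hD => ?_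
  · simp only [pat, image_image]
    congr 2
    funext x
    rcases x with x | x <;> rfl
  · have h3 : #D.toRight < #e := by
      rw [← Fintype.card_coe e]
      refine lt_of_le_of_ne (card_le_univ _) fun h4 => hD ?_
      rw [image_inr_subset_iff, (card_eq_iff_eq_univ _).1 h4]
    have h5 : (D.image (baseEmb (S ⊕ T) e)).toRight = D.toRight.image Subtype.val :=
      toRight_image_map _ _ _
    have h6 : (D.image (baseEmb (S ⊕ T) e)).toLeft = D.toLeft.image id := toLeft_image_map _ _ _
    have h7 : (D.image f).toRight = D.toRight.image g := toRight_image_map _ _ _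
    have h8 : (D.image f).toLeft = D.toLeft.image id := toLeft_image_map _ _ _
    rw [truncR, h5, h6, h7, h8, if_pos]
    · simp only [image_image]
      rfl
    · rwa [card_image_of_injective _ Subtype.val_injective]

theorem target_resample (A : Finset V → α) (B : Finset V → β) (A' : Finset V' → α) (j : ℕ)
    (σ : S ⊕ T → V') (b' : Finset V' → Finset (S ⊕ T) → β) (φ : R → V')
    (hφ : Function.Injective φ) (Φ : (Finset (S ⊕ R) → α) → (Finset (S ⊕ R) → β) → ℝ) :
    resample A B j Φ (pat A' (Sum.elim σ φ))
        (truncR j fun D => b' (D.toRight.image φ) D.toLeft) =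
      ∑ c : {e : Finset V' // #e = j} → Finset S → β,
        (∏ e, targetKern A B A' σ b' e.1 (c e)) *
          Φ (pat A' (Sum.elim (σ ∘ Sum.inl) φ))
            (truncR (j + 1) fun D => extendAt j b' c (D.toRight.image φ) D.toLeft) := by
  let κ : {e : Finset R // #e = j} → {e : Finset V' // #e = j} := fun e =>
    ⟨e.1.image φ, by rw [card_image_of_injective _ hφ, e.2]⟩
  have hκ : Function.Injective κ := by
    intro e e' h
    exact Subtype.ext (image_injective hφ (Subtype.ext_iff.1 h))
  have h1 : ∀ c : {e : Finset V' // #e = j} → Finset S → β,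
      (truncR (j + 1) fun D : Finset (S ⊕ R) => extendAt j b' c (D.toRight.image φ) D.toLeft) =
        comb j (fun D => truncR j (fun D => b' (D.toRight.image φ) D.toLeft)
          (D.image (Sum.map Sum.inl id))) (c ∘ κ) := by
    intro c
    funext D
    unfold truncR comb extendAt
    simp only [toRight_image_map, toLeft_image_map, image_id, card_image_of_injective _ hφ]
    by_cases h2 : #D.toRight < j
    · rw [if_pos h2, if_pos (by omega), if_pos h2, dif_neg (by omega)]
    · rw [if_neg h2]
      by_cases h3 : #D.toRight = j
      · rw [if_pos (by omega), dif_pos h3, dif_pos h3]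
        rfl
      · rw [if_neg (by omega), dif_neg h3]
  have h2 : pat A' (Sum.elim (σ ∘ Sum.inl) φ) =
      fun D : Finset (S ⊕ R) => pat A' (Sum.elim σ φ) (D.image (Sum.map Sum.inl id)) := by
    funext D
    rw [← pat_comp]
    congr 1
    funext x
    rcases x with x | x <;> rfl
  simp only [h1, h2]
  have h3 := sum_prod_weights_comp (fun e : {e : Finset V' // #e = j} =>
    targetKern A B A' σ b' e.1) (fun e => sum_maskProb _ _ _ _ _ _ _) κ hκ
    (fun c => Φ (fun D : Finset (S ⊕ R) => pat A' (Sum.elim σ φ) (D.image (Sum.map Sum.inl id)))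
      (comb j (fun D => truncR j (fun D => b' (D.toRight.image φ) D.toLeft)
          (D.image (Sum.map Sum.inl id))) c))
  rw [h3, resample]
  refine sum_congr rfl fun c _ => ?_
  congr 1
  refine prod_congr rfl fun e _ => ?_
  have h4 := kern_eq_targetKern A B A' σ b' e.1 φ hφ (c e)
  rw [e.2] at h4
  exact h4

end Target

/-- A random lift of a colouring: up to rank `j`, relative to a base `S`, seen on `R`. -/
def LiftProp (α β : Type) [Fintype β] [Inhabited β] (j : ℕ) : Prop :=
  ∀ (S R : Type) [Fintype S] [DecidableEq S] [Fintype R] [DecidableEq R] (γ : ℝ), 0 < γ →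
  ∃ (M : ℕ) (γ' : ℝ) (n₀ : ℕ), 0 < γ' ∧
  ∀ (V V' : Type) [Fintype V] [DecidableEq V] [Nonempty V] [Fintype V'] [DecidableEq V']
    [Nonempty V'], n₀ ≤ Fintype.card V' →
  ∀ (A : Finset V → α) (A' : Finset V' → α), Close M γ' A A' → ∀ B : Finset V → β,
  ∃ (Ω : Type) (_ : Fintype Ω) (w : Ω → ℝ) (σ : Ω → S → V')
    (b' : Ω → Finset V' → Finset S → β), (∀ ω, 0 ≤ w ω) ∧ ∑ ω, w ω = 1 ∧
  ∀ Φ : (Finset (S ⊕ R) → α) → (Finset (S ⊕ R) → β) → ℝ, (∀ a b, 0 ≤ Φ a b) →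
    (∀ a b, Φ a b ≤ 1) →
    |𝔼 ψ : S ⊕ R → V, Φ (pat A ψ) (truncR j (pat B ψ)) -
      ∑ ω, w ω * 𝔼 φ : R → V', Φ (pat A' (Sum.elim (σ ω) φ))
        (truncR j fun D => b' ω (D.toRight.image φ) D.toLeft)| ≤ γ

variable {α β : Type} [Fintype β] [Inhabited β]

theorem liftProp_zero : LiftProp α β 0 := by
  intro S R _ _ _ _ γ hγ
  refine ⟨Fintype.card (S ⊕ R), γ, 0, hγ, ?_⟩
  intro V V' _ _ _ _ _ _ _ A A' hA B
  refine ⟨S → V', inferInstance, fun _ => 1 / Fintype.card (S → V'), id, fun _ _ _ => default,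
    fun _ => by positivity, by simp, ?_⟩
  intro Φ h0 h1
  have h2 : ∀ b : Finset (S ⊕ R) → β, truncR 0 b = fun _ => default := by
    intro b; funext D; simp [truncR]
  simp only [h2]
  have h3 := hA.apply le_rfl (fun p => Φ p fun _ => default) (fun _ => h0 _ _) (fun _ => h1 _ _)
  convert h3 using 3
  rw [Fintype.expect_equiv (Equiv.sumArrowEquivProdArrow S R V') (fun ψ => Φ (pat A' ψ) fun _ =>
    default) (fun p => Φ (pat A' (Sum.elim p.1 p.2)) fun _ => default)]
  · rw [← univ_product_univ, expect_product, Fintype.expect_eq_sum_div_card, sum_div]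
    exact sum_congr rfl fun _ _ => by simp only [id]; ring
  · intro ψ
    congr 2
    funext x
    rcases x with x | x <;> rfl

theorem energy_le_levelEnergy_succ {S R V : Type} [Fintype S] [DecidableEq S] [Fintype R]
    [DecidableEq R] [Fintype V] [DecidableEq V] [Nonempty V] (A : Finset V → α)
    (B : Finset V → β) (i j : ℕ) (e : Finset R) (he : #e = j) :
    energy (patSetoid A B (e.image (Sum.inr : R → (S ⊕ (Fin i × R)) ⊕ R)))
      (tgt B (Sum.inl ∘ Sum.inl : S → (S ⊕ (Fin i × R)) ⊕ R) (e.image Sum.inr)) ≤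
      levelEnergy S (Fin (i + 1) × R) A B (Fin j) := by
  let g : e ≃ Fin j := equivFinOfCardEq he
  let f : (S ⊕ (Fin i × R)) ⊕ R → (S ⊕ (Fin (i + 1) × R)) ⊕ Fin j :=
    Sum.elim (Sum.inl ∘ Sum.map id (Prod.map Fin.castSucc id))
      fun x => if h : x ∈ e then Sum.inr (g ⟨x, h⟩) else Sum.inl (Sum.inr (Fin.last i, x))
  have hf : Function.Injective f := by
    rintro ((x | ⟨a, x⟩) | x) ((y | ⟨b, y⟩) | y) h <;>
      simp only [f, Sum.elim_inl, Sum.elim_inr, Function.comp] at h <;>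
      (try split_ifs at h) <;>
      simp_all [Fin.castSucc_ne_last, (Fin.castSucc_ne_last _).symm]
  have h := energy_patSetoid_le A B (e.image Sum.inr) (Sum.inl ∘ Sum.inl) f hf
  have h1 : (e.image Sum.inr).image f = (univ : Finset (Fin j)).image Sum.inr := by
    ext x
    simp only [mem_image, mem_univ, true_and, exists_exists_and_eq_and]
    constructor
    · rintro ⟨y, hy, rfl⟩
      exact ⟨g ⟨y, hy⟩, by simp [f, hy]⟩
    · rintro ⟨y, rfl⟩
      exact ⟨(g.symm y).1, (g.symm y).2, by simp [f]⟩
  rw [h1] at h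
  exact h

theorem levelEnergy_fin_le {S T V R : Type} [Fintype S] [DecidableEq S] [Fintype T]
    [DecidableEq T] [DecidableEq R] [Fintype V] [DecidableEq V] [Nonempty V] (A : Finset V → α)
    (B : Finset V → β) (j : ℕ) (e : Finset R) (he : #e = j) :
    levelEnergy S T A B (Fin j) ≤ levelEnergy S T A B e := by
  let g : Fin j ≃ e := (equivFinOfCardEq he).symm
  have h := energy_patSetoid_le A B ((univ : Finset (Fin j)).image Sum.inr)
    (Sum.inl ∘ Sum.inl) (Sum.map id g : (S ⊕ T) ⊕ Fin j → (S ⊕ T) ⊕ e)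
    (Function.injective_id.sumMap g.injective)
  have h1 : ((univ : Finset (Fin j)).image Sum.inr).image
      (Sum.map id g : (S ⊕ T) ⊕ Fin j → (S ⊕ T) ⊕ e) = univ.image Sum.inr := by
    ext x
    simp only [mem_image, mem_univ, true_and, exists_exists_eq_and, Sum.map_inr]
    constructor
    · rintro ⟨y, rfl⟩
      exact ⟨g y, rfl⟩
    · rintro ⟨y, rfl⟩
      exact ⟨g.symm y, by simp⟩
  rw [h1] at h
  exact h

theorem exists_small_increment (f : ℕ → ℝ) (h0 : ∀ i, 0 ≤ f i) (h1 : ∀ i, f i ≤ 1) (K : ℕ)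
    (hK : 0 < K) : ∃ i < K, f (i + 1) - f i ≤ 1 / K := by
  by_contra! h
  have hs := sum_range_sub f K
  have : ∑ i ∈ range K, (1 / (K:ℝ)) < ∑ i ∈ range K, (f (i + 1) - f i) :=
    sum_lt_sum_of_nonempty (by simpa using hK.ne') fun i hi => h i (mem_range.1 hi)
  rw [hs, sum_const, card_range, nsmul_eq_mul, mul_one_div_cancel (by exact_mod_cast hK.ne')]
    at this
  linarith [h0 0, h1 K]

theorem exists_pos_le (g : ℕ → ℝ) (hg : ∀ i, 0 < g i) (K : ℕ) :
    ∃ x, 0 < x ∧ ∀ i < K, x ≤ g i := by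
  induction K with
  | zero => exact ⟨1, one_pos, by simp⟩
  | succ K ih =>
    obtain ⟨x, hx, h⟩ := ih
    refine ⟨min x (g K), lt_min hx (hg K), fun i hi => ?_⟩
    rcases Nat.lt_succ_iff_lt_or_eq.1 hi with h1 | rfl
    · exact (min_le_left _ _).trans (h i h1)
    · exact min_le_right _ _

theorem abs_weighted_sub_le {Ω : Type} [Fintype Ω] (w x y : Ω → ℝ) (hw : ∀ ω, 0 ≤ w ω)
    (h1 : ∑ ω, w ω = 1) (b : ℝ) (h : ∀ ω, |x ω - y ω| ≤ b) :
    |∑ ω, w ω * x ω - ∑ ω, w ω * y ω| ≤ b := by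
  rw [← sum_sub_distrib]
  refine (abs_sum_le_sum_abs _ _).trans ?_
  calc _ ≤ ∑ ω, w ω * b := sum_le_sum fun ω _ => by
        rw [← mul_sub, abs_mul, abs_of_nonneg (hw ω)]
        exact mul_le_mul_of_nonneg_left (h ω) (hw ω)
    _ = b := by rw [← sum_mul, h1, one_mul]

theorem abs_expect_sub_le_of_injective {R V : Type} [Fintype R] [DecidableEq R] [Fintype V]
    [Nonempty V] (f g : (R → V) → ℝ) (h : ∀ φ, Function.Injective φ → f φ = g φ)
    (hb : ∀ φ, |f φ - g φ| ≤ 1) :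
    |𝔼 φ, f φ - 𝔼 φ, g φ| ≤ (Fintype.card R : ℝ) ^ 2 / Fintype.card V := by
  rw [← expect_sub_distrib]
  refine (abs_expect_le' _).trans (le_trans (expect_le_expect fun φ _ => ?_)
    expect_not_injective_le)
  split_ifs with hφ
  · rw [h φ hφ, sub_self, abs_zero]
  · exact hb φ

theorem abs_sub_le_one {x y : ℝ} (hx : 0 ≤ x) (hx1 : x ≤ 1) (hy : 0 ≤ y) (hy1 : y ≤ 1) :
    |x - y| ≤ 1 := by
  rw [abs_le]; constructor <;> linarith

theorem liftProp_succ (j : ℕ) (ih : LiftProp α β j) : LiftProp α β (j + 1) := by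
  intro S R _ _ _ _ γ hγ
  set c₁ : ℝ := ((Fintype.card {e : Finset R // #e = j} : ℕ) : ℝ) with hc₁
  set c₂ : ℝ := ((Fintype.card (Finset S → β) : ℕ) : ℝ) with hc₂
  have hc₁0 : 0 ≤ c₁ := Nat.cast_nonneg _
  have hc₂0 : 0 ≤ c₂ := Nat.cast_nonneg _
  set η : ℝ := γ / (3 * (c₁ * c₂ + 1)) with hη
  have hη0 : 0 < η := by positivity
  have hηb : c₁ * (c₂ * η) ≤ γ / 3 := by
    rw [hη, ← mul_assoc, mul_div_assoc', div_le_div_iff₀ (by positivity) (by norm_num)]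
    nlinarith [mul_nonneg hc₁0 hc₂0]
  obtain ⟨K, hK⟩ := exists_nat_gt (1 / η ^ 2)
  have hK0 : (0:ℝ) < K := lt_trans (by positivity) hK
  have hKη : 1 / (K:ℝ) ≤ η ^ 2 := by
    rw [div_le_iff₀ hK0]
    rw [div_lt_iff₀ (by positivity)] at hK
    linarith
  have hih := fun i : ℕ => ih (S ⊕ (Fin i × R)) R (γ / 3) (by positivity)
  choose M g n₀ hg hM using hih
  obtain ⟨γ', hγ', hγ'g⟩ := exists_pos_le g hg K
  obtain ⟨n₁, hn₁⟩ := exists_nat_gt ((Fintype.card R : ℝ) ^ 2 / (γ / 3))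
  refine ⟨(range K).sup M, γ', max ((range K).sup n₀) n₁, hγ', ?_⟩
  intro V V' _ _ _ _ _ _ hV' A A' hA B
  obtain ⟨i, hiK, hi⟩ := exists_small_increment
    (fun i => levelEnergy S (Fin i × R) A B (Fin j)) (fun _ => energy_nonneg _ _)
    (fun _ => energy_le_one _ _) K (by exact_mod_cast hK0)
  have hiK' : i ∈ range K := mem_range.2 hiK
  obtain ⟨Ω, _, w, σ, b', hw0, hw1, hw⟩ := hM i V V'
    ((le_sup (f := n₀) hiK').trans ((le_max_left _ _).trans hV')) A A'
    (hA.mono (le_sup (f := M) hiK') (hγ'g i hiK)) B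
  refine ⟨Ω × ({e : Finset V' // #e = j} → Finset S → β), inferInstance,
    fun p => w p.1 * ∏ e, targetKern A B A' (σ p.1) (b' p.1) e.1 (p.2 e),
    fun p => σ p.1 ∘ Sum.inl, fun p => extendAt j (b' p.1) p.2,
    fun p => mul_nonneg (hw0 _) (prod_nonneg fun _ _ => maskProb_nonneg _ _ _ _ _ _ _ _),
    ?_, ?_⟩
  · rw [Fintype.sum_prod_type]
    simp only [← mul_sum]
    rw [← hw1]
    refine sum_congr rfl fun ω _ => ?_
    rw [sum_prod_weights_eq_one (fun e : {e : Finset V' // #e = j} =>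
      targetKern A B A' (σ ω) (b' ω) e.1) fun e => sum_maskProb _ _ _ _ _ _ _, mul_one]
  intro Φ h0 h1
  have s1 := source_resample (T := Fin i × R) A B j hη0.le (fun e he => by
    have e1 := energy_le_levelEnergy_succ (S := S) A B i j e he
    have e2 := levelEnergy_fin_le (S := S) (T := Fin i × R) A B j e he
    linarith) Φ h0 h1
  have s2 := hw (resample A B j Φ) (resample_nonneg A B j Φ h0) (resample_le_one A B j Φ h1)
  have s3 : |∑ ω, w ω * 𝔼 φ : R → V', resample A B j Φ (pat A' (Sum.elim (σ ω) φ))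
        (truncR j fun D => b' ω (D.toRight.image φ) D.toLeft) -
      ∑ ω, w ω * 𝔼 φ : R → V', ∑ c : {e : Finset V' // #e = j} → Finset S → β,
        (∏ e, targetKern A B A' (σ ω) (b' ω) e.1 (c e)) *
          Φ (pat A' (Sum.elim (σ ω ∘ Sum.inl) φ))
            (truncR (j + 1) fun D => extendAt j (b' ω) c (D.toRight.image φ) D.toLeft)| ≤
      γ / 3 := by
    refine abs_weighted_sub_le _ _ _ hw0 hw1 _ fun ω => ?_
    refine (abs_expect_sub_le_of_injective _ _
      (fun φ hφ => target_resample A B A' j (σ ω) (b' ω) φ hφ Φ) fun φ => ?_).trans ?_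
    · refine abs_sub_le_one (resample_nonneg A B j Φ h0 _ _) (resample_le_one A B j Φ h1 _ _)
        (sum_nonneg fun c _ => mul_nonneg
          (prod_nonneg fun _ _ => maskProb_nonneg _ _ _ _ _ _ _ _) (h0 _ _)) ?_
      rw [← sum_prod_weights_eq_one (fun e : {e : Finset V' // #e = j} =>
        targetKern A B A' (σ ω) (b' ω) e.1) fun e => sum_maskProb _ _ _ _ _ _ _]
      exact sum_le_sum fun c _ => mul_le_of_le_one_right
        (prod_nonneg fun _ _ => maskProb_nonneg _ _ _ _ _ _ _ _) (h1 _ _)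
    · have h2 : (n₁ : ℝ) ≤ Fintype.card V' := by exact_mod_cast (le_max_right _ _).trans hV'
      rw [div_le_iff₀ (by positivity)]
      rw [div_lt_iff₀ (by positivity)] at hn₁
      nlinarith
  have s4 : ∑ p : Ω × ({e : Finset V' // #e = j} → Finset S → β),
      (w p.1 * ∏ e, targetKern A B A' (σ p.1) (b' p.1) e.1 (p.2 e)) *
        𝔼 φ : R → V', Φ (pat A' (Sum.elim (σ p.1 ∘ Sum.inl) φ))
          (truncR (j + 1) fun D => extendAt j (b' p.1) p.2 (D.toRight.image φ) D.toLeft) =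
      ∑ ω, w ω * 𝔼 φ : R → V', ∑ c : {e : Finset V' // #e = j} → Finset S → β,
        (∏ e, targetKern A B A' (σ ω) (b' ω) e.1 (c e)) *
          Φ (pat A' (Sum.elim (σ ω ∘ Sum.inl) φ))
            (truncR (j + 1) fun D => extendAt j (b' ω) c (D.toRight.image φ) D.toLeft) := by
    rw [Fintype.sum_prod_type]
    refine sum_congr rfl fun ω _ => ?_
    rw [expect_sum_comm, mul_sum]
    refine sum_congr rfl fun c _ => ?_
    rw [← mul_expect]
    ring
  rw [s4]
  rw [abs_le] at *
  constructor <;> linarith [s1.1, s1.2, s2.1, s2.2, s3.1, s3.2]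

theorem liftProp (j : ℕ) : LiftProp α β j := by
  induction j with
  | zero => exact liftProp_zero
  | succ j ih => exact liftProp_succ j ih

end HypReg

namespace HypReg

open Finset

open scoped BigOperators

attribute [local instance 10] Classical.propDecidable

set_option linter.unusedSectionVars false

theorem expect_sum_arrow {I J V : Type} [Fintype I] [DecidableEq I] [Fintype J] [DecidableEq J]
    [Fintype V] (f : (I → V) → ℝ) (g : (J → V) → ℝ) :
    𝔼 ψ : I ⊕ J → V, f (ψ ∘ Sum.inl) * g (ψ ∘ Sum.inr) =
      (𝔼 ψ : I → V, f ψ) * 𝔼 ψ : J → V, g ψ := by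
  rw [Fintype.expect_equiv (Equiv.sumArrowEquivProdArrow I J V)
    (fun ψ => f (ψ ∘ Sum.inl) * g (ψ ∘ Sum.inr)) (fun p => f p.1 * g p.2) fun _ => rfl,
    ← univ_product_univ, expect_product]
  simp only [← mul_expect, ← expect_mul]

theorem exists_le_of_weighted {Ω : Type} [Fintype Ω] (w x : Ω → ℝ) (hw : ∀ ω, 0 ≤ w ω)
    (h1 : ∑ ω, w ω = 1) (b : ℝ) (h : ∑ ω, w ω * x ω ≤ b) : ∃ ω, x ω ≤ b := by
  by_contra! hx
  have h2 : ∑ ω, w ω * b < ∑ ω, w ω * x ω := by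
    refine sum_lt_sum (fun ω _ => mul_le_mul_of_nonneg_left (hx ω).le (hw ω)) ?_
    have : ∃ ω, 0 < w ω := by
      by_contra! h0
      have : ∑ ω, w ω ≤ 0 := sum_nonpos fun ω _ => h0 ω
      linarith
    obtain ⟨ω, hω⟩ := this
    exact ⟨ω, mem_univ _, mul_lt_mul_of_pos_left (hx ω) hω⟩
  rw [← sum_mul, h1, one_mul] at h2
  linarith

/-- It is enough to compare the frequencies of single patterns. -/
theorem Close.of_patterns {V V' κ : Type} [Fintype V] [Fintype V'] [DecidableEq V]
    [DecidableEq V'] [Fintype κ] [DecidableEq κ] {M : ℕ} {γ : ℝ} (Z : Finset V → κ) (Z' : Finset V' → κ)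
    (h : ∀ F : Finset (Fin M) → κ,
      |𝔼 ψ : Fin M → V, (if pat Z ψ = F then (1:ℝ) else 0) -
        𝔼 ψ : Fin M → V', (if pat Z' ψ = F then (1:ℝ) else 0)| ≤
        γ / Fintype.card (Finset (Fin M) → κ)) (hγ : 0 ≤ γ) : Close M γ Z Z' := by
  intro Φ h0 h1
  have key : ∀ p : Finset (Fin M) → κ, Φ p = ∑ F, Φ F * (if p = F then (1:ℝ) else 0) := by
    intro p; simp
  have e1 : 𝔼 ψ : Fin M → V, Φ (pat Z ψ) =
      ∑ F, Φ F * 𝔼 ψ : Fin M → V, (if pat Z ψ = F then (1:ℝ) else 0) := by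
    rw [expect_congr rfl fun ψ _ => key (pat Z ψ), expect_sum_comm]
    simp only [← mul_expect]
  have e2 : 𝔼 ψ : Fin M → V', Φ (pat Z' ψ) =
      ∑ F, Φ F * 𝔼 ψ : Fin M → V', (if pat Z' ψ = F then (1:ℝ) else 0) := by
    rw [expect_congr rfl fun ψ _ => key (pat Z' ψ), expect_sum_comm]
    simp only [← mul_expect]
  rw [e1, e2, ← sum_sub_distrib]
  refine (abs_sum_le_sum_abs _ _).trans ?_
  calc _ ≤ ∑ F : Finset (Fin M) → κ, γ / Fintype.card (Finset (Fin M) → κ) := by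
        refine sum_le_sum fun F _ => ?_
        rw [← mul_sub, abs_mul, abs_of_nonneg (h0 F)]
        exact (mul_le_of_le_one_left (abs_nonneg _) (h1 F)).trans (h F)
    _ ≤ γ := by
        rw [sum_const, card_univ, nsmul_eq_mul]
        rcases eq_or_ne (Fintype.card (Finset (Fin M) → κ)) 0 with h | h
        · simpa [h] using hγ
        · rw [mul_div_cancel₀]; exact_mod_cast h

theorem weighted_sq_le {V V' κ Ω : Type} [DecidableEq κ] [Fintype V] [DecidableEq V] [Nonempty V] [Fintype V']
    [DecidableEq V'] [Nonempty V'] [Fintype Ω] {M : ℕ} (Z : Finset V → κ)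
    (Z' : Ω → Finset V' → κ) (w : Ω → ℝ) (hw1 : ∑ ω, w ω = 1) (γ₂ : ℝ)
    (hγ₂0 : 0 ≤ γ₂)
    (hw : ∀ Φ : (Finset (Fin M ⊕ Fin M) → κ) → ℝ, (∀ p, 0 ≤ Φ p) → (∀ p, Φ p ≤ 1) →
      |𝔼 ψ, Φ (pat Z ψ) - ∑ ω, w ω * 𝔼 φ, Φ (pat (Z' ω) φ)| ≤ γ₂) (F : Finset (Fin M) → κ) :
    ∑ ω, w ω * (𝔼 ψ : Fin M → V', (if pat (Z' ω) ψ = F then (1:ℝ) else 0) -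
      𝔼 ψ : Fin M → V, (if pat Z ψ = F then (1:ℝ) else 0)) ^ 2 ≤ 3 * γ₂ := by
  set X : Ω → ℝ := fun ω => 𝔼 ψ : Fin M → V', (if pat (Z' ω) ψ = F then (1:ℝ) else 0) with hX
  set p : ℝ := 𝔼 ψ : Fin M → V, (if pat Z ψ = F then (1:ℝ) else 0) with hp
  change ∑ ω, w ω * (X ω - p) ^ 2 ≤ _
  have hp0 : 0 ≤ p := expect_nonneg fun _ _ => by split_ifs <;> norm_num
  have hp1 : p ≤ 1 := by
    rcases isEmpty_or_nonempty (Fin M → V) with h | h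
    · simp [hp]
    · exact expect_le_of_forall_le _ _ fun _ => by split_ifs <;> norm_num
  let ind : (Finset (Fin M) → κ) → ℝ := fun P => if P = F then 1 else 0
  have hind0 : ∀ P, 0 ≤ ind P := fun P => by simp only [ind]; split_ifs <;> norm_num
  have hind1 : ∀ P, ind P ≤ 1 := fun P => by simp only [ind]; split_ifs <;> norm_num
  have hpc : ∀ {U : Type} [Fintype U] [DecidableEq U] (Z : Finset U → κ) (ψ : Fin M ⊕ Fin M → U)
      (f : Fin M → Fin M ⊕ Fin M), (fun D => pat Z ψ (D.image f)) = pat Z (ψ ∘ f) :=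
    fun Z ψ f => funext fun D => (pat_comp Z ψ f D).symm
  have h1 := hw (fun P => ind fun D => P (D.image Sum.inl)) (fun _ => hind0 _) fun _ => hind1 _
  have h2 := hw (fun P => ind (fun D => P (D.image Sum.inl)) * ind fun D => P (D.image Sum.inr))
    (fun _ => mul_nonneg (hind0 _) (hind0 _))
    fun _ => mul_le_one₀ (hind1 _) (hind0 _) (hind1 _)
  simp only [hpc] at h1 h2
  rw [expect_sum_arrow (fun φ => ind (pat Z φ))
    (fun φ => ind (pat Z φ))] at h2
  rw [expect_comp_injective (Sum.inl : Fin M → Fin M ⊕ Fin M) Sum.inl_injective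
    (fun φ => ind (pat Z φ))] at h1
  have e1 : ∀ ω, 𝔼 φ : Fin M ⊕ Fin M → V',
      ind (pat (Z' ω) (φ ∘ Sum.inl)) = X ω := fun ω =>
    expect_comp_injective (Sum.inl : Fin M → Fin M ⊕ Fin M) Sum.inl_injective
      (fun φ => ind (pat (Z' ω) φ))
  have e2 : ∀ ω, 𝔼 φ : Fin M ⊕ Fin M → V',
      ind (pat (Z' ω) (φ ∘ Sum.inl)) *
      ind (pat (Z' ω) (φ ∘ Sum.inr)) = X ω * X ω := fun ω =>
    expect_sum_arrow (fun φ => ind (pat (Z' ω) φ))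
      (fun φ => ind (pat (Z' ω) φ))
  simp only [e1] at h1
  simp only [e2] at h2
  change |p - ∑ ω, w ω * X ω| ≤ γ₂ at h1
  change |p * p - ∑ ω, w ω * (X ω * X ω)| ≤ γ₂ at h2
  have e3 : ∑ ω, w ω * (X ω - p) ^ 2 = ∑ ω, w ω * (X ω * X ω) -
      2 * p * ∑ ω, w ω * X ω + p ^ 2 * ∑ ω, w ω := by
    rw [mul_sum, mul_sum, ← sum_sub_distrib, ← sum_add_distrib]
    exact sum_congr rfl fun ω _ => by ring
  rw [e3, hw1]
  rw [abs_le] at h1 h2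
  nlinarith [h1.1, h1.2, h2.1, h2.2]

section Lifting

variable {α β : Type} [Fintype β] [Inhabited β]

theorem truncR_image_inr {R V : Type} [Fintype R] [DecidableEq R] [DecidableEq V] (r : ℕ)
    (B : Finset V → β) (hB : ∀ e, r < #e → B e = default) (φ : R → V)
    (hφ : Function.Injective φ) (b : Finset (Empty ⊕ R) → β)
    (hb : ∀ D : Finset R, #D ≤ r → b (D.image Sum.inr) = B (D.image φ)) (D : Finset R) :
    truncR (r + 1) b (D.image Sum.inr) = pat B φ D := by
  unfold truncR pat
  have h1 : (D.image (Sum.inr : R → Empty ⊕ R)).toRight = D := by ext; simp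
  rw [h1]
  split_ifs with h
  · exact hb D (by omega)
  · exact (hB _ (by rw [card_image_of_injective _ hφ]; omega)).symm

/-- A random lift, stated for full patterns. -/
theorem exists_random_lift (r : ℕ) (R : Type) [Fintype R] [DecidableEq R] (γ : ℝ) (hγ : 0 < γ) :
    ∃ (M : ℕ) (γ' : ℝ) (n₀ : ℕ), 0 < γ' ∧
    ∀ (V V' : Type) [Fintype V] [DecidableEq V] [Nonempty V] [Fintype V'] [DecidableEq V']
      [Nonempty V'], n₀ ≤ Fintype.card V → n₀ ≤ Fintype.card V' →
    ∀ (A : Finset V → α) (A' : Finset V' → α), Close M γ' A A' →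
    ∀ B : Finset V → β, (∀ e, r < #e → B e = default) →
    ∃ (Ω : Type) (_ : Fintype Ω) (w : Ω → ℝ) (B' : Ω → Finset V' → β), (∀ ω, 0 ≤ w ω) ∧
      ∑ ω, w ω = 1 ∧ (∀ ω e, r < #e → B' ω e = default) ∧
    ∀ Φ : (Finset R → α × β) → ℝ, (∀ p, 0 ≤ Φ p) → (∀ p, Φ p ≤ 1) →
      |𝔼 ψ : R → V, Φ (pat (fun e => (A e, B e)) ψ) -
        ∑ ω, w ω * 𝔼 φ : R → V', Φ (pat (fun e => (A' e, B' ω e)) φ)| ≤ γ := by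
  obtain ⟨M, γ', n₀, hγ', H⟩ := liftProp (α := α) (β := β) (r + 1) Empty R (γ / 3) (by positivity)
  obtain ⟨n₁, hn₁⟩ := exists_nat_gt ((Fintype.card R : ℝ) ^ 2 / (γ / 3))
  refine ⟨M, γ', max n₀ n₁, hγ', ?_⟩
  intro V V' _ _ _ _ _ _ hV hV' A A' hA B hB
  obtain ⟨Ω, _, w, σ, b', hw0, hw1, hw⟩ := H V V' ((le_max_left _ _).trans hV') A A' hA B
  have small : ∀ m : ℕ, max n₀ n₁ ≤ m → 0 < m → (Fintype.card R : ℝ) ^ 2 / m ≤ γ / 3 := by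
    intro m hm hm0
    have h2 : (n₁ : ℝ) ≤ m := by exact_mod_cast (le_max_right _ _).trans hm
    have hm0' : (0:ℝ) < m := by exact_mod_cast hm0
    rw [div_le_iff₀ hm0']
    rw [div_lt_iff₀ (by positivity)] at hn₁
    nlinarith
  refine ⟨Ω, inferInstance, w, fun ω e => if #e ≤ r then b' ω e ∅ else default, hw0, hw1,
    fun ω e he => if_neg (by omega), ?_⟩
  intro Φ h0 h1
  let Ψ : (Finset (Empty ⊕ R) → α) → (Finset (Empty ⊕ R) → β) → ℝ :=
    fun a b => Φ fun D => (a (D.image Sum.inr), b (D.image Sum.inr))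
  have s := hw Ψ (fun _ _ => h0 _) (fun _ _ => h1 _)
  have e1 : 𝔼 ψ : Empty ⊕ R → V, Ψ (pat A ψ) (truncR (r + 1) (pat B ψ)) =
      𝔼 φ : R → V, Ψ (pat A (Sum.elim Empty.elim φ))
        (truncR (r + 1) (pat B (Sum.elim Empty.elim φ))) := by
    rw [← expect_comp_injective (Sum.inr : R → Empty ⊕ R) Sum.inr_injective]
    refine expect_congr rfl fun ψ _ => ?_
    have : Sum.elim Empty.elim (ψ ∘ Sum.inr) = ψ := by
      funext x; rcases x with x | x
      · exact x.elim
      · rfl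
    rw [this]
  rw [e1] at s
  have t1 : |𝔼 φ : R → V, Φ (pat (fun e => (A e, B e)) φ) - 𝔼 φ : R → V,
      Ψ (pat A (Sum.elim Empty.elim φ)) (truncR (r + 1) (pat B (Sum.elim Empty.elim φ)))| ≤
      γ / 3 := by
    refine (abs_expect_sub_le_of_injective _ _ (fun φ hφ => ?_) fun φ => ?_).trans
      (small _ hV Fintype.card_pos)
    · refine congrArg Φ (funext fun D => Prod.ext ?_ ?_)
      · simp [pat, image_image]
      · exact (truncR_image_inr r B hB φ hφ _ (fun D _ => by simp [pat, image_image]) D).symm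
    · exact abs_sub_le_one (h0 _) (h1 _) (h0 _) (h1 _)
  have t2 : |∑ ω, w ω * 𝔼 φ : R → V', Ψ (pat A' (Sum.elim (σ ω) φ))
        (truncR (r + 1) fun D => b' ω (D.toRight.image φ) D.toLeft) -
      ∑ ω, w ω * 𝔼 φ : R → V',
        Φ (pat (fun e => (A' e, if #e ≤ r then b' ω e ∅ else default)) φ)| ≤ γ / 3 := by
    refine abs_weighted_sub_le _ _ _ hw0 hw1 _ fun ω => ?_
    refine (abs_expect_sub_le_of_injective _ _ (fun φ hφ => ?_) fun φ => ?_).trans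
      (small _ hV' Fintype.card_pos)
    · refine congrArg Φ (funext fun D => Prod.ext ?_ ?_)
      · simp [pat, image_image]
      · refine truncR_image_inr r (fun e => if #e ≤ r then b' ω e ∅ else default)
          (fun e he => if_neg (by omega)) φ hφ
          (fun D => b' ω (D.toRight.image φ) D.toLeft) (fun D hD => ?_) D
        have h2 : (D.image (Sum.inr : R → Empty ⊕ R)).toRight = D := by ext; simp
        have h3 : (D.image (Sum.inr : R → Empty ⊕ R)).toLeft = ∅ := by ext; simp
        simp only [h2, h3]
        exact (if_pos (card_image_le.trans hD)).symm
    · exact abs_sub_le_one (h0 _) (h1 _) (h0 _) (h1 _)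
  rw [abs_le] at *
  constructor <;> linarith [s.1, s.2, t1.1, t1.2, t2.1, t2.2]

/-- Colourings of bounded rank can be lifted along statistical closeness. -/
theorem Close.exists_lift (α β : Type) [Fintype α] [Fintype β] [Inhabited β] (r M : ℕ) (γ : ℝ)
    (hγ : 0 < γ) : ∃ (M' : ℕ) (γ' : ℝ) (n₀ : ℕ), 0 < γ' ∧
    ∀ (V V' : Type) [Fintype V] [DecidableEq V] [Nonempty V] [Fintype V'] [DecidableEq V']
      [Nonempty V'], n₀ ≤ Fintype.card V → n₀ ≤ Fintype.card V' →
    ∀ (A : Finset V → α) (A' : Finset V' → α), Close M' γ' A A' →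
    ∀ B : Finset V → β, (∀ e, r < #e → B e = default) →
    ∃ B' : Finset V' → β, (∀ e, r < #e → B' e = default) ∧
      Close M γ (fun e => (A e, B e)) (fun e => (A' e, B' e)) := by
  obtain ⟨N, hN⟩ : ∃ N : ℝ, N = ((Fintype.card (Finset (Fin M) → α × β) : ℕ) : ℝ) := ⟨_, rfl⟩
  have hNN : 0 ≤ N := by rw [hN]; exact Nat.cast_nonneg _
  obtain ⟨γ₂, hγ₂0, hγ₂⟩ : ∃ γ₂ : ℝ, 0 < γ₂ ∧ 3 * γ₂ * (N + 1) = (γ / (N + 1)) ^ 2 :=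
    ⟨(γ / (N + 1)) ^ 2 / (3 * (N + 1)), by positivity, by field_simp⟩
  obtain ⟨M', γ', n₀, hγ', H⟩ := exists_random_lift (α := α) (β := β) r (Fin M ⊕ Fin M) γ₂ hγ₂0
  refine ⟨M', γ', n₀, hγ', ?_⟩
  intro V V' _ _ _ _ _ _ hV hV' A A' hA B hB
  obtain ⟨Ω, _, w, B', hw0, hw1, hd, hw⟩ := H V V' hV hV' A A' hA B hB
  obtain ⟨p, hp⟩ : ∃ p : (Finset (Fin M) → α × β) → ℝ, ∀ F, p F =
    𝔼 ψ : Fin M → V, (if pat (fun e => (A e, B e)) ψ = F then (1:ℝ) else 0) := ⟨_, fun _ => rfl⟩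
  obtain ⟨X, hX⟩ : ∃ X : Ω → (Finset (Fin M) → α × β) → ℝ, ∀ ω F, X ω F =
    𝔼 ψ : Fin M → V', (if pat (fun e => (A' e, B' ω e)) ψ = F then (1:ℝ) else 0) :=
    ⟨_, fun _ _ => rfl⟩
  have key : ∀ F, ∑ ω, w ω * (X ω F - p F) ^ 2 ≤ 3 * γ₂ := fun F => by
    simp only [hX, hp]
    exact weighted_sq_le (fun e => (A e, B e)) (fun ω e => (A' e, B' ω e)) w hw1 _ hγ₂0.le hw F
  obtain ⟨ω, hω⟩ := exists_le_of_weighted w (fun ω => ∑ F, (X ω F - p F) ^ 2) hw0 hw1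
    (3 * γ₂ * (N + 1)) (by
      simp only [mul_sum]
      rw [sum_comm]
      refine (sum_le_sum fun F _ => key F).trans ?_
      rw [sum_const, card_univ, nsmul_eq_mul, ← hN]
      nlinarith)
  rw [hγ₂] at hω
  refine ⟨B' ω, hd ω, Close.of_patterns _ _ (fun F => ?_) hγ.le⟩
  have h3 : (X ω F - p F) ^ 2 ≤ (γ / (N + 1)) ^ 2 :=
    (single_le_sum (f := fun F => (X ω F - p F) ^ 2) (fun _ _ => sq_nonneg _) (mem_univ F)).trans hω
  have hN1 : 1 ≤ N := by
    have : Nonempty (Finset (Fin M) → α × β) := ⟨F⟩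
    rw [hN]; exact_mod_cast Fintype.card_pos
  rw [abs_sub_comm, ← hX, ← hp]
  have h4 : γ / (N + 1) ≤ γ / N := div_le_div_of_nonneg_left hγ.le (by linarith) (by linarith)
  rw [← hN]
  exact (abs_le_of_sq_le_sq h3 (by positivity)).trans h4

end Lifting

end HypReg

namespace HypReg

open Finset

open scoped BigOperators

attribute [local instance 10] Classical.propDecidable

set_option linter.unusedSectionVars false

section Core

variable {V : Type} [DecidableEq V]

/-- The set of vertex labels appearing on `J`. -/
def shape (ℓ : Finset V → ℕ) (J : Finset V) : Finset ℕ := J.image fun v => ℓ {v}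

/-- The vertices of `J` have distinct labels. -/
def Cross (ℓ : Finset V → ℕ) (J : Finset V) : Prop := Set.InjOn (fun v => ℓ {v}) (J : Set V)

/-- The labels of `J` and of its subsets of size at most `m` are those prescribed by `x`. -/
def Fits (ℓ : Finset V → ℕ) (x : Addr) (m : ℕ) (J : Finset V) : Prop :=
  Cross ℓ J ∧ shape ℓ J ⊆ x.1 ∧ ∀ L ⊆ J, 2 ≤ #L → #L ≤ m → ℓ L = x.2 (shape ℓ L)

/-- The address formed by all labels of `J`. -/
def adr (ℓ : Finset V → ℕ) (J : Finset V) : Addr :=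
  (shape ℓ J, fun M => ℓ (J.filter fun v => ℓ {v} ∈ M))

variable {ℓ : Finset V → ℕ} {x y : Addr} {m m' : ℕ} {I J : Finset V}

theorem Cross.subset (h : Cross ℓ J) (hI : I ⊆ J) : Cross ℓ I :=
  Set.InjOn.mono (by exact_mod_cast hI) h

theorem shape_subset (hI : I ⊆ J) : shape ℓ I ⊆ shape ℓ J := image_subset_image hI

theorem Cross.card_shape (h : Cross ℓ J) : #(shape ℓ J) = #J := card_image_of_injOn h

theorem shape_filter {M : Finset ℕ} (hM : M ⊆ shape ℓ J) :
    shape ℓ (J.filter fun v => ℓ {v} ∈ M) = M := by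
  ext i
  simp only [shape, mem_image, mem_filter]
  constructor
  · rintro ⟨v, ⟨_, h⟩, rfl⟩; exact h
  · intro hi
    obtain ⟨v, hv, rfl⟩ := mem_image.1 (hM hi)
    exact ⟨v, ⟨hv, hi⟩, rfl⟩

theorem Cross.filter_shape (h : Cross ℓ J) (hI : I ⊆ J) :
    (J.filter fun v => ℓ {v} ∈ shape ℓ I) = I := by
  ext v
  simp only [mem_filter, shape, mem_image]
  constructor
  · rintro ⟨hv, u, hu, huv⟩
    rwa [← h (hI hu) hv huv]
  · exact fun hv => ⟨hI hv, v, hv, rfl⟩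

theorem Fits.subset (h : Fits ℓ x m J) (hI : I ⊆ J) : Fits ℓ x m I :=
  ⟨h.1.subset hI, (shape_subset hI).trans h.2.1, fun L hL => h.2.2 L (hL.trans hI)⟩

theorem Fits.mono (h : Fits ℓ x m J) (hm : m' ≤ m) : Fits ℓ x m' J :=
  ⟨h.1, h.2.1, fun L hL h2 hL' => h.2.2 L hL h2 (hL'.trans hm)⟩

theorem Cross.fits_adr (h : Cross ℓ J) : Fits ℓ (adr ℓ J) m J :=
  ⟨h, Subset.rfl, fun L hL _ _ => by simp only [adr]; rw [h.filter_shape hL]⟩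

theorem Fits.fits_adr_iff (h : Fits ℓ x m J) (hI : shape ℓ I ⊆ shape ℓ J) :
    Fits ℓ (adr ℓ J) m I ↔ Fits ℓ x m I := by
  unfold Fits
  refine and_congr_right fun hc => and_congr (iff_of_true hI (hI.trans h.2.1)) ?_
  refine forall_congr' fun L => forall_congr' fun hL => forall_congr' fun h2 =>
    forall_congr' fun hm => ?_
  have h1 : shape ℓ L ⊆ shape ℓ J := (shape_subset hL).trans hI
  have h3 : #(J.filter fun v => ℓ {v} ∈ shape ℓ L) = #L := by
    rw [← (h.1.subset (filter_subset _ _)).card_shape, shape_filter h1,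
      (hc.subset hL).card_shape]
  have h4 := h.2.2 _ (filter_subset (fun v => ℓ {v} ∈ shape ℓ L) J) (by omega) (by omega)
  rw [shape_filter h1] at h4
  simp only [adr]
  rw [h4]

theorem Fits.shape_eq (h : Fits ℓ x m J) (hJ : #J = #x.1) : shape ℓ J = x.1 :=
  eq_of_subset_of_card_le h.2.1 (by rw [h.1.card_shape, hJ])

theorem Fits.fits_adr_iff' (h : Fits ℓ x m J) (hJ : #J = #x.1) :
    Fits ℓ (adr ℓ J) m I ↔ Fits ℓ x m I := by
  have hs := h.shape_eq hJ
  constructor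
  · intro h1
    exact (h.fits_adr_iff h1.2.1).1 h1
  · intro h1
    exact (h.fits_adr_iff (h1.2.1.trans hs.symm.subset)).2 h1

/-- Fitting an address is decided by the subsets with one element less. -/
theorem fits_of_facets {i : ℕ} (hi : 1 ≤ i) (hJ : #J = i + 1) (hc : Cross ℓ J)
    (h : ∀ I ⊆ J, #I = i → Fits ℓ x i I) : Fits ℓ x i J := by
  refine ⟨hc, fun a ha => ?_, fun L hL h2 hLi => ?_⟩
  · obtain ⟨v, hv, rfl⟩ := mem_image.1 ha
    obtain ⟨I, hI, hI', hIc⟩ := exists_subsuperset_card_eq (n := i) (singleton_subset_iff.2 hv)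
      (by simpa using hi) (by omega)
    exact (h I hI' hIc).2.1 (mem_image_of_mem _ (hI (mem_singleton_self v)))
  · obtain ⟨I, hI, hI', hIc⟩ := exists_subsuperset_card_eq hL hLi (by omega)
    exact (h I hI' hIc).2.2 L hI h2 hLi

theorem cross_of_facets {i : ℕ} (hi : 2 ≤ i) (hJ : #J = i + 1)
    (h : ∀ I ⊆ J, #I = i → Cross ℓ I) : Cross ℓ J := by
  intro u hu v hv huv
  by_contra hne
  obtain ⟨I, hI, hI', hIc⟩ := exists_subsuperset_card_eq (n := i) (s := {u, v}) (t := J)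
    (by intro w hw; simp only [mem_insert, mem_singleton] at hw; rcases hw with rfl | rfl
        · exact hu
        · exact hv) ((card_le_two).trans hi) (by omega)
  exact hne (h I hI' hIc (hI (by simp)) (hI (by simp)) huv)

/-- The subsets of `W` fitting `x` all of whose facets lie in `Q`. -/
noncomputable def cliq (W : Finset V) (ℓ : Finset V → ℕ) (x : Addr) (Q : Finset (Finset V)) :
    Finset (Finset V) :=
  W.powerset.filter fun J => #J = #x.1 ∧ Fits ℓ x (#x.1 - 1) J ∧
    ∀ I ⊆ J, #I + 1 = #x.1 → I ∈ Q

/-- The subsets of `W` fitting `x`. -/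
noncomputable def cliqAll (W : Finset V) (ℓ : Finset V → ℕ) (x : Addr) : Finset (Finset V) :=
  W.powerset.filter fun J => #J = #x.1 ∧ Fits ℓ x (#x.1 - 1) J

/-- Regularity of `A` at the address `x`. -/
def RegAt (W : Finset V) (ℓ : Finset V → ℕ) (x : Addr) (ε D : ℝ) (A : Finset V → Prop) : Prop :=
  ∀ Q : Finset (Finset V), ε * #(cliqAll W ℓ x) ≤ #(cliq W ℓ x Q) →
    |(#((cliq W ℓ x Q).filter A) : ℝ) - D * #(cliq W ℓ x Q)| ≤ ε * #(cliq W ℓ x Q)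

/-- A labelling of the subsets of `W` describing an equitable partition of `H`. -/
structure Core (W : Finset V) (k : ℕ) (a : ℕ → ℕ) (ε : ℝ) (d : Addr → ℝ) (ℓ : Finset V → ℕ)
    (H : Finset (Finset V)) : Prop where
  le_a : k ≤ a 1
  vertex : ∀ v ∈ W, 1 ≤ ℓ {v} ∧ ℓ {v} ≤ a 1
  size : ∀ i, 1 ≤ i → i ≤ a 1 → #(W.filter fun v => ℓ {v} = i) = #W / a 1 ∨
    #(W.filter fun v => ℓ {v} = i) = #W / a 1 + 1
  label : ∀ J ⊆ W, 2 ≤ #J → #J ≤ k - 1 → Cross ℓ J → 1 ≤ ℓ J ∧ ℓ J ≤ a #J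
  zero : ∀ J ⊆ W, #J ≠ 1 → ¬ (2 ≤ #J ∧ #J ≤ k - 1 ∧ Cross ℓ J) → ℓ J = 0
  reg : ∀ j, 2 ≤ j → j ≤ k - 1 → ∀ x, IsAddress j (j - 1) a x → ∀ b, 1 ≤ b → b ≤ a j →
    RegAt W ℓ x ε (1 / (a j : ℝ)) fun J => ℓ J = b
  regH : ∀ x, IsAddress k (k - 1) a x → RegAt W ℓ x ε (d x) fun J => J ∈ H

end Core

end HypReg

namespace HypReg

open Finset

open scoped BigOperators

attribute [local instance 10] Classical.propDecidable

set_option linter.unusedSectionVars false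

section Family

variable {V : Type} [DecidableEq V]

/-- `ℓ` collects the labels of the labelled family `F`. -/
structure LabFam.Labels (F : LabFam V) (k : ℕ) (ℓ : Finset V → ℕ) : Prop where
  class_iff : ∀ u ∈ F.gnd, ∀ v ∈ F.gnd, (F.vIdx u = F.vIdx v ↔ F.vClass u = F.vClass v)
  sing : ∀ v ∈ F.gnd, ℓ {v} = F.vIdx v
  lbl : ∀ j, 2 ≤ j → j ≤ k - 1 → ∀ J ∈ F.toPartFam.cross j, ℓ J = F.lbl j J

variable {F : LabFam V} {k : ℕ} {ℓ : Finset V → ℕ} {I J : Finset V} {x : Addr} {i : ℕ}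

namespace LabFam.Labels

theorem mem_cross (h : F.Labels k ℓ) :
    J ∈ F.toPartFam.cross i ↔ J ⊆ F.gnd ∧ #J = i ∧ Cross ℓ J := by
  simp only [PartFam.cross, mem_filter, mem_powersetCard, and_assoc]
  refine and_congr_right fun hJ => and_congr_right fun _ => ?_
  constructor
  · intro hc u hu v hv huv
    by_contra hne
    refine hc u hu v hv hne ((h.class_iff u (hJ hu) v (hJ hv)).1 ?_)
    simpa [h.sing u (hJ hu), h.sing v (hJ hv)] using huv
  · intro hc u hu v hv hne hcl
    have h1 := (h.class_iff u (hJ hu) v (hJ hv)).2 hcl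
    rw [← h.sing u (hJ hu), ← h.sing v (hJ hv)] at h1
    exact hne (hc hu hv h1)

theorem mem_KsetC (h : F.Labels k ℓ) (hi : 1 ≤ i) {B : Finset (Finset V)}
    (hB : ∀ I ∈ B, #I = i ∧ Cross ℓ I) :
    J ∈ KsetC F.gnd (F.toPartFam.cross (i + 1)) i (i + 1) B ↔
      J ⊆ F.gnd ∧ #J = i + 1 ∧ Cross ℓ J ∧ ∀ I ⊆ J, #I = i → I ∈ B := by
  unfold KsetC
  split_ifs with h1
  · subst h1
    rw [mem_filter, h.mem_cross, and_assoc, and_assoc]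
    refine and_congr_right fun _ => and_congr_right fun _ => and_congr_right fun _ => ?_
    constructor
    · intro hv I hI hI1
      obtain ⟨v, rfl⟩ := card_eq_one.1 hI1
      exact hv v (singleton_subset_iff.1 hI)
    · exact fun hv v hvJ => hv {v} (singleton_subset_iff.2 hvJ) (card_singleton v)
  · unfold Kset
    simp only [mem_filter, mem_powersetCard, and_imp, and_assoc]
    refine and_congr_right fun _ => and_congr_right fun hJ => ?_
    constructor
    · exact fun hv => ⟨cross_of_facets (by omega) hJ fun I hI hIc => (hB I (hv I hI hIc)).2, hv⟩
    · exact fun hv => hv.2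

theorem mem_cliq_iff (h : F.Labels k ℓ) (hi : 1 ≤ i) (hx : #x.1 = i + 1)
    {B Q : Finset (Finset V)} (hB : ∀ I, I ∈ B ↔ I ⊆ F.gnd ∧ #I = i ∧ Fits ℓ x i I) :
    KsetC F.gnd (F.toPartFam.cross (i + 1)) i (i + 1) (B.filter (· ∈ Q)) =
      cliq F.gnd ℓ x Q := by
  ext J
  rw [h.mem_KsetC hi (fun I hI => ?_)]
  swap
  · have := (hB I).1 (mem_filter.1 hI).1
    exact ⟨this.2.1, this.2.2.1⟩
  simp only [cliq, mem_filter, mem_powerset, hx, Nat.add_sub_cancel, Nat.add_right_cancel_iff, hB]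
  refine and_congr_right fun hJ => and_congr_right fun hJc => ?_
  constructor
  · rintro ⟨hc, h1⟩
    exact ⟨fits_of_facets hi hJc hc fun I hI hIc => (h1 I hI hIc).1.2.2,
      fun I hI hIc => (h1 I hI hIc).2⟩
  · rintro ⟨hf, h1⟩
    exact ⟨hf.1, fun I hI hIc => ⟨⟨hI.trans hJ, hIc, hf.subset hI⟩, h1 I hI hIc⟩⟩

theorem mem_cliqAll_iff (h : F.Labels k ℓ) (hi : 1 ≤ i) (hx : #x.1 = i + 1)
    {B : Finset (Finset V)} (hB : ∀ I, I ∈ B ↔ I ⊆ F.gnd ∧ #I = i ∧ Fits ℓ x i I) :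
    KsetC F.gnd (F.toPartFam.cross (i + 1)) i (i + 1) B = cliqAll F.gnd ℓ x := by
  have h1 := h.mem_cliq_iff hi hx hB (Q := B)
  rw [filter_true_of_mem fun _ hI => hI] at h1
  rw [h1]
  ext J
  simp only [cliq, cliqAll, mem_filter, mem_powerset, hx, Nat.add_sub_cancel,
    Nat.add_right_cancel_iff, hB]
  refine and_congr_right fun hJ => and_congr_right fun _ => and_iff_left_of_imp fun hf I hI hIc =>
    ⟨hI.trans hJ, hIc, hf.subset hI⟩

theorem regPairC_iff (h : F.Labels k ℓ) (hi : 1 ≤ i) (hx : #x.1 = i + 1)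
    {A B : Finset (Finset V)} (hB : ∀ I, I ∈ B ↔ I ⊆ F.gnd ∧ #I = i ∧ Fits ℓ x i I)
    {P : Finset V → Prop} (hP : ∀ J ∈ cliqAll F.gnd ℓ x, (J ∈ A ↔ P J)) (ε D : ℝ) :
    RegPairC F.gnd (F.toPartFam.cross (i + 1)) i ε D A B ↔ RegAt F.gnd ℓ x ε D P := by
  have hA : ∀ Q, (cliq F.gnd ℓ x Q).filter P = A ∩ cliq F.gnd ℓ x Q := by
    intro Q
    ext J
    simp only [mem_filter, mem_inter]
    constructor
    · rintro ⟨h1, h2⟩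
      refine ⟨(hP J ?_).2 h2, h1⟩
      simp only [cliq, cliqAll, mem_filter] at h1 ⊢
      exact ⟨h1.1, h1.2.1, h1.2.2.1⟩
    · rintro ⟨h1, h2⟩
      refine ⟨h2, (hP J ?_).1 h1⟩
      simp only [cliq, cliqAll, mem_filter] at h2 ⊢
      exact ⟨h2.1, h2.2.1, h2.2.2.1⟩
  constructor
  · intro hr Q hQ
    have := hr (B.filter (· ∈ Q)) (filter_subset _ _)
    rw [h.mem_cliq_iff hi hx hB, h.mem_cliqAll_iff hi hx hB] at this
    rw [hA]
    exact this hQ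
  · intro hr Q hQB hQ
    have h1 : Q = B.filter (· ∈ Q) := by
      ext I; simp only [mem_filter]; exact ⟨fun h => ⟨hQB h, h⟩, fun h => h.2⟩
    rw [h1, h.mem_cliq_iff hi hx hB] at hQ ⊢
    rw [h.mem_cliqAll_iff hi hx hB] at hQ
    rw [← hA]
    exact hr Q hQ

theorem mem_polyAt (h : F.Labels k ℓ) (hi : 1 ≤ i) (hik : i ≤ k - 1) :
    I ∈ F.polyAt i x ↔ I ⊆ F.gnd ∧ #I = i ∧ Fits ℓ x i I := by
  unfold LabFam.polyAt
  split_ifs with h1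
  · subst h1
    simp only [HypReg.sing, mem_image, mem_filter]
    constructor
    · rintro ⟨v, ⟨hv, hx⟩, rfl⟩
      refine ⟨by simpa using hv, by simp, by simp [Cross], ?_, fun L hL h2 h1 => by omega⟩
      simpa [shape, h.sing v hv] using hx
    · rintro ⟨hI, hI1, _, hx, _⟩
      obtain ⟨v, rfl⟩ := card_eq_one.1 hI1
      have hv : v ∈ F.gnd := by simpa using hI
      exact ⟨v, ⟨hv, by simpa [shape, h.sing v hv] using hx⟩, rfl⟩
  · have hi2 : 2 ≤ i := by omega
    have hsh : ∀ I ⊆ F.gnd, I.image F.vIdx = shape ℓ I := fun I hI =>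
      image_congr fun v hv => (h.sing v (hI hv)).symm
    have hfil : ∀ I ⊆ F.gnd, ∀ M : Finset ℕ, (I.filter fun v => F.vIdx v ∈ M) =
        I.filter fun v => ℓ {v} ∈ M := fun I hI M => filter_congr fun v hv => by
      rw [h.sing v (hI hv)]
    simp only [mem_sup, mem_powersetCard, LabFam.partAt, if_neg (show ¬ i ≤ 1 by omega), mem_filter,
      h.mem_cross, LabFam.addrOf, restrictA, Prod.ext_iff, and_assoc]
    constructor
    · rintro ⟨B, hB, hBc, hI, hIc, hc, hsB, hlab, hlast⟩
      rw [hsh I hI] at hsB hlab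
      subst hsB
      refine ⟨hI, hIc, hc, hB, fun L hL h2 hLi => ?_⟩
      rcases eq_or_lt_of_le hLi with h3 | h3
      · have : L = I := eq_of_subset_of_card_le hL (by omega)
        subst this
        rw [← hlast]
        exact h.lbl i hi2 hik L (h.mem_cross.2 ⟨hI, hIc, hc⟩)
      · have h4 := congrFun hlab (shape ℓ L)
        have h5 : shape ℓ L ⊆ shape ℓ I ∧ 2 ≤ #(shape ℓ L) ∧ #(shape ℓ L) ≤ i - 1 := by
          rw [(hc.subset hL).card_shape]; exact ⟨shape_subset hL, h2, by omega⟩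
        rw [if_pos h5, if_pos h5, hfil I hI, hc.filter_shape hL, (hc.subset hL).card_shape] at h4
        rw [← h4]
        exact h.lbl _ h2 (by omega) L (h.mem_cross.2 ⟨hL.trans hI, rfl, hc.subset hL⟩)
    · rintro ⟨hI, hIc, hf⟩
      refine ⟨shape ℓ I, hf.2.1, by rw [hf.1.card_shape, hIc], hI, hIc, hf.1, hsh I hI, ?_, ?_⟩
      · rw [hsh I hI]
        funext M
        by_cases hM : M ⊆ shape ℓ I ∧ 2 ≤ #M ∧ #M ≤ i - 1
        · rw [if_pos hM, if_pos hM, hfil I hI]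
          have h3 : #(I.filter fun v => ℓ {v} ∈ M) = #M := by
            rw [← (hf.1.subset (filter_subset _ _)).card_shape, shape_filter hM.1]
          have h4 := hf.2.2 (I.filter fun v => ℓ {v} ∈ M) (filter_subset _ _) (by omega) (by omega)
          rw [shape_filter hM.1] at h4
          rw [← h4]
          refine (h.lbl _ hM.2.1 (by omega) _ (h.mem_cross.2
            ⟨(filter_subset _ _).trans hI, h3, hf.1.subset (filter_subset _ _)⟩)).symm
        · rw [if_neg hM, if_neg hM]
      · rw [← hf.2.2 I Subset.rfl (by omega) (by omega)]
        exact (h.lbl i hi2 hik I (h.mem_cross.2 ⟨hI, hIc, hf.1⟩)).symm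

end LabFam.Labels

end Family

end HypReg

namespace HypReg

open Finset

open scoped BigOperators

attribute [local instance 10] Classical.propDecidable

set_option linter.unusedSectionVars false

theorem card_image_le_card_image {α β γ : Type*} [DecidableEq β] [DecidableEq γ] {s : Finset α}
    {f : α → β} {g : α → γ} (h : ∀ x ∈ s, ∀ y ∈ s, g x = g y → f x = f y) :
    #(s.image f) ≤ #(s.image g) := by
  rcases s.eq_empty_or_nonempty with rfl | ⟨x₀, -⟩
  · simp
  have hb : ∀ c ∈ s.image g, ∃ x ∈ s, g x = c := fun c hc => mem_image.1 hc
  have : Nonempty α := ⟨x₀⟩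
  choose! r hr1 hr2 using hb
  have : s.image f ⊆ (s.image g).image fun c => f (r c) := by
    intro C hC
    obtain ⟨x, hx, rfl⟩ := mem_image.1 hC
    have hx' := mem_image_of_mem g hx
    exact mem_image.2 ⟨_, hx', h _ (hr1 _ hx') x hx (hr2 _ hx')⟩
  exact (card_le_card this).trans card_image_le

section FamilyToCore

variable {V : Type} [DecidableEq V]

/-- All labels of a labelled family, collected in one function. -/
noncomputable def LabFam.lab (F : LabFam V) (k : ℕ) (e : Finset V) : ℕ :=
  if #e = 1 then e.sum F.vIdx
  else if e ∈ F.toPartFam.cross #e ∧ 2 ≤ #e ∧ #e ≤ k - 1 then F.lbl #e e else 0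

variable {F : LabFam V} {k : ℕ} {a : ℕ → ℕ} {ℓ : Finset V → ℕ} {I J : Finset V} {x : Addr} {i : ℕ}

theorem LabFam.IsLabeled.labels (h : F.IsLabeled k a) : F.Labels k (F.lab k) where
  class_iff := h.2.2.1
  sing v _ := by simp [LabFam.lab]
  lbl j h2 hj J hJ := by
    have hJc : #J = j := (mem_powersetCard.1 (mem_filter.1 hJ).1).2
    subst hJc
    rw [LabFam.lab, if_neg (by omega), if_pos ⟨hJ, h2, hj⟩]

theorem LabFam.Labels.mem_polyad_one (hℓ : F.Labels k ℓ) (hv : ∀ v ∈ F.gnd, v ∈ F.vClass v)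
    (hsub : ∀ v ∈ F.gnd, F.vClass v ⊆ F.gnd)
    (heq : ∀ u ∈ F.gnd, ∀ v ∈ F.gnd, u ∈ F.vClass v → F.vClass u = F.vClass v) (hJ : J ⊆ F.gnd) :
    I ∈ F.toPartFam.polyad 1 J ↔ I ⊆ F.gnd ∧ #I = 1 ∧ Fits ℓ (adr ℓ J) 1 I := by
  rw [PartFam.polyad, if_pos rfl]
  simp only [HypReg.sing, mem_image, mem_sup]
  constructor
  · rintro ⟨v, ⟨u, hu, hvu⟩, rfl⟩
    have hvg := hsub u (hJ hu) hvu
    refine ⟨by simpa using hvg, by simp, by simp [Cross], ?_, fun L hL h2 h1 => by omega⟩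
    have h1 := heq v hvg u (hJ hu) hvu
    have h2 := (hℓ.class_iff v hvg u (hJ hu)).2 h1
    rw [← hℓ.sing v hvg, ← hℓ.sing u (hJ hu)] at h2
    simp only [shape, image_singleton, singleton_subset_iff, adr, mem_image]
    exact ⟨u, hu, h2.symm⟩
  · rintro ⟨hI, hI1, _, hx, _⟩
    obtain ⟨v, rfl⟩ := card_eq_one.1 hI1
    have hvg : v ∈ F.gnd := by simpa using hI
    simp only [shape, image_singleton, singleton_subset_iff, adr, mem_image] at hx
    obtain ⟨u, hu, huv⟩ := hx
    rw [hℓ.sing v hvg, hℓ.sing u (hJ hu)] at huv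
    refine ⟨v, ⟨u, hu, ?_⟩, rfl⟩
    rw [(hℓ.class_iff u (hJ hu) v hvg).1 huv]
    exact hv v hvg

/-- The polyads of `F` at level `i` are described by `ℓ`. -/
def PolyadSpec (F : LabFam V) (ℓ : Finset V → ℕ) (i : ℕ) : Prop :=
  ∀ J ⊆ F.gnd, Cross ℓ J → i ≤ #J → ∀ I, I ∈ F.toPartFam.polyad i J ↔
    I ⊆ F.gnd ∧ #I = i ∧ Fits ℓ (adr ℓ J) i I

theorem PolyadSpec.polyCliques (hp : PolyadSpec F ℓ i) (hℓ : F.Labels k ℓ) (hi : 1 ≤ i)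
    (hJ : J ∈ F.toPartFam.cross (i + 1)) :
    F.toPartFam.polyCliques (i + 1) J = cliqAll F.gnd ℓ (adr ℓ J) := by
  obtain ⟨h1, h2, h3⟩ := hℓ.mem_cross.1 hJ
  exact hℓ.mem_cliqAll_iff hi (by rw [adr, h3.card_shape, h2]) (hp J h1 h3 (by omega))

theorem LabFam.IsLabeled.mem_cls (h : F.IsLabeled k a) (hℓ : F.Labels k ℓ)
    (hp : PolyadSpec F ℓ i) (hi : 1 ≤ i) (hik : i + 1 ≤ k - 1)
    (hJ : J ∈ F.toPartFam.cross (i + 1)) :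
    I ∈ F.cls (i + 1) J ↔ I ⊆ F.gnd ∧ #I = i + 1 ∧ Fits ℓ (adr ℓ J) (i + 1) I := by
  have hpc := hp.polyCliques hℓ hi hJ
  obtain ⟨hJg, hJc, hJX⟩ := hℓ.mem_cross.1 hJ
  have hax : #(adr ℓ J).1 = i + 1 := by rw [adr, hJX.card_shape, hJc]
  obtain ⟨⟨-, -, -, -, -, hfam⟩, -, -, hlab⟩ := h
  obtain ⟨hself, -, hsub, -, -⟩ := hfam (i + 1) (by omega) hik
  obtain ⟨-, hl2, hl3⟩ := hlab (i + 1) (by omega) hik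
  have hJJ : ℓ J = F.lbl (i + 1) J := hℓ.lbl _ (by omega) hik J hJ
  constructor
  · intro hI
    have h1 := hsub J hJ hI
    rw [hpc] at h1
    simp only [cliqAll, mem_filter, mem_powerset, hax, Nat.add_sub_cancel] at h1
    obtain ⟨hIg, hIc, hf⟩ := h1
    refine ⟨hIg, hIc, hf.1, hf.2.1, fun L hL h2 hLi => ?_⟩
    rcases eq_or_lt_of_le hLi with h3 | h3
    · have : L = I := eq_of_subset_of_card_le hL (by omega)
      subst this
      have hsh : shape ℓ L = shape ℓ J := hf.shape_eq (by rw [hIc, hax])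
      rw [hsh]
      simp only [adr]
      rw [hJX.filter_shape Subset.rfl, hJJ, ← hl2 J hJ L hI]
      exact hℓ.lbl _ (by omega) hik L (hℓ.mem_cross.2 ⟨hIg, hIc, hf.1⟩)
    · exact hf.2.2 L hL h2 (by omega)
  · rintro ⟨hIg, hIc, hf⟩
    have hIX := hℓ.mem_cross.2 ⟨hIg, hIc, hf.1⟩
    rw [← hl3 I hIX J hJ ?_ ?_]
    · exact hself I hIX
    · ext T
      rw [Nat.add_sub_cancel, hp I hIg hf.1 (by omega), hp J hJg hJX (by omega)]
      rw [(hf.mono (Nat.le_succ i)).fits_adr_iff' (by rw [hIc, hax])]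
    · rw [← hJJ, ← hℓ.lbl _ (by omega) hik I hIX, hf.2.2 I Subset.rfl (by omega) (by omega)]
      have hsh : shape ℓ I = shape ℓ J := hf.shape_eq (by rw [hIc, hax])
      rw [hsh]
      simp only [adr]
      rw [hJX.filter_shape Subset.rfl]

theorem LabFam.Labels.polyadSpec_of_cls (hℓ : F.Labels k ℓ) (hi : 2 ≤ i)
    (h : ∀ J ∈ F.toPartFam.cross i, ∀ I, I ∈ F.cls i J ↔
      I ⊆ F.gnd ∧ #I = i ∧ Fits ℓ (adr ℓ J) i I) : PolyadSpec F ℓ i := by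
  intro J hJ hJX hJc I
  rw [PartFam.polyad, if_neg (by omega)]
  simp only [mem_sup, mem_powersetCard]
  constructor
  · rintro ⟨L, ⟨hL, hLc⟩, hI⟩
    have hLX := hℓ.mem_cross.2 ⟨hL.trans hJ, hLc, hJX.subset hL⟩
    obtain ⟨h1, h2, h3⟩ := (h L hLX I).1 hI
    exact ⟨h1, h2, ((hJX.fits_adr.subset hL).fits_adr_iff h3.2.1).1 h3⟩
  · rintro ⟨h1, h2, h3⟩
    have hs : shape ℓ (J.filter fun v => ℓ {v} ∈ shape ℓ I) = shape ℓ I := shape_filter h3.2.1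
    have hL : (J.filter fun v => ℓ {v} ∈ shape ℓ I) ⊆ J := filter_subset _ _
    generalize (J.filter fun v => ℓ {v} ∈ shape ℓ I) = L at hs hL
    have hLc : #L = i := by rw [← (hJX.subset hL).card_shape, hs, h3.1.card_shape, h2]
    refine ⟨L, ⟨hL, hLc⟩, ?_⟩
    have hLX := hℓ.mem_cross.2 ⟨hL.trans hJ, hLc, hJX.subset hL⟩
    exact (h L hLX I).2 ⟨h1, h2, ((hJX.fits_adr.subset hL).fits_adr_iff hs.symm.subset).2 h3⟩

theorem LabFam.IsLabeled.polyadSpec (h : F.IsLabeled k a) (hℓ : F.Labels k ℓ) (hi : 1 ≤ i)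
    (hik : i ≤ k - 1) : PolyadSpec F ℓ i := by
  induction i, hi using Nat.le_induction with
  | base => exact fun J hJ _ _ I => hℓ.mem_polyad_one h.1.1 h.1.2.1 h.1.2.2.1 hJ
  | succ i hi ih =>
    exact hℓ.polyadSpec_of_cls (by omega) fun J hJ I => h.mem_cls hℓ (ih (by omega)) hi hik hJ

theorem fits_adr_iff_label (hJ : Fits ℓ x i J) (hJc : #J = i + 1) (hI : Fits ℓ x i I)
    (hIc : #I = i + 1) (hx : #x.1 = i + 1) (hi : 1 ≤ i) :
    Fits ℓ (adr ℓ J) (i + 1) I ↔ ℓ I = ℓ J := by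
  have hsI := hI.shape_eq (hIc.trans hx.symm)
  have hsJ := hJ.shape_eq (hJc.trans hx.symm)
  have key : (adr ℓ J).2 (shape ℓ I) = ℓ J := by
    simp only [adr]
    rw [hsI, ← hsJ, hJ.1.filter_shape Subset.rfl]
  have h1 : Fits ℓ (adr ℓ J) i I := (hJ.fits_adr_iff' (hJc.trans hx.symm)).2 hI
  constructor
  · intro h
    rw [h.2.2 I Subset.rfl (by omega) (by omega), key]
  · intro h
    refine ⟨hI.1, h1.2.1, fun L hL h2 hLi => ?_⟩
    rcases eq_or_lt_of_le hLi with h3 | h3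
    · have : L = I := eq_of_subset_of_card_le hL (by omega)
      rw [this, h, key]
    · exact h1.2.2 L hL h2 (by omega)

theorem cliqAll_congr {W : Finset V} {y : Addr} (hc : #x.1 = #y.1)
    (h : ∀ I, Fits ℓ x (#x.1 - 1) I ↔ Fits ℓ y (#x.1 - 1) I) :
    cliqAll W ℓ x = cliqAll W ℓ y := by
  simp only [cliqAll, ← hc, h]

theorem LabFam.IsLabeled.nonempty (h : F.IsLabeled k a) (hk : 2 ≤ k) : Nonempty V := by
  obtain ⟨⟨-, -, -, hcard, hka, -⟩, -⟩ := h
  have : (F.gnd.image F.vClass).Nonempty := card_pos.1 (by omega)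
  obtain ⟨v, -⟩ := this.of_image
  exact ⟨v⟩

theorem LabFam.IsLabeled.image_vIdx (h : F.IsLabeled k a) :
    F.gnd.image F.vIdx = Icc 1 (a 1) := by
  obtain ⟨⟨-, -, -, hcard, -⟩, hr, hiff, -⟩ := h
  refine eq_of_subset_of_card_le (fun i hi => ?_) ?_
  · obtain ⟨v, hv, rfl⟩ := mem_image.1 hi
    exact mem_Icc.2 (hr v hv)
  · rw [Nat.card_Icc, Nat.add_sub_cancel, ← hcard]
    exact card_image_le_card_image fun u hu v hv => (hiff u hu v hv).1

theorem LabFam.IsLabeled.exists_crossing (h : F.IsLabeled k a) (hℓ : F.Labels k ℓ) (hk2 : 2 ≤ k)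
    (hJ : J ⊆ F.gnd) (hX : Cross ℓ J) (hJc : #J ≤ k) : ∃ K ∈ F.toPartFam.cross k, J ⊆ K := by
  have := h.nonempty hk2
  have him := h.image_vIdx
  have hk : k ≤ a 1 := h.1.2.2.2.2.1
  have himl : F.gnd.image (fun v => ℓ {v}) = Icc 1 (a 1) := by
    rw [← him]; exact image_congr fun v hv => hℓ.sing v hv
  have hsub : shape ℓ J ⊆ Icc 1 (a 1) := by rw [← himl]; exact image_subset_image hJ
  obtain ⟨T, hT1, hT2, hTc⟩ := exists_subsuperset_card_eq hsub (n := k)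
    (by rw [hX.card_shape]; exact hJc) (by simpa using hk)
  have hb : ∀ i ∈ Icc 1 (a 1), ∃ v ∈ F.gnd, ℓ {v} = i := fun i hi =>
    mem_image.1 (by rw [himl]; exact hi)
  choose! r hr1 hr2 using hb
  have hsh : shape ℓ (J ∪ (T \ shape ℓ J).image r) = T := by
    have h1 : shape ℓ ((T \ shape ℓ J).image r) = T \ shape ℓ J := by
      rw [shape, image_image]
      conv_rhs => rw [← image_id (s := T \ shape ℓ J)]
      exact image_congr fun i hi => hr2 i (hT2 (mem_sdiff.1 hi).1)
    have h2 : shape ℓ (J ∪ (T \ shape ℓ J).image r) =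
        shape ℓ J ∪ shape ℓ ((T \ shape ℓ J).image r) := image_union _ _
    rw [h2, h1, union_sdiff_of_subset hT1]
  have hcard : #(J ∪ (T \ shape ℓ J).image r) ≤ k := by
    refine (card_union_le _ _).trans ?_
    have := card_image_le (s := T \ shape ℓ J) (f := r)
    rw [card_sdiff_of_subset hT1, hX.card_shape, hTc] at this
    omega
  have hcard' : k ≤ #(J ∪ (T \ shape ℓ J).image r) := by
    have : #(shape ℓ (J ∪ (T \ shape ℓ J).image r)) ≤ _ := card_image_le
    rw [hsh, hTc] at this
    exact this
  refine ⟨_, hℓ.mem_cross.2 ⟨union_subset hJ fun v hv => ?_, le_antisymm hcard hcard', ?_⟩,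
    subset_union_left⟩
  · obtain ⟨i, hi, rfl⟩ := mem_image.1 hv
    exact hr1 i (hT2 (mem_sdiff.1 hi).1)
  · refine card_image_iff.1 ?_
    change #(shape ℓ _) = _
    rw [hsh, hTc]
    exact le_antisymm hcard' hcard

theorem LabFam.IsEquitPartition.core {ε : ℝ} {d : Addr → ℝ} {H : Finset (Finset V)}
    (h : F.IsEquitPartition k a ε d H) (hk : 2 ≤ k) : Core F.gnd k a ε d (F.lab k) H := by
  obtain ⟨h, ⟨-, hsz, hreg⟩, hd⟩ := h
  have hℓ := h.labels
  have hrep : ∀ i, 1 ≤ i → i ≤ a 1 → ∃ v ∈ F.gnd, F.vIdx v = i := fun i h1 h2 =>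
    mem_image.1 (by rw [h.image_vIdx]; exact mem_Icc.2 ⟨h1, h2⟩)
  refine ⟨h.1.2.2.2.2.1, fun v hv => ?_, fun i h1 h2 => ?_, fun J hJ h2 hJk hX => ?_,
    fun J hJ h1 h2 => ?_, fun j h2 hjk x hx b hb hb' => ?_, fun x hx => ?_⟩
  · rw [hℓ.sing v hv]; exact h.2.1 v hv
  · obtain ⟨u, hu, rfl⟩ := hrep i h1 h2
    have : F.gnd.filter (fun v => F.lab k {v} = F.vIdx u) = F.vClass u := by
      ext v
      rw [mem_filter]
      constructor
      · rintro ⟨hv, hvu⟩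
        rw [hℓ.sing v hv] at hvu
        rw [← (h.2.2.1 v hv u hu).1 hvu]
        exact h.1.1 v hv
      · intro hv
        have hvg := h.1.2.1 u hu hv
        refine ⟨hvg, ?_⟩
        rw [hℓ.sing v hvg]
        exact (h.2.2.1 v hvg u hu).2 (h.1.2.2.1 v hvg u hu hv)
    rw [this]
    exact hsz u hu
  · have hJX := hℓ.mem_cross.2 ⟨hJ, rfl, hX⟩
    rw [hℓ.lbl _ h2 hJk J hJX]
    exact (h.2.2.2 _ h2 hJk).1 J hJX
  · rw [LabFam.lab, if_neg h1, if_neg]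
    rintro ⟨h3, h4, h5⟩
    exact h2 ⟨h4, h5, (hℓ.mem_cross.1 h3).2.2⟩
  · obtain ⟨i, rfl⟩ : ∃ i, j = i + 1 := ⟨j - 1, by omega⟩
    have hi : 1 ≤ i := by omega
    generalize F.lab k = ℓ at hℓ
    have hxc : #x.1 = i + 1 := hx.1
    rcases (cliqAll F.gnd ℓ x).eq_empty_or_nonempty with he | ⟨J₀, hJ₀⟩
    · intro Q _
      have : cliq F.gnd ℓ x Q = ∅ := by
        refine eq_empty_of_forall_notMem fun J hJ => ?_
        have : J ∈ cliqAll F.gnd ℓ x := by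
          simp only [cliq, cliqAll, mem_filter] at hJ ⊢
          exact ⟨hJ.1, hJ.2.1, hJ.2.2.1⟩
        rw [he] at this
        exact absurd this (notMem_empty _)
      simp [this]
    · have hp := h.polyadSpec hℓ hi (by omega)
      have hp' := h.polyadSpec hℓ (show 1 ≤ i + 1 by omega) hjk
      have hmem : ∀ J, J ∈ cliqAll F.gnd ℓ x ↔ J ⊆ F.gnd ∧ #J = i + 1 ∧ Fits ℓ x i J := by
        intro J
        simp only [cliqAll, mem_filter, mem_powerset, hxc, Nat.add_sub_cancel]
      obtain ⟨hJ₀g, hJ₀c, hJ₀f⟩ := (hmem J₀).1 hJ₀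
      have hJ₀X := hℓ.mem_cross.2 ⟨hJ₀g, hJ₀c, hJ₀f.1⟩
      have hall : cliqAll F.gnd ℓ (adr ℓ J₀) = cliqAll F.gnd ℓ x := by
        have hc : #(adr ℓ J₀).1 = #x.1 := by rw [adr, hJ₀f.1.card_shape, hJ₀c, hxc]
        refine cliqAll_congr hc fun I => ?_
        rw [hc, hxc, Nat.add_sub_cancel]
        exact hJ₀f.fits_adr_iff' (hJ₀c.trans hxc.symm)
      have hcl := (h.1.2.2.2.2.2 (i + 1) h2 hjk).2.2.2.2 J₀ hJ₀X
      rw [hp.polyCliques hℓ hi hJ₀X, hall] at hcl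
      have hX : ∀ J ∈ cliqAll F.gnd ℓ x, J ∈ F.toPartFam.cross (i + 1) := fun J hJ =>
        hℓ.mem_cross.2 ⟨((hmem J).1 hJ).1, ((hmem J).1 hJ).2.1, ((hmem J).1 hJ).2.2.1⟩
      obtain ⟨J₁, hJ₁, hJ₁b⟩ : ∃ J₁ ∈ cliqAll F.gnd ℓ x, F.lbl (i + 1) J₁ = b := by
        have him : (cliqAll F.gnd ℓ x).image (F.lbl (i + 1)) = Icc 1 (a (i + 1)) := by
          refine eq_of_subset_of_card_le (fun b hb => ?_) ?_
          · obtain ⟨J, hJ, rfl⟩ := mem_image.1 hb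
            exact mem_Icc.2 ((h.2.2.2 (i + 1) h2 hjk).1 J (hX J hJ))
          · rw [Nat.card_Icc, Nat.add_sub_cancel, ← hcl]
            refine card_image_le_card_image fun I hI J hJ hIJ => ?_
            obtain ⟨g1, g2, g3⟩ := (hmem _).1 hI
            obtain ⟨f1, f2, f3⟩ := (hmem _).1 hJ
            refine (h.2.2.2 (i + 1) h2 hjk).2.2 _ (hX I hI) _ (hX J hJ) ?_ hIJ
            ext T
            rw [Nat.add_sub_cancel, hp _ g1 g3.1 (by omega), hp _ f1 f3.1 (by omega),
              g3.fits_adr_iff' (g2.trans hxc.symm), f3.fits_adr_iff' (f2.trans hxc.symm)]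
        exact mem_image.1 (by rw [him]; exact mem_Icc.2 ⟨hb, hb'⟩)
      obtain ⟨hJ₁g, hJ₁c, hJ₁f⟩ := (hmem J₁).1 hJ₁
      obtain ⟨K, hK, hJ₁K⟩ := h.exists_crossing hℓ hk hJ₁g hJ₁f.1 (by omega)
      obtain ⟨hKg, hKc, hKX⟩ := hℓ.mem_cross.1 hK
      have hr := hreg K hK (i + 1) h2 hjk J₁ (mem_powersetCard.2 ⟨hJ₁K, hJ₁c⟩)
      refine (hℓ.regPairC_iff hi hxc (fun I => ?_) (fun J hJ => ?_) ε _).1 hr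
      · rw [Nat.add_sub_cancel, hp J₁ hJ₁g hJ₁f.1 (by omega),
          hJ₁f.fits_adr_iff' (hJ₁c.trans hxc.symm)]
      · obtain ⟨f1, f2, f3⟩ := (hmem _).1 hJ
        rw [hp' K hKg hKX (by omega), ← hJ₁b, ← hℓ.lbl (i + 1) h2 hjk J₁ (hX J₁ hJ₁),
          ← fits_adr_iff_label hJ₁f hJ₁c f3 f2 hxc hi,
          (hKX.fits_adr.subset hJ₁K).fits_adr_iff
            ((f3.shape_eq (f2.trans hxc.symm)).trans (hJ₁f.shape_eq (hJ₁c.trans hxc.symm)).symm).subset]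
        exact ⟨fun g => g.2.2, fun g => ⟨f1, f2, g⟩⟩
  · obtain ⟨i, rfl⟩ : ∃ i, k = i + 1 := ⟨k - 1, by omega⟩
    exact (hℓ.regPairC_iff (by omega) hx.1 (fun I => hℓ.mem_polyAt (by omega) le_rfl)
      (fun J _ => Iff.rfl) ε _).1 (hd x hx)

end FamilyToCore

end HypReg

namespace HypReg

open Finset

open scoped BigOperators

attribute [local instance 10] Classical.propDecidable

set_option linter.unusedSectionVars false

section CoreToFamily

variable {V : Type} [DecidableEq V] {W : Finset V} {k : ℕ} {a : ℕ → ℕ} {ε : ℝ} {d : Addr → ℝ}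
  {ℓ : Finset V → ℕ} {H : Finset (Finset V)} {I J : Finset V} {x : Addr} {i m m' : ℕ}

/-- The labelled family on `W` described by `ℓ`. -/
noncomputable def famOf (W : Finset V) (ℓ : Finset V → ℕ) : LabFam V where
  gnd := W
  vClass v := W.filter fun u => ℓ {u} = ℓ {v}
  cls j J := W.powerset.filter fun I => #I = j ∧ Fits ℓ (adr ℓ J) j I
  vIdx v := ℓ {v}
  lbl _ e := ℓ e

theorem famOf_labels (W : Finset V) (k : ℕ) (ℓ : Finset V → ℕ) : (famOf W ℓ).Labels k ℓ where
  class_iff u hu v hv := by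
    constructor
    · intro h
      change ℓ {u} = ℓ {v} at h
      simp only [famOf, h]
    · intro h
      have : u ∈ (famOf W ℓ).vClass u := mem_filter.2 ⟨hu, rfl⟩
      rw [h] at this
      exact (mem_filter.1 this).2
  sing _ _ := rfl
  lbl _ _ _ _ _ := rfl

theorem mem_famOf_cls {j : ℕ} :
    I ∈ (famOf W ℓ).cls j J ↔ I ⊆ W ∧ #I = j ∧ Fits ℓ (adr ℓ J) j I := by
  simp only [famOf, mem_filter, mem_powerset]

theorem famOf_polyadSpec (hi : 1 ≤ i) : PolyadSpec (famOf W ℓ) ℓ i := by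
  rcases eq_or_lt_of_le hi with rfl | hi
  · intro J hJ _ _ I
    refine (famOf_labels W 2 ℓ).mem_polyad_one (fun v hv => mem_filter.2 ⟨hv, rfl⟩)
      (fun v _ => filter_subset _ _) (fun u _ v _ huv => ?_) hJ
    have := (mem_filter.1 huv).2
    simp only [famOf, this]
  · exact (famOf_labels W 2 ℓ).polyadSpec_of_cls hi fun J _ I => mem_famOf_cls

theorem fits_restrictA_adr (hm : m' ≤ m) :
    Fits ℓ (restrictA (adr ℓ J) m (shape ℓ J)) m' I ↔ Fits ℓ (adr ℓ J) m' I := by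
  unfold Fits
  refine and_congr_right fun hc => and_congr_right fun hI => ?_
  refine forall_congr' fun L => forall_congr' fun hL => forall_congr' fun h2 =>
    forall_congr' fun hm' => ?_
  simp only [restrictA]
  rw [if_pos ⟨(shape_subset hL).trans hI, by rw [(hc.subset hL).card_shape]; omega,
    by rw [(hc.subset hL).card_shape]; omega⟩]

theorem Core.isAddress (h : Core W k a ε d ℓ H) (hJ : J ⊆ W) (hX : Cross ℓ J) (hm : m ≤ k - 1) :
    IsAddress #J m a (restrictA (adr ℓ J) m (shape ℓ J)) := by
  refine ⟨hX.card_shape, fun i hi => ?_, fun L hL h2 hLm => ?_, fun L hL => if_neg hL⟩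
  · obtain ⟨v, hv, rfl⟩ := mem_image.1 hi
    exact h.vertex v (hJ hv)
  · simp only [restrictA]
    have hL' : L ⊆ shape ℓ J := hL
    rw [if_pos ⟨hL', h2, hLm⟩]
    have hsh := shape_filter hL'
    have hsub : (J.filter fun v => ℓ {v} ∈ L) ⊆ J := filter_subset _ _
    simp only [adr]
    generalize (J.filter fun v => ℓ {v} ∈ L) = I at hsh hsub
    have hc : #L = #I := by rw [← hsh, (hX.subset hsub).card_shape]
    rw [hc]
    exact h.label I (hsub.trans hJ) (by omega) (by omega) (hX.subset hsub)

/-- Every label occurs at every address. -/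
def AllLabels (W : Finset V) (k : ℕ) (a : ℕ → ℕ) (ℓ : Finset V → ℕ) : Prop :=
  ∀ j, 2 ≤ j → j ≤ k - 1 → ∀ x, IsAddress j (j - 1) a x → ∀ b, 1 ≤ b → b ≤ a j →
    ∃ J ∈ cliqAll W ℓ x, ℓ J = b

theorem mem_cliqAll {J : Finset V} : J ∈ cliqAll W ℓ x ↔
    J ⊆ W ∧ #J = #x.1 ∧ Fits ℓ x (#x.1 - 1) J := by
  simp only [cliqAll, mem_filter, mem_powerset]

theorem Core.isLabeled (h : Core W k a ε d ℓ H) (hk : 2 ≤ k) (hW : a 1 ≤ #W)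
    (hN : AllLabels W k a ℓ) : (famOf W ℓ).IsLabeled k a := by
  have hℓ := famOf_labels W k ℓ
  have ha : 2 ≤ a 1 := hk.trans h.le_a
  have hne : ∀ i, 1 ≤ i → i ≤ a 1 → ∃ v ∈ W, ℓ {v} = i := by
    intro i h1 h2
    have h3 := h.size i h1 h2
    have h4 : 1 ≤ #W / a 1 := (Nat.one_le_div_iff (by omega)).2 hW
    obtain ⟨v, hv⟩ := card_pos.1 (show 0 < #(W.filter fun v => ℓ {v} = i) by omega)
    exact ⟨v, mem_filter.1 hv⟩
  have hcongr : ∀ {j : ℕ} {I J : Finset V}, 2 ≤ j → I ⊆ W → #I = j → #J = j → Cross ℓ J →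
      Fits ℓ (adr ℓ J) j I → (famOf W ℓ).cls j I = (famOf W ℓ).cls j J := by
    intro j I J _ hI hIc hJc hJX hf
    ext T
    rw [mem_famOf_cls, mem_famOf_cls, hf.fits_adr_iff' (by rw [hIc, adr, hJX.card_shape, hJc])]
  refine ⟨⟨fun v hv => mem_filter.2 ⟨hv, rfl⟩, fun v _ => filter_subset _ _,
    fun u _ v _ huv => ?_, ?_, h.le_a, fun j h2 hj => ?_⟩, h.vertex, hℓ.class_iff,
    fun j h2 hj => ?_⟩
  · have := (mem_filter.1 huv).2
    simp only [famOf, this]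
  · have h1 : #(W.image (famOf W ℓ).vClass) = #(W.image fun v => ℓ {v}) :=
      le_antisymm (card_image_le_card_image fun u hu v hv => (hℓ.class_iff u hu v hv).1)
        (card_image_le_card_image fun u hu v hv => (hℓ.class_iff u hu v hv).2)
    have h2 : (W.image fun v => ℓ {v}) = Icc 1 (a 1) := by
      ext i
      rw [mem_image, mem_Icc]
      constructor
      · rintro ⟨v, hv, rfl⟩; exact h.vertex v hv
      · exact fun hi => hne i hi.1 hi.2
    refine Eq.trans h1 ?_
    rw [h2, Nat.card_Icc, Nat.add_sub_cancel]
  · obtain ⟨i, rfl⟩ : ∃ i, j = i + 1 := ⟨j - 1, by omega⟩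
    have hi : 1 ≤ i := by omega
    have hpc : ∀ J ∈ (famOf W ℓ).toPartFam.cross (i + 1),
        (famOf W ℓ).toPartFam.polyCliques (i + 1) J = cliqAll W ℓ (adr ℓ J) := fun J hJ =>
      (famOf_polyadSpec hi).polyCliques hℓ hi hJ
    have hax : ∀ J ∈ (famOf W ℓ).toPartFam.cross (i + 1), #(adr ℓ J).1 = i + 1 := fun J hJ => by
      obtain ⟨-, h2, h3⟩ := hℓ.mem_cross.1 hJ
      rw [adr, h3.card_shape, h2]
    have hX : ∀ J ∈ (famOf W ℓ).toPartFam.cross (i + 1), ∀ I ∈ cliqAll W ℓ (adr ℓ J),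
        I ⊆ W ∧ #I = i + 1 ∧ Fits ℓ (adr ℓ J) i I := fun J hJ I hI => by
      rw [mem_cliqAll, hax J hJ] at hI
      exact hI
    refine ⟨fun J hJ => ?_, fun J hJ I hI => ?_, fun J hJ I hI => ?_, fun J hJ I hI => ?_,
      fun J hJ => ?_⟩
    · obtain ⟨h1, h2, h3⟩ := hℓ.mem_cross.1 hJ
      exact mem_famOf_cls.2 ⟨h1, h2, h3.fits_adr⟩
    · obtain ⟨h1, h2', h3⟩ := hℓ.mem_cross.1 hJ
      obtain ⟨g1, g2, g3⟩ := mem_famOf_cls.1 hI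
      exact hcongr h2 g1 g2 h2' h3 g3
    · obtain ⟨g1, g2, g3⟩ := mem_famOf_cls.1 hI
      rw [hpc J hJ, mem_cliqAll, hax J hJ]
      exact ⟨g1, g2, g3.mono (Nat.sub_le _ _)⟩
    · rw [hpc J hJ] at hI
      obtain ⟨g1, g2, g3⟩ := hX J hJ I hI
      exact hℓ.mem_cross.2 ⟨g1, g2, g3.1⟩
    · obtain ⟨f1, f2, f3⟩ := hℓ.mem_cross.1 hJ
      rw [hpc J hJ]
      have h1 : ∀ S ∈ cliqAll W ℓ (adr ℓ J), ∀ T ∈ cliqAll W ℓ (adr ℓ J),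
          ((famOf W ℓ).cls (i + 1) S = (famOf W ℓ).cls (i + 1) T ↔ ℓ S = ℓ T) := by
        intro S hS T hT
        obtain ⟨s1, s2, s3⟩ := hX J hJ S hS
        obtain ⟨t1, t2, t3⟩ := hX J hJ T hT
        have key := fits_adr_iff_label t3 t2 s3 s2 (hax J hJ) hi
        rw [← key]
        constructor
        · intro hST
          have : S ∈ (famOf W ℓ).cls (i + 1) S := mem_famOf_cls.2 ⟨s1, s2, s3.1.fits_adr⟩
          rw [hST] at this
          exact (mem_famOf_cls.1 this).2.2
        · exact hcongr h2 s1 s2 t2 t3.1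
      rw [le_antisymm (card_image_le_card_image fun S hS T hT => (h1 S hS T hT).2)
        (card_image_le_card_image fun S hS T hT => (h1 S hS T hT).1)]
      have hcl : cliqAll W ℓ (adr ℓ J) =
          cliqAll W ℓ (restrictA (adr ℓ J) i (shape ℓ J)) :=
        cliqAll_congr rfl fun I => by
          rw [hax J hJ, Nat.add_sub_cancel]; exact (fits_restrictA_adr le_rfl).symm
      have him : (cliqAll W ℓ (adr ℓ J)).image ℓ = Icc 1 (a (i + 1)) := by
        ext b
        rw [mem_image, mem_Icc]
        constructor
        · rintro ⟨S, hS, rfl⟩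
          obtain ⟨s1, s2, s3⟩ := hX J hJ S hS
          have := h.label S s1 (by omega) (by omega) s3.1
          rwa [s2] at this
        · rintro ⟨hb, hb'⟩
          have hadr := h.isAddress (m := i) f1 f3 (by omega)
          rw [f2] at hadr
          rw [hcl]
          exact hN (i + 1) h2 hj _ hadr b hb hb'
      rw [him, Nat.card_Icc, Nat.add_sub_cancel]
  · obtain ⟨i, rfl⟩ : ∃ i, j = i + 1 := ⟨j - 1, by omega⟩
    have hi : 1 ≤ i := by omega
    refine ⟨fun I hI => ?_, fun I hI I' hI' => ?_, fun I hI I' hI' hp hl => ?_⟩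
    · obtain ⟨f1, f2, f3⟩ := hℓ.mem_cross.1 hI
      have := h.label I f1 (by omega) (by omega) f3
      rwa [f2] at this
    · obtain ⟨f1, f2, f3⟩ := hℓ.mem_cross.1 hI
      obtain ⟨g1, g2, g3⟩ := mem_famOf_cls.1 hI'
      exact (fits_adr_iff_label f3.fits_adr f2 (g3.mono (Nat.le_succ i)) g2
        (by rw [adr, f3.card_shape, f2]) hi).1 g3
    · obtain ⟨f1, f2, f3⟩ := hℓ.mem_cross.1 hI
      obtain ⟨g1, g2, g3⟩ := hℓ.mem_cross.1 hI'
      rw [Nat.add_sub_cancel] at hp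
      have h3 : Fits ℓ (adr ℓ I') i I := by
        refine fits_of_facets hi f2 f3 fun T hT hTc => ?_
        have := (famOf_polyadSpec (W := W) hi I f1 f3 (by omega) T).2
          ⟨hT.trans f1, hTc, f3.fits_adr.subset hT⟩
        rw [hp] at this
        exact ((famOf_polyadSpec (W := W) hi I' g1 g3 (by omega) T).1 this).2.2
      exact hcongr h2 f1 f2 g2 g3 ((fits_adr_iff_label g3.fits_adr g2 h3 f2
        (by rw [adr, g3.card_shape, g2]) hi).2 hl)

theorem Core.isEquitPartition (h : Core W k a ε d ℓ H) (hk : 2 ≤ k) (hW : a 1 ≤ #W)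
    (hN : AllLabels W k a ℓ) : (famOf W ℓ).IsEquitPartition k a ε d H := by
  have hℓ := famOf_labels W k ℓ
  have ha : 2 ≤ a 1 := hk.trans h.le_a
  refine ⟨h.isLabeled hk hW hN, ⟨?_, fun v hv => ?_, fun K hK j h2 hj J hJ => ?_⟩, fun x hx => ?_⟩
  · rw [one_div, inv_mul_cancel₀]
    exact_mod_cast (by omega : a 1 ≠ 0)
  · exact h.size _ (h.vertex v hv).1 (h.vertex v hv).2
  · obtain ⟨i, rfl⟩ : ∃ i, j = i + 1 := ⟨j - 1, by omega⟩
    have hi : 1 ≤ i := by omega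
    obtain ⟨hJK, hJc⟩ := mem_powersetCard.1 hJ
    obtain ⟨hKg, hKc, hKX⟩ := hℓ.mem_cross.1 hK
    have hJX := hKX.subset hJK
    have hadr := h.isAddress (m := i) (hJK.trans hKg) hJX (by omega)
    rw [hJc] at hadr
    have hl := h.label J (hJK.trans hKg) (by omega) (by omega) hJX
    rw [hJc] at hl
    have hxc : #(restrictA (adr ℓ J) i (shape ℓ J)).1 = i + 1 := hadr.1
    refine (hℓ.regPairC_iff hi hxc (fun I => ?_) (fun S hS => ?_) ε _).2
      (h.reg (i + 1) h2 hj _ hadr (ℓ J) hl.1 hl.2)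
    · rw [fits_restrictA_adr le_rfl]
      exact famOf_polyadSpec hi J (hJK.trans hKg) hJX (by omega) I
    · rw [mem_cliqAll, hxc, Nat.add_sub_cancel, fits_restrictA_adr le_rfl] at hS
      obtain ⟨s1, s2, s3⟩ := hS
      have hax : #(adr ℓ J).1 = i + 1 := by rw [adr, hJX.card_shape, hJc]
      rw [famOf_polyadSpec (by omega) K hKg hKX (by omega),
        ← fits_adr_iff_label hJX.fits_adr hJc s3 s2 hax hi,
        (hKX.fits_adr.subset hJK).fits_adr_iff s3.2.1]
      exact ⟨fun g => g.2.2, fun g => ⟨s1, s2, g⟩⟩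
  · obtain ⟨i, rfl⟩ : ∃ i, k = i + 1 := ⟨k - 1, by omega⟩
    exact (hℓ.regPairC_iff (by omega) hx.1 (fun I => hℓ.mem_polyAt (by omega) le_rfl)
      (fun J _ => Iff.rfl) ε _).2 (h.regH x hx)

end CoreToFamily

end HypReg

namespace HypReg

open Finset

open scoped BigOperators

attribute [local instance 10] Classical.propDecidable

set_option linter.unusedSectionVars false

section Counting

variable {V : Type} [DecidableEq V] {W : Finset V} {k : ℕ} {a : ℕ → ℕ} {ε : ℝ} {d : Addr → ℝ}
  {ℓ : Finset V → ℕ} {H : Finset (Finset V)} {I J : Finset V} {x y : Addr} {i j m m' : ℕ}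
  {B : Finset ℕ}

theorem fits_restrictA_iff (hB : B ⊆ y.1) (hm : m' ≤ m) :
    Fits ℓ (restrictA y m B) m' I ↔ Fits ℓ y m' I ∧ shape ℓ I ⊆ B := by
  constructor
  · rintro ⟨h1, h2, h3⟩
    refine ⟨⟨h1, h2.trans hB, fun L hL hL2 hLm => ?_⟩, h2⟩
    have h4 := h3 L hL hL2 hLm
    simp only [restrictA] at h4
    rwa [if_pos ⟨(shape_subset hL).trans h2, by rw [(h1.subset hL).card_shape]; omega,
      by rw [(h1.subset hL).card_shape]; omega⟩] at h4
  · rintro ⟨⟨h1, -, h3⟩, h2⟩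
    refine ⟨h1, h2, fun L hL hL2 hLm => ?_⟩
    simp only [restrictA]
    rw [if_pos ⟨(shape_subset hL).trans h2, by rw [(h1.subset hL).card_shape]; omega,
      by rw [(h1.subset hL).card_shape]; omega⟩]
    exact h3 L hL hL2 hLm

theorem IsAddress.restrictA {l : ℕ} (h : IsAddress l m' a y) (hB : B ⊆ y.1) (hm : m ≤ m') :
    IsAddress #B m a (restrictA y m B) := by
  obtain ⟨-, h2, h3, -⟩ := h
  refine ⟨rfl, fun i hi => h2 i (hB hi), fun L hL hL2 hLm => ?_, fun L hL => if_neg hL⟩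
  have hL' : L ⊆ B := hL
  simp only [HypReg.restrictA]
  rw [if_pos ⟨hL', hL2, hLm⟩]
  exact h3 L (hL'.trans hB) hL2 (hLm.trans hm)

/-- The complex of all subsets of `W` fitting `y`, with vertex classes indexed by `f`. -/
noncomputable def fitCx (W : Finset V) (ℓ : Finset V → ℕ) (y : Addr) (f : Fin k → ℕ) : Cx V k where
  C t := W.filter fun v => ℓ {v} = f t
  G j := W.powerset.filter fun J => #J = j ∧ Fits ℓ y j J

variable {f : Fin k → ℕ}

theorem mem_fitCx_G : J ∈ (fitCx W ℓ y f).G j ↔ J ⊆ W ∧ #J = j ∧ Fits ℓ y j J := by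
  simp only [fitCx, mem_filter, mem_powerset]

theorem mem_sup_fitCx_C (L : Finset (Fin k)) {v : V} :
    v ∈ L.sup (fitCx W ℓ y f).C ↔ v ∈ W ∧ ℓ {v} ∈ L.image f := by
  simp only [fitCx, mem_sup, mem_filter, mem_image]
  constructor
  · rintro ⟨t, ht, hv, h⟩; exact ⟨hv, t, ht, h.symm⟩
  · rintro ⟨hv, t, ht, h⟩; exact ⟨t, ht, hv, h.symm⟩

theorem subset_sup_fitCx_C (L : Finset (Fin k)) :
    I ⊆ L.sup (fitCx W ℓ y f).C ↔ I ⊆ W ∧ shape ℓ I ⊆ L.image f := by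
  simp only [subset_iff, mem_sup_fitCx_C, shape, mem_image, forall_exists_index, and_imp,
    forall_apply_eq_imp_iff₂]
  exact ⟨fun h => ⟨fun v hv => (h hv).1, fun v hv => (h hv).2⟩,
    fun h v hv => ⟨h.1 hv, h.2 v hv⟩⟩

theorem fitCx_cross :
    (fitCx W ℓ y f).cross j = (famOf (fitCx W ℓ y f).gnd ℓ).toPartFam.cross j := by
  ext S
  rw [(famOf_labels (fitCx W ℓ y f).gnd k ℓ).mem_cross]
  simp only [Cx.cross, mem_filter, mem_powersetCard, and_assoc]
  refine and_congr_right fun hS => and_congr_right fun _ => ?_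
  constructor
  · intro h u hu v hv huv
    obtain ⟨hu1, hu2⟩ := (mem_sup_fitCx_C univ).1 (hS hu)
    obtain ⟨hv1, -⟩ := (mem_sup_fitCx_C univ).1 (hS hv)
    obtain ⟨t, -, ht⟩ := mem_image.1 hu2
    exact card_le_one.1 (h t) u (mem_inter.2 ⟨hu, mem_filter.2 ⟨hu1, ht.symm⟩⟩) v
      (mem_inter.2 ⟨hv, mem_filter.2 ⟨hv1, huv.symm.trans ht.symm⟩⟩)
  · intro h t
    refine card_le_one.2 fun u hu v hv => ?_
    obtain ⟨hu1, hu2⟩ := mem_inter.1 hu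
    obtain ⟨hv1, hv2⟩ := mem_inter.1 hv
    exact h hu1 hv1 ((mem_filter.1 hu2).2.trans (mem_filter.1 hv2).2.symm)

theorem cliqAll_fitCx_gnd (hx : x.1 ⊆ univ.image f) :
    cliqAll (fitCx W ℓ y f).gnd ℓ x = cliqAll W ℓ x := by
  ext J
  rw [mem_cliqAll, mem_cliqAll, Cx.gnd, subset_sup_fitCx_C]
  exact ⟨fun h => ⟨h.1.1, h.2⟩, fun h => ⟨⟨h.1, h.2.2.2.1.trans hx⟩, h.2⟩⟩

theorem cliq_eq_filter {Q : Finset (Finset V)} :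
    cliq W ℓ x Q = (cliqAll W ℓ x).filter fun J => ∀ I ⊆ J, #I + 1 = #x.1 → I ∈ Q := by
  ext J
  simp only [cliq, cliqAll, mem_filter, and_assoc]

theorem regAt_fitCx_gnd (hx : x.1 ⊆ univ.image f) {D : ℝ} {P : Finset V → Prop} :
    RegAt (fitCx W ℓ y f).gnd ℓ x ε D P ↔ RegAt W ℓ x ε D P := by
  unfold RegAt
  simp only [cliq_eq_filter, cliqAll_fitCx_gnd hx]

theorem fitCx_isComplex (hf : Function.Injective f) (hfy : univ.image f = y.1) (n : ℕ) :
    (fitCx W ℓ y f).IsComplex n := by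
  have hgnd : ∀ {j J}, J ∈ (fitCx W ℓ y f).G j → J ⊆ (fitCx W ℓ y f).gnd := fun {j J} hJ => by
    obtain ⟨h1, h2, h3⟩ := mem_fitCx_G.1 hJ
    rw [Cx.gnd, subset_sup_fitCx_C, hfy]
    exact ⟨h1, h3.2.1⟩
  refine ⟨fun s t hst => ?_, fun j h2 _ J hJ => ?_, fun j h3 _ J hJ => ?_⟩
  · refine disjoint_left.2 fun v hv hv' => hst (hf ?_)
    exact (mem_filter.1 hv).2.symm.trans (mem_filter.1 hv').2
  · rw [fitCx_cross, (famOf_labels (fitCx W ℓ y f).gnd k ℓ).mem_cross]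
    exact ⟨hgnd hJ, (mem_fitCx_G.1 hJ).2.1, (mem_fitCx_G.1 hJ).2.2.1⟩
  · obtain ⟨h1, h2, h3⟩ := mem_fitCx_G.1 hJ
    refine mem_filter.2 ⟨mem_powersetCard.2 ⟨hgnd hJ, h2⟩, fun I hI => ?_⟩
    obtain ⟨hI, hIc⟩ := mem_powersetCard.1 hI
    exact mem_fitCx_G.2 ⟨hI.trans h1, hIc, (h3.subset hI).mono (Nat.sub_le _ _)⟩

theorem mem_fitCx_restr (hfy : univ.image f = y.1) (hi : 1 ≤ i) (L : Finset (Fin k)) :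
    I ∈ (fitCx W ℓ y f).restr i L ↔ I ⊆ (fitCx W ℓ y f).gnd ∧ #I = i ∧
      Fits ℓ (restrictA y i (L.image f)) i I := by
  have hL : L.image f ⊆ y.1 := by rw [← hfy]; exact image_subset_image (subset_univ _)
  rw [fits_restrictA_iff hL le_rfl, Cx.gnd, subset_sup_fitCx_C, hfy]
  unfold Cx.restr
  split_ifs with h1
  · subst h1
    simp only [HypReg.sing, mem_image]
    constructor
    · rintro ⟨v, hv, rfl⟩
      rw [mem_sup_fitCx_C] at hv
      have hs : shape ℓ {v} ⊆ L.image f := by simpa [shape] using hv.2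
      exact ⟨⟨by simpa using hv.1, hs.trans hL⟩, by simp,
        ⟨by simp [Cross], hs.trans hL, fun L hL h2 h1 => by omega⟩, hs⟩
    · rintro ⟨⟨h1, -⟩, h3, -, h4⟩
      obtain ⟨v, rfl⟩ := card_eq_one.1 h3
      refine ⟨v, ?_, rfl⟩
      rw [mem_sup_fitCx_C]
      exact ⟨by simpa using h1, by simpa [shape] using h4⟩
  · rw [mem_filter, mem_fitCx_G, subset_sup_fitCx_C]
    exact ⟨fun h => ⟨⟨h.1.1, h.1.2.2.2.1⟩, h.1.2.1, h.1.2.2, h.2.2⟩,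
      fun h => ⟨⟨h.1.1, h.2.1, h.2.2.1⟩, h.1.1, h.2.2.2⟩⟩

theorem Core.fitCx_isRegular (h : Core W k a ε d ℓ H) (hf : Function.Injective f)
    (hfy : univ.image f = y.1) (hy : IsAddress k (k - 1) a y) :
    (fitCx W ℓ y f).IsRegular (k - 1) ε fun j => 1 / (a j : ℝ) := by
  intro j h2 hj L hL
  obtain ⟨i, rfl⟩ : ∃ i, j = i + 1 := ⟨j - 1, by omega⟩
  have hi : 1 ≤ i := by omega
  have hLc := (mem_powersetCard.1 hL).2
  have hLy : L.image f ⊆ y.1 := by rw [← hfy]; exact image_subset_image (subset_univ _)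
  have hLi : #(L.image f) = i + 1 := by rw [card_image_of_injective _ hf, hLc]
  have hadr := hy.restrictA hLy (show i ≤ k - 1 by omega)
  rw [hLi] at hadr
  have hb := hy.2.2.1 (L.image f) hLy (by omega) (by omega)
  rw [hLi] at hb
  rw [Nat.add_sub_cancel, fitCx_cross]
  refine ((famOf_labels (fitCx W ℓ y f).gnd k ℓ).regPairC_iff hi hadr.1
    (fun I => mem_fitCx_restr hfy hi L) (fun J hJ => ?_) ε _).2 ((regAt_fitCx_gnd ?_).2
    (h.reg (i + 1) h2 hj _ hadr _ hb.1 hb.2))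
  · have hJ : J ∈ cliqAll (fitCx W ℓ y f).gnd ℓ _ := hJ
    rw [cliqAll_fitCx_gnd (by rw [hfy]; exact hLy), mem_cliqAll] at hJ
    obtain ⟨h1, h2, h3⟩ := hJ
    have hs := h3.shape_eq h2
    rw [hadr.1] at h2 h3
    rw [Nat.add_sub_cancel, fits_restrictA_iff hLy le_rfl] at h3
    rw [mem_fitCx_G]
    change shape ℓ J = L.image f at hs
    constructor
    · rintro ⟨-, -, g⟩
      rw [g.2.2 J Subset.rfl (by omega) (by omega), hs]
    · intro g
      refine ⟨h1, h2, h3.1.1, h3.1.2.1, fun S hS hS2 hSi => ?_⟩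
      rcases eq_or_lt_of_le hSi with h4 | h4
      · rw [eq_of_subset_of_card_le hS (by omega), g, hs]
      · exact h3.1.2.2 S hS hS2 (by omega)
  · rw [hfy]; exact hLy

theorem Kset_fitCx (hk : 3 ≤ k) (hfy : univ.image f = y.1) (hyc : #y.1 = k) :
    Kset (fitCx W ℓ y f).gnd (k - 1) k ((fitCx W ℓ y f).G (k - 1)) = cliqAll W ℓ y := by
  ext J
  rw [mem_cliqAll, hyc]
  simp only [Kset, mem_filter, mem_powersetCard, and_imp, mem_fitCx_G, Cx.gnd,
    subset_sup_fitCx_C, hfy]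
  constructor
  · rintro ⟨⟨⟨h1, -⟩, h2⟩, h3⟩
    have hk' : #J = (k - 1) + 1 := by omega
    exact ⟨h1, h2, fits_of_facets (by omega) hk'
      (cross_of_facets (by omega) hk' fun I hI hIc => (h3 I hI hIc).2.2.1)
      fun I hI hIc => (h3 I hI hIc).2.2⟩
  · rintro ⟨h1, h2, h3⟩
    exact ⟨⟨⟨h1, h3.2.1⟩, h2⟩, fun I hI hIc => ⟨hI.trans h1, hIc, h3.subset hI⟩⟩

theorem card_cliqAll_two {p q : ℕ} (hpq : p ≠ q) (hy : y.1 = {p, q}) :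
    #(W.filter fun v => ℓ {v} = p) * #(W.filter fun v => ℓ {v} = q) ≤ #(cliqAll W ℓ y) := by
  rw [← card_product]
  refine card_le_card_of_injOn (fun z => {z.1, z.2}) (fun z hz => ?_) ?_
  · obtain ⟨hz1, hz2⟩ := mem_product.1 hz
    obtain ⟨u, v⟩ := z
    obtain ⟨hu, rfl⟩ := mem_filter.1 hz1
    obtain ⟨hv, rfl⟩ := mem_filter.1 hz2
    have huv : u ≠ v := fun h => hpq (by rw [h])
    have hsh : shape ℓ {u, v} = y.1 := by rw [hy, shape, image_insert, image_singleton]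
    have hc : #y.1 = 2 := by rw [hy, card_pair hpq]
    refine mem_coe.2 (mem_cliqAll.2 ⟨?_, ?_, ?_, hsh.subset, fun L _ h2 h1 => by omega⟩)
    · intro w hw
      simp only [mem_insert, mem_singleton] at hw
      rcases hw with rfl | rfl
      · exact hu
      · exact hv
    · rw [hc, card_pair huv]
    · refine card_image_iff.1 ?_
      change #(shape ℓ {u, v}) = _
      rw [hsh, hc, card_pair huv]
  · rintro ⟨u, v⟩ hz ⟨u', v'⟩ hz' h
    simp only [coe_product, Set.mem_prod, mem_coe, mem_filter] at hz hz'
    change ({u, v} : Finset V) = {u', v'} at h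
    have h1 : u ∈ ({u', v'} : Finset V) := by rw [← h]; simp
    have h2 : v ∈ ({u', v'} : Finset V) := by rw [← h]; simp
    simp only [mem_insert, mem_singleton] at h1 h2
    rcases h1 with rfl | rfl
    · rcases h2 with rfl | rfl
      · exact absurd (hz.1.2.symm.trans hz.2.2) hpq
      · rfl
    · exact absurd (hz.1.2.symm.trans hz'.2.2) hpq

theorem CountingProp.le_card_cliqAll {eCL : ℝ → ℝ → ℕ → ℕ → ℝ} {mCL : ℝ → ℝ → ℕ → ℕ → ℕ}
    (hCL : CountingProp eCL mCL) (hk : 3 ≤ k) (h : Core W k a ε d ℓ H)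
    (hy : IsAddress k (k - 1) a y) {t : ℕ} (ht : 2 ≤ t) (ha : ∀ j, 1 ≤ j → j ≤ k - 1 → 1 ≤ a j)
    (hat : ∀ j, 1 ≤ j → j ≤ k - 1 → a j ≤ t)
    (hε : 0 < ε) (hεCL : ε ≤ eCL (1 / (t : ℝ)) (1 / (t : ℝ)) (k - 1) k)
    (hm : mCL (1 / (t : ℝ)) (1 / (t : ℝ)) (k - 1) k ≤ #W / a 1) (hm5 : 5 ≤ #W / a 1) :
    1 / 2 * ((∏ j ∈ Icc 2 (k - 1), (1 / (t : ℝ)) ^ (k.choose j)) * ((#W / a 1 : ℕ) : ℝ) ^ k) ≤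
      #(cliqAll W ℓ y) := by
  have ht0 : (0 : ℝ) < t := by exact_mod_cast (by omega : 0 < t)
  have ht2 : 1 / (t : ℝ) ≤ 1 / 2 := one_div_le_one_div_of_le two_pos (by exact_mod_cast ht)
  obtain ⟨f, hf, hfy⟩ : ∃ f : Fin k → ℕ, Function.Injective f ∧ univ.image f = y.1 :=
    ⟨y.1.orderEmbOfFin hy.1, (y.1.orderEmbOfFin hy.1).injective, by
      rw [← coe_inj, coe_image, coe_univ, Set.image_univ, range_orderEmbOfFin]⟩
  have hsize : ∀ i, #((fitCx W ℓ y f).C i) = #W / a 1 ∨ #((fitCx W ℓ y f).C i) = #W / a 1 + 1 := by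
    intro i
    have : f i ∈ y.1 := by rw [← hfy]; exact mem_image_of_mem _ (mem_univ i)
    exact h.size (f i) (hy.2.1 _ this).1 (hy.2.1 _ this).2
  have hsize' : ∀ i, ((#W / a 1 : ℕ) : ℝ) ≤ #((fitCx W ℓ y f).C i) := by
    intro i
    rcases hsize i with h | h
    · rw [h]
    · rw [h]; push_cast; linarith
  have hda : ∀ j, 2 ≤ j → j ≤ k - 1 → 1 / (t : ℝ) ≤ 1 / (a j : ℝ) := fun j h2 hj =>
    one_div_le_one_div_of_le (by exact_mod_cast ha j (by omega) hj)
      (by exact_mod_cast hat j (by omega) hj)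
  have key := (hCL (1 / (t : ℝ)) (1 / (t : ℝ)) (by positivity) (by positivity) (k - 1) k (by omega)
    (by omega)).2 V (fitCx W ℓ y f) (#W / a 1) (1 / 5) ε (fun j => 1 / (a j : ℝ)) (by norm_num)
    (by norm_num) hε hεCL hm hda (fitCx_isComplex hf hfy _) ?_ (h.fitCx_isRegular hf hfy hy)
  · rw [Kset_fitCx hk hfy hy.1] at key
    have hP : (∏ j ∈ Icc 2 (k - 1), (1 / (t : ℝ)) ^ (k.choose j)) * ((#W / a 1 : ℕ) : ℝ) ^ k ≤
        (∏ j ∈ Icc 2 (k - 1), (1 / (a j : ℝ)) ^ (k.choose j)) *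
          ∏ i, (#((fitCx W ℓ y f).C i) : ℝ) := by
      refine mul_le_mul ?_ ?_ (by positivity) (by positivity)
      · refine prod_le_prod (fun _ _ => by positivity) fun j hj => ?_
        obtain ⟨h2, hj⟩ := mem_Icc.1 hj
        exact pow_le_pow_left₀ (by positivity) (hda j h2 hj) _
      · calc ((#W / a 1 : ℕ) : ℝ) ^ k = ∏ i : Fin k, ((#W / a 1 : ℕ) : ℝ) := by simp
          _ ≤ _ := prod_le_prod (fun _ _ => by positivity) fun i _ => hsize' i
    have hP0 : 0 ≤ (∏ j ∈ Icc 2 (k - 1), (1 / (a j : ℝ)) ^ (k.choose j)) *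
          ∏ i, (#((fitCx W ℓ y f).C i) : ℝ) := by positivity
    have := (abs_le.1 key).1
    nlinarith [mul_le_mul_of_nonneg_right ht2 hP0]
  · intro i
    have : (5 : ℝ) ≤ ((#W / a 1 : ℕ) : ℝ) := by exact_mod_cast hm5
    rcases hsize i with h | h <;> (rw [h, abs_le]; push_cast; constructor <;> linarith)

theorem RegInstance.one_le {eRI : ℕ → ℕ → ℝ} (h : RegInstance eRI k ε a d) : ∀ j, 1 ≤ j →
    j ≤ k - 1 → 1 ≤ a j := h.2.1

theorem le_maxA (h1 : 1 ≤ j) (hj : j ≤ k - 1) : a j ≤ maxA k a :=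
  le_sup (f := a) (mem_Icc.2 ⟨h1, hj⟩)

theorem exists_cliqAll_lower_bound {eRI : ℕ → ℕ → ℝ} (hERI : GoodERI eRI) (hk : 2 ≤ k) {ε₀ : ℝ}
    (hε : 0 < ε₀) : ∃ (T n₀ : ℕ) (c : ℝ), 0 < c ∧ ∀ (a : ℕ → ℕ) (d : Addr → ℝ),
      RegInstance eRI k (2 * ε₀ / 3) a d → (∀ j, 1 ≤ j → j ≤ k - 1 → a j ≤ T) ∧
        ∀ (V : Type) [DecidableEq V] (W : Finset V) (ℓ : Finset V → ℕ) (H : Finset (Finset V)),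
          n₀ ≤ #W → Core W k a ε₀ d ℓ H → ∀ y, IsAddress k (k - 1) a y →
            c * (#W : ℝ) ^ k ≤ #(cliqAll W ℓ y) := by
  obtain ⟨-, -, -, hlim, eCL, mCL, hCL, hlt⟩ := hERI
  obtain ⟨T₀, hT₀⟩ := Filter.eventually_atTop.1
    ((hlim k).eventually (gt_mem_nhds (show (0 : ℝ) < 2 * ε₀ / 3 by positivity)))
  obtain ⟨T, hT0, hT⟩ : ∃ T : ℕ, 1 ≤ T ∧ T₀ ≤ T := ⟨T₀ + 1, by omega, by omega⟩
  have hTr : (0 : ℝ) < T := by exact_mod_cast hT0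
  refine ⟨T, 10 * T + T * ∑ t ∈ range (T + 1), mCL (1 / (t : ℝ)) (1 / (t : ℝ)) (k - 1) k,
    1 / 2 * ((∏ j ∈ Icc 2 (k - 1), (1 / (T : ℝ)) ^ (k.choose j)) * (1 / (2 * T : ℝ)) ^ k),
    by positivity, fun a d hR => ?_⟩
  have ha1 : 1 ≤ a 1 := hR.one_le 1 le_rfl (by omega)
  have ha1t : a 1 ≤ maxA k a := le_maxA le_rfl (by omega)
  have htT : maxA k a ≤ T := by
    by_contra hcon
    have h1 := hT₀ (maxA k a) (by omega)
    have h2 := hR.2.2.2.1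
    linarith
  refine ⟨fun j h1 hj => (le_maxA h1 hj).trans htT, ?_⟩
  intro V _ W ℓ H hn hcore y hy
  have ht2 : 2 ≤ maxA k a := (hk.trans hcore.le_a).trans ha1t
  obtain ⟨t, ht⟩ : ∃ t, t = maxA k a := ⟨_, rfl⟩
  rw [← ht] at ht2 htT ha1t
  have haT : a 1 ≤ T := ha1t.trans htT
  have hmr : (#W : ℝ) * (1 / (2 * T : ℝ)) ≤ ((#W / a 1 : ℕ) : ℝ) := by
    have h1 : (#W : ℝ) ≤ a 1 * (((#W / a 1 : ℕ) : ℝ) + 1) := by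
      exact_mod_cast (Nat.lt_mul_div_succ #W ha1).le
    have h2 : (10 * T : ℝ) ≤ #W := by exact_mod_cast (le_trans (Nat.le_add_right _ _) hn)
    have h3 : (a 1 : ℝ) * (((#W / a 1 : ℕ) : ℝ) + 1) ≤ T * (((#W / a 1 : ℕ) : ℝ) + 1) := by
      have : (a 1 : ℝ) ≤ T := by exact_mod_cast haT
      gcongr
    rw [mul_one_div, div_le_iff₀ (by positivity)]
    nlinarith
  have hmain : 1 / 2 * ((∏ j ∈ Icc 2 (k - 1), (1 / (t : ℝ)) ^ (k.choose j)) *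
      ((#W / a 1 : ℕ) : ℝ) ^ k) ≤ #(cliqAll W ℓ y) := by
    rcases eq_or_lt_of_le hk with rfl | hk3
    · obtain ⟨p, q, hpq, hyp⟩ := card_eq_two.1 hy.1
      have h1 := card_cliqAll_two (W := W) (ℓ := ℓ) hpq hyp
      have hsz : ∀ i ∈ y.1, #W / a 1 ≤ #(W.filter fun v => ℓ {v} = i) := fun i hi => by
        have := hcore.size i (hy.2.1 i hi).1 (hy.2.1 i hi).2
        omega
      have h2 := Nat.mul_le_mul (hsz p (by simp [hyp])) (hsz q (by simp [hyp]))
      have h3 : (((#W / a 1 : ℕ) : ℝ)) ^ 2 ≤ #(cliqAll W ℓ y) := by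
        rw [sq]; exact_mod_cast h2.trans h1
      simp only [Nat.add_one_sub_one, Order.lt_two_iff, le_refl, Icc_eq_empty_of_lt,
        Finset.prod_empty, one_mul]
      nlinarith [sq_nonneg ((#W / a 1 : ℕ) : ℝ)]
    · refine hCL.le_card_cliqAll hk3 hcore hy ht2 hR.one_le
        (fun j h1 hj => ht ▸ le_maxA h1 hj) hε ?_ ?_ ?_
      · have h1 := hlt t k (by omega) hk
        have h2 := hR.2.2.2.1
        rw [← ht] at h2
        have h3 : 0 < eCL (1 / (t : ℝ)) (1 / (t : ℝ)) (k - 1) k := by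
          have : (0 : ℝ) < t := by exact_mod_cast (by omega : 0 < t)
          exact (hCL _ _ (by positivity) (by positivity) (k - 1) k (by omega) (by omega)).1.1
        have h4 : (1 : ℝ) ≤ (t : ℝ) ^ (4 ^ k) := one_le_pow₀ (by exact_mod_cast (by omega : 1 ≤ t))
        rw [lt_div_iff₀ (by positivity)] at h1
        nlinarith
      · refine (Nat.le_div_iff_mul_le ha1).2 (le_trans ?_ hn)
        rw [mul_comm]
        refine le_trans (Nat.mul_le_mul haT ?_) (Nat.le_add_left _ _)
        exact single_le_sum (f := fun t : ℕ => mCL (1 / (t : ℝ)) (1 / (t : ℝ)) (k - 1) k)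
          (fun _ _ => Nat.zero_le _) (mem_range.2 (by omega))
      · refine (Nat.le_div_iff_mul_le ha1).2 (le_trans ?_ hn)
        refine le_trans ?_ (Nat.le_add_right _ _)
        omega
  refine le_trans ?_ hmain
  rw [mul_assoc, mul_assoc, ← mul_pow, mul_comm (1 / (2 * T : ℝ))]
  have ht0 : (0 : ℝ) < t := by exact_mod_cast (by omega : 0 < t)
  refine mul_le_mul_of_nonneg_left (mul_le_mul ?_ ?_ (by positivity) (by positivity)) (by norm_num)
  · refine prod_le_prod (fun _ _ => by positivity) fun j _ => ?_
    refine pow_le_pow_left₀ (by positivity) (one_div_le_one_div_of_le ht0 ?_) _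
    exact_mod_cast htT
  · exact pow_le_pow_left₀ (by positivity) hmr _

end Counting

end HypReg

namespace HypReg

open Finset

open scoped BigOperators

attribute [local instance 10] Classical.propDecidable

set_option linter.unusedSectionVars false

section Extension

variable {V : Type} [DecidableEq V] {W : Finset V} {k : ℕ} {a : ℕ → ℕ} {ε : ℝ} {d : Addr → ℝ}
  {ℓ : Finset V → ℕ} {H : Finset (Finset V)} {x : Addr} {b j : ℕ}

/-- An address and a label at it extend to an address of full size. -/
theorem IsAddress.exists_extend (hx : IsAddress j (j - 1) a x) (h2 : 2 ≤ j) (hj : j ≤ k - 1)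
    (ha : ∀ i, 1 ≤ i → i ≤ k - 1 → 1 ≤ a i) (hk : k ≤ a 1) (hb1 : 1 ≤ b) (hb : b ≤ a j) :
    ∃ y, IsAddress k (k - 1) a y ∧ x.1 ⊆ y.1 ∧ y.2 x.1 = b ∧
      ∀ L ⊆ x.1, 2 ≤ #L → #L ≤ j - 1 → y.2 L = x.2 L := by
  obtain ⟨hc, hbd, hlab, hz⟩ := hx
  obtain ⟨S, hxS, hS, hSc⟩ := exists_subsuperset_card_eq (s := x.1) (t := Icc 1 (a 1)) (n := k)
    (fun i hi => mem_Icc.2 (hbd i hi)) (by omega) (by simpa using hk)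
  refine ⟨(S, fun L => if L ⊆ S ∧ 2 ≤ #L ∧ #L ≤ k - 1 then
      (if L = x.1 then b else if L ⊆ x.1 then x.2 L else 1) else 0),
    ⟨hSc, fun i hi => mem_Icc.1 (hS hi), fun L hL hL2 hLk => ?_, fun L hL => ?_⟩, hxS, ?_,
    fun L hL hL2 hLj => ?_⟩
  · simp only
    rw [if_pos ⟨hL, hL2, hLk⟩]
    split_ifs with h1 h3
    · rw [h1, hc]; exact ⟨hb1, hb⟩
    · refine hlab L h3 hL2 ?_
      have := card_lt_card (h3.ssubset_of_ne h1)
      omega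
    · exact ⟨le_rfl, ha _ (by omega) hLk⟩
  · simp only
    rw [if_neg hL]
  · simp only
    rw [if_pos ⟨hxS, by omega, by omega⟩, if_pos trivial]
  · simp only
    rw [if_pos ⟨hL.trans hxS, hL2, by omega⟩, if_neg, if_pos hL]
    rintro rfl
    omega

theorem card_cliqAll_le_of_extend {y : Addr} (hy : #y.1 = k) (hj : #x.1 ≤ k - 1) (h2 : 2 ≤ #x.1)
    (hxy : x.1 ⊆ y.1) (hb : y.2 x.1 = b)
    (hL : ∀ L ⊆ x.1, 2 ≤ #L → #L ≤ #x.1 - 1 → y.2 L = x.2 L) :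
    #(cliqAll W ℓ y) ≤ #((cliqAll W ℓ x).filter fun J => ℓ J = b) * #W ^ (k - #x.1) := by
  have h1 : #(cliqAll W ℓ y) ≤ #(((cliqAll W ℓ x).filter fun J => ℓ J = b) ×ˢ
      W.powersetCard (k - #x.1)) := by
    refine card_le_card_of_injOn
      (fun K => (K.filter fun v => ℓ {v} ∈ x.1, K \ K.filter fun v => ℓ {v} ∈ x.1)) ?_ ?_
    · intro K hK
      obtain ⟨hKW, hKc, hKf⟩ := mem_cliqAll.1 hK
      obtain ⟨J, hJ⟩ : ∃ J, J = K.filter fun v => ℓ {v} ∈ x.1 := ⟨_, rfl⟩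
      have hJK : J ⊆ K := hJ ▸ filter_subset _ _
      have hs : shape ℓ J = x.1 := by
        rw [hJ, shape_filter]; rw [hKf.shape_eq hKc]; exact hxy
      have hJc : #J = #x.1 := by rw [← hs, (hKf.1.subset hJK).card_shape]
      simp only [coe_product, Set.mem_prod, mem_coe, mem_filter, mem_powersetCard, ← hJ]
      refine ⟨⟨mem_cliqAll.2 ⟨hJK.trans hKW, hJc, hKf.1.subset hJK, hs.subset,
        fun L hLJ hL2 hLc => ?_⟩, ?_⟩, sdiff_subset.trans hKW, ?_⟩
      · rw [hKf.2.2 L (hLJ.trans hJK) hL2 (by omega)]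
        have h3 := (hKf.1.subset (hLJ.trans hJK)).card_shape
        exact hL _ ((shape_subset hLJ).trans hs.subset) (by omega) (by omega)
      · rw [hKf.2.2 J hJK (by omega) (by omega), hs, hb]
      · rw [card_sdiff_of_subset hJK, hKc, hy, hJc]
    · intro K _ K' _ h
      simp only [Prod.mk.injEq] at h
      have h3 : ∀ K : Finset V, (K.filter fun v => ℓ {v} ∈ x.1) ∪
          (K \ K.filter fun v => ℓ {v} ∈ x.1) = K := fun K =>
        union_sdiff_of_subset (filter_subset _ _)
      rw [← h3 K, h.2, h.1, h3 K']
  rw [card_product, card_powersetCard] at h1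
  exact h1.trans (Nat.mul_le_mul_left _ (Nat.choose_le_pow _ _))

/-- Every label is frequent at every address, provided the addresses of full size are. -/
theorem Core.le_card_label {c : ℝ} (h : Core W k a ε d ℓ H)
    (ha : ∀ i, 1 ≤ i → i ≤ k - 1 → 1 ≤ a i) (hW : 1 ≤ #W)
    (hc : ∀ y, IsAddress k (k - 1) a y → c * (#W : ℝ) ^ k ≤ #(cliqAll W ℓ y))
    (h2 : 2 ≤ j) (hj : j ≤ k - 1) (hx : IsAddress j (j - 1) a x) (hb1 : 1 ≤ b) (hb : b ≤ a j) :
    c * (#W : ℝ) ^ j ≤ #((cliqAll W ℓ x).filter fun J => ℓ J = b) := by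
  obtain ⟨y, hy, hxy, hyb, hyL⟩ := hx.exists_extend h2 hj ha h.le_a hb1 hb
  have hxc := hx.1
  have h1 := card_cliqAll_le_of_extend (W := W) (ℓ := ℓ) hy.1 (by omega) (by omega) hxy hyb
    (by rw [hxc]; exact hyL)
  have h3 := (hc y hy).trans (Nat.cast_le.2 h1)
  rw [hxc] at h3
  push_cast at h3
  have hW' : (0 : ℝ) < #W := by exact_mod_cast hW
  rw [show k = j + (k - j) by omega, pow_add, ← mul_assoc, show j + (k - j) - j = k - j by omega]
    at h3
  exact le_of_mul_le_mul_right h3 (by positivity)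

end Extension

end HypReg

namespace HypReg

open Finset

open scoped BigOperators

attribute [local instance 10] Classical.propDecidable

set_option linter.unusedSectionVars false

section Counting

variable {V κ : Type} [DecidableEq V]

/-- The restriction of a colouring to the subsets of `W`. -/
def res (W : Finset V) (Z : Finset V → κ) : Finset W → κ := fun e => Z (e.image Subtype.val)

theorem image_val_subset {W : Finset V} (e : Finset W) : e.image Subtype.val ⊆ W := by
  intro v hv
  obtain ⟨w, -, rfl⟩ := mem_image.1 hv
  exact w.2

theorem pat_res {I : Type} [DecidableEq I] (W : Finset V) (Z : Finset V → κ) (ψ : I → W)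
    (D : Finset I) : pat (res W Z) ψ D = Z (D.image fun i => (ψ i : V)) := by
  simp only [pat, res, image_image]
  rfl

/-- The patterns of the cliques at the address `x`, with labels read by `lab`, facets in `q` and
the top set in `t`. -/
def CliquePat (x : Addr) (lab : κ → ℕ) (q t : κ → Prop) (p : Finset x.1 → κ) : Prop :=
  (∀ i : x.1, lab (p {i}) = i) ∧
  (∀ D : Finset x.1, 2 ≤ #D → #D ≤ #x.1 - 1 → lab (p D) = x.2 (D.image Subtype.val)) ∧
  (∀ D : Finset x.1, #D + 1 = #x.1 → q (p D)) ∧ t (p univ)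

variable {W : Finset V} {ℓ : Finset V → ℕ} {x : Addr} {m : ℕ}

theorem shape_image {f : x.1 → V} (hf : ∀ i, ℓ {f i} = i) (D : Finset x.1) :
    shape ℓ (D.image f) = D.image Subtype.val := by
  simp only [shape, image_image]
  exact image_congr fun i _ => hf i

theorem injective_of_labels {f : x.1 → V} (hf : ∀ i, ℓ {f i} = i) : Function.Injective f :=
  fun i i' h => Subtype.ext (by rw [← hf i, ← hf i', h])

theorem univ_image_val : (univ : Finset x.1).image Subtype.val = x.1 := by
  ext i; simp

theorem fits_image_iff {f : x.1 → V} (hf : ∀ i, ℓ {f i} = i) :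
    Fits ℓ x m (univ.image f) ↔ ∀ D : Finset x.1, 2 ≤ #D → #D ≤ m →
      ℓ (D.image f) = x.2 (D.image Subtype.val) := by
  have hinj := injective_of_labels hf
  constructor
  · intro h D h2 hm
    rw [h.2.2 _ (image_subset_image (subset_univ D)) (by rwa [card_image_of_injective _ hinj])
      (by rwa [card_image_of_injective _ hinj]), shape_image hf]
  · refine fun h => ⟨?_, by rw [shape_image hf, univ_image_val], fun L hL h2 hm => ?_⟩
    · intro u hu v hv huv
      obtain ⟨i, -, rfl⟩ := mem_image.1 (mem_coe.1 hu)
      obtain ⟨i', -, rfl⟩ := mem_image.1 (mem_coe.1 hv)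
      simp only [hf] at huv
      rw [Subtype.ext huv]
    · obtain ⟨D, -, rfl⟩ := subset_image_iff.1 hL
      rw [card_image_of_injective _ hinj] at h2 hm
      rw [h D h2 hm, shape_image hf]

theorem card_cliq_filter (Z : Finset V → κ) (lab : κ → ℕ) (q t : κ → Prop) {Q : Finset (Finset V)}
    {P : Finset V → Prop} [DecidablePred P] (hlab : ∀ e ⊆ W, lab (Z e) = ℓ e)
    (hq : ∀ e ⊆ W, #e + 1 = #x.1 → (q (Z e) ↔ e ∈ Q)) (ht : ∀ e ⊆ W, t (Z e) ↔ P e) :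
    #((cliq W ℓ x Q).filter P) =
      #(univ.filter fun ψ : x.1 → W => CliquePat x lab q t (pat (res W Z) ψ)) := by
  symm
  have hsub : ∀ (ψ : x.1 → W) (D : Finset x.1), (D.image fun i => (ψ i : V)) ⊆ W := by
    intro ψ D v hv
    obtain ⟨i, -, rfl⟩ := mem_image.1 hv
    exact (ψ i).2
  have key : ∀ ψ : x.1 → W, (∀ i, ℓ {(ψ i : V)} = i) → (CliquePat x lab q t (pat (res W Z) ψ) ↔
      (univ.image fun i => (ψ i : V)) ∈ (cliq W ℓ x Q).filter P) := by
    intro ψ hψ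
    have hinj := injective_of_labels (f := fun i => (ψ i : V)) hψ
    simp only [CliquePat, pat_res, mem_filter, cliq, mem_powerset, image_singleton,
      fits_image_iff (f := fun i => (ψ i : V)) hψ]
    rw [card_image_of_injective _ hinj, card_univ, Fintype.card_coe]
    have h1 : ∀ i : x.1, lab (Z {(ψ i : V)}) = i := fun i => by
      rw [hlab _ (by simp), hψ]
    simp only [h1, hlab _ (hsub ψ _), hsub ψ univ, true_and, implies_true, ht _ (hsub ψ _)]
    rw [and_assoc]
    refine and_congr_right fun _ => and_congr_left fun _ => ⟨fun h I hI hIc => ?_, fun h D hD => ?_⟩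
    · obtain ⟨D, -, rfl⟩ := subset_image_iff.1 hI
      rw [card_image_of_injective _ hinj] at hIc
      exact (hq _ (hsub ψ D) (by rwa [card_image_of_injective _ hinj])).1 (h D hIc)
    · have hc : #(D.image fun i => (ψ i : V)) + 1 = #x.1 := by
        rwa [card_image_of_injective _ hinj]
      exact (hq _ (hsub ψ D) hc).2 (h _ (image_subset_image (subset_univ D)) hc)
  have hvl : ∀ ψ : x.1 → W, CliquePat x lab q t (pat (res W Z) ψ) → ∀ i, ℓ {(ψ i : V)} = i := by
    intro ψ h i
    rw [← hlab _ (by simp), ← h.1 i, pat_res, image_singleton]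
  refine card_bij (fun ψ _ => univ.image fun i => (ψ i : V)) (fun ψ hψ => ?_)
    (fun ψ hψ ψ' hψ' h => ?_) fun J hJ => ?_
  · have := (mem_filter.1 hψ).2
    exact (key ψ (hvl ψ this)).1 this
  · have h1 := hvl ψ (mem_filter.1 hψ).2
    have h2 := hvl ψ' (mem_filter.1 hψ').2
    funext i
    have h3 : (ψ i : V) ∈ univ.image fun i => (ψ' i : V) := by
      rw [← h]; exact mem_image_of_mem _ (mem_univ i)
    obtain ⟨i', -, hi'⟩ := mem_image.1 h3
    have h4 : i' = i := Subtype.ext (by rw [← h1 i, ← h2 i', hi'])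
    exact Subtype.ext (by rw [← hi', h4])
  · have hJ' := hJ
    simp only [cliq, mem_filter, mem_powerset] at hJ'
    obtain ⟨⟨hJW, hJc, hJf, -⟩, -⟩ := hJ'
    have hs := hJf.shape_eq hJc
    have h1 : ∀ i : x.1, ∃ w : W, (w : V) ∈ J ∧ ℓ {(w : V)} = i := by
      intro i
      have : (i : ℕ) ∈ shape ℓ J := hs.symm ▸ i.2
      obtain ⟨v, hv, hvi⟩ := mem_image.1 this
      exact ⟨⟨v, hJW hv⟩, hv, hvi⟩
    choose ψ hψJ hψ using h1
    have h2 : (univ.image fun i => (ψ i : V)) = J := by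
      refine eq_of_subset_of_card_le ?_ ?_
      · intro v hv
        obtain ⟨i, -, rfl⟩ := mem_image.1 hv
        exact hψJ i
      · rw [card_image_of_injective _ (injective_of_labels (f := fun i => (ψ i : V)) hψ),
          card_univ, Fintype.card_coe, hJc]
    exact ⟨ψ, mem_filter.2 ⟨mem_univ _, (key ψ hψ).2 (h2 ▸ hJ)⟩, h2⟩

theorem card_cliq_filter_eq_expect [Nonempty W] (Z : Finset V → κ) (lab : κ → ℕ) (q t : κ → Prop)
    {Q : Finset (Finset V)} {P : Finset V → Prop} [DecidablePred P]
    (hlab : ∀ e ⊆ W, lab (Z e) = ℓ e) (hq : ∀ e ⊆ W, #e + 1 = #x.1 → (q (Z e) ↔ e ∈ Q))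
    (ht : ∀ e ⊆ W, t (Z e) ↔ P e) :
    (#((cliq W ℓ x Q).filter P) : ℝ) / (#W : ℝ) ^ #x.1 =
      𝔼 ψ : x.1 → W, if CliquePat x lab q t (pat (res W Z) ψ) then (1 : ℝ) else 0 := by
  rw [card_cliq_filter Z lab q t hlab hq ht, Fintype.expect_eq_sum_div_card, sum_boole]
  simp

/-- Close colourings have nearly the same clique densities. -/
theorem Close.card_cliq_filter {M : ℕ} {γ : ℝ} {V' : Type} [DecidableEq V'] {W' : Finset V'}
    {ℓ' : Finset V' → ℕ} [Nonempty W] [Nonempty W'] {Z : Finset V → κ} {Z' : Finset V' → κ}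
    (h : Close M γ (res W Z) (res W' Z')) (hM : #x.1 ≤ M) (lab : κ → ℕ) (q t : κ → Prop)
    {Q : Finset (Finset V)} {P : Finset V → Prop} [DecidablePred P]
    {Q' : Finset (Finset V')} {P' : Finset V' → Prop} [DecidablePred P']
    (hlab : ∀ e ⊆ W, lab (Z e) = ℓ e) (hq : ∀ e ⊆ W, #e + 1 = #x.1 → (q (Z e) ↔ e ∈ Q))
    (ht : ∀ e ⊆ W, t (Z e) ↔ P e)
    (hlab' : ∀ e ⊆ W', lab (Z' e) = ℓ' e)
    (hq' : ∀ e ⊆ W', #e + 1 = #x.1 → (q (Z' e) ↔ e ∈ Q')) (ht' : ∀ e ⊆ W', t (Z' e) ↔ P' e) :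
    |(#((cliq W ℓ x Q).filter P) : ℝ) / (#W : ℝ) ^ #x.1 -
      (#((cliq W' ℓ' x Q').filter P') : ℝ) / (#W' : ℝ) ^ #x.1| ≤ γ := by
  rw [card_cliq_filter_eq_expect Z lab q t hlab hq ht,
    card_cliq_filter_eq_expect Z' lab q t hlab' hq' ht']
  refine h.apply (I := x.1) (by simpa using hM)
    (fun p => if CliquePat x lab q t p then (1 : ℝ) else 0) (fun p => ?_) (fun p => ?_) <;>
  split_ifs <;> norm_num

theorem cliq_powerset : cliq W ℓ x W.powerset = cliqAll W ℓ x := by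
  rw [cliq_eq_filter]
  refine filter_true_of_mem fun J hJ I hI _ => mem_powerset.2 (hI.trans (mem_cliqAll.1 hJ).1)

end Counting

end HypReg

namespace HypReg

open Finset

open scoped BigOperators

attribute [local instance 10] Classical.propDecidable

set_option linter.unusedSectionVars false

section Regularity

variable {V : Type} [DecidableEq V]

/-- The colouring of sets of vertices obtained from a colouring of the subsets of `W`. -/
def unres {β : Type} (W : Finset V) (B : Finset W → β) : Finset V → β :=
  fun e => B (e.subtype (· ∈ W))

theorem unres_image_val {β : Type} {W : Finset V} (B : Finset W → β) (e : Finset W) :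
    unres W B (e.image Subtype.val) = B e := by
  simp only [unres]
  congr 1
  ext w
  simp

theorem regularity_arithmetic {ε δ c D γ u u' v v' w w' : ℝ} (hε : 0 ≤ ε) (hε1 : ε ≤ 1)
    (hδ : 0 < δ) (hδ1 : δ ≤ 1) (hc : 0 < c) (hγ : γ = δ ^ 2 * c / 6) (hD : 0 ≤ D) (hD1 : D ≤ 1)
    (hu : c ≤ u) (huu : |u - u'| ≤ γ) (hvv : |v - v'| ≤ γ) (hww : |w - w'| ≤ γ)
    (h : ε * u ≤ v → |w - D * v| ≤ ε * v) (hv : (ε + δ) * u' ≤ v') :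
    |w' - D * v'| ≤ (ε + δ) * v' := by
  rw [abs_le] at huu hvv hww
  have hδ2 : δ ^ 2 ≤ δ := by nlinarith
  have hγ0 : 0 < γ := by rw [hγ]; positivity
  have hδc : δ ^ 2 * c ≤ δ * c := by gcongr
  have h6 : 6 * γ = δ ^ 2 * c := by rw [hγ]; ring
  have hγc : γ ≤ c / 6 := by nlinarith
  have hu' : (ε + δ) * (u - γ) ≤ (ε + δ) * u' := by gcongr; linarith
  have hδu : δ * c ≤ δ * u := by gcongr
  have hεγ : (ε + δ) * γ ≤ 2 * γ := by gcongr; linarith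
  have h1 := abs_le.1 (h (by nlinarith))
  have hεu : 0 ≤ ε * (u - γ) := mul_nonneg hε (by linarith)
  have h2 : δ * (c - γ) ≤ v' := by nlinarith [mul_le_mul_of_nonneg_left hu hδ.le]
  have h3 : 3 * γ ≤ δ * v' := by
    have h4 : δ * (δ * (c - γ)) ≤ δ * v' := by gcongr
    have h5 : δ ^ 2 * γ ≤ δ ^ 2 * (c / 6) := by gcongr
    nlinarith
  have h7 : ε * v ≤ ε * v' + γ := by nlinarith
  have h8 : D * v ≤ D * v' + γ := by nlinarith
  have h9 : D * v' ≤ D * v + γ := by nlinarith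
  rw [abs_le]
  constructor <;> nlinarith

/-- Regularity passes to close colourings. -/
theorem exists_regAt_transfer (α : Type) [Fintype α] (k : ℕ) {δ c : ℝ} (hδ : 0 < δ) (hδ1 : δ ≤ 1)
    (hc : 0 < c) : ∃ (M : ℕ) (γ : ℝ) (n₀ : ℕ), 0 < γ ∧
    ∀ (V : Type) [DecidableEq V] (W W' : Finset V), W.Nonempty → W'.Nonempty → n₀ ≤ #W → n₀ ≤ #W' →
    ∀ Z Z' : Finset V → α, Close M γ (res W Z) (res W' Z') →
    ∀ (lab : α → ℕ) (t : α → Prop) (ℓ ℓ' : Finset V → ℕ) (P P' : Finset V → Prop),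
      (∀ e ⊆ W, lab (Z e) = ℓ e) → (∀ e ⊆ W', lab (Z' e) = ℓ' e) →
      (∀ e ⊆ W, t (Z e) ↔ P e) → (∀ e ⊆ W', t (Z' e) ↔ P' e) →
    ∀ (x : Addr) (ε D : ℝ), #x.1 ≤ k → 0 ≤ ε → ε ≤ 1 → 0 ≤ D → D ≤ 1 →
      c * (#W : ℝ) ^ #x.1 ≤ #(cliqAll W ℓ x) → RegAt W ℓ x ε D P → RegAt W' ℓ' x (ε + δ) D P' := by
  obtain ⟨M, γ, n₀, hγ, hlift⟩ := Close.exists_lift α Prop (k - 1) k (δ ^ 2 * c / 6) (by positivity)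
  refine ⟨M, γ, n₀, hγ, ?_⟩
  intro V _ W W' hW hW' hn hn' Z Z' hZ lab t ℓ ℓ' P P' hlab hlab' ht ht' x ε D hx hε hε1 hD hD1 hlow
    hreg Q' hQ'
  have := hW.to_subtype
  have := hW'.to_subtype
  obtain ⟨B, -, hB⟩ := hlift W' W (by simpa using hn') (by simpa using hn) _ _ hZ.symm
    (fun e => #e ≤ k - 1 → e.image Subtype.val ∈ Q') (fun e he => by
      have : ¬ #e ≤ k - 1 := by omega
      simp only [this, false_imp_iff]
      rfl)
  obtain ⟨Y, hY⟩ : ∃ Y : Finset V → α × Prop, Y = fun e => (Z e, unres W B e) := ⟨_, rfl⟩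
  obtain ⟨Y', hY'⟩ : ∃ Y' : Finset V → α × Prop, Y' = fun e => (Z' e, #e ≤ k - 1 → e ∈ Q') :=
    ⟨_, rfl⟩
  have e1 : res W Y = fun e => (res W Z e, B e) := by
    funext e
    rw [hY]
    simp only [res]
    rw [unres_image_val]
  have e2 : res W' Y' = fun e => (res W' Z' e, #e ≤ k - 1 → e.image Subtype.val ∈ Q') := by
    funext e
    rw [hY']
    simp only [res]
    rw [card_image_of_injective _ Subtype.val_injective]
  rw [← e1, ← e2] at hB
  have hY1 : ∀ e, (Y e).1 = Z e := fun e => by rw [hY]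
  have hY1' : ∀ e, (Y' e).1 = Z' e := fun e => by rw [hY']
  have hY2 : ∀ e, (Y e).2 = unres W B e := fun e => by rw [hY]
  have hY2' : ∀ e, #e + 1 = #x.1 → ((Y' e).2 ↔ e ∈ Q') := fun e he => by
    rw [hY']
    exact ⟨fun h => h (by omega), fun h _ => h⟩
  obtain ⟨Q, hQ⟩ : ∃ Q, Q = W.powerset.filter fun e => unres W B e := ⟨_, rfl⟩
  have hYQ : ∀ e ⊆ W, #e + 1 = #x.1 → ((Y e).2 ↔ e ∈ Q) := fun e he _ => by
    rw [hY2, hQ, mem_filter, mem_powerset]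
    exact ⟨fun h => ⟨he, h⟩, fun h => h.2⟩
  have f0 : ∀ (U : Finset V) (l : Finset V → ℕ) (R : Finset (Finset V)),
      (cliq U l x R).filter (fun _ => True) = cliq U l x R := fun _ _ _ => by simp
  have c1 := hB.symm.card_cliq_filter hx (fun y => lab y.1) (fun _ => True) (fun _ => True)
    (Q := W.powerset) (P := fun _ => True) (Q' := W'.powerset) (P' := fun _ => True)
    (fun e he => by rw [hY1, hlab e he]) (fun e he _ => iff_of_true trivial (mem_powerset.2 he))
    (fun _ _ => Iff.rfl) (fun e he => by rw [hY1', hlab' e he])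
    (fun e he _ => iff_of_true trivial (mem_powerset.2 he)) (fun _ _ => Iff.rfl)
  have c2 := hB.symm.card_cliq_filter hx (fun y => lab y.1) (fun y => y.2) (fun _ => True)
    (P := fun _ => True) (P' := fun _ => True)
    (fun e he => by rw [hY1, hlab e he]) hYQ
    (fun _ _ => Iff.rfl) (fun e he => by rw [hY1', hlab' e he])
    (fun e he h => hY2' e h) (fun _ _ => Iff.rfl)
  have c3 := hB.symm.card_cliq_filter hx (fun y => lab y.1) (fun y => y.2) (fun y => t y.1)
    (P := P) (P' := P')
    (fun e he => by rw [hY1, hlab e he]) hYQ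
    (fun e he => by rw [hY1, ht e he]) (fun e he => by rw [hY1', hlab' e he])
    (fun e he h => hY2' e h) (fun e he => by rw [hY1', ht' e he])
  rw [f0, f0, cliq_powerset, cliq_powerset] at c1
  rw [f0, f0] at c2
  have hWp : (0 : ℝ) < (#W : ℝ) ^ #x.1 := by
    have : (0 : ℝ) < #W := by exact_mod_cast hW.card_pos
    positivity
  have hWp' : (0 : ℝ) < (#W' : ℝ) ^ #x.1 := by
    have : (0 : ℝ) < #W' := by exact_mod_cast hW'.card_pos
    positivity
  have key := regularity_arithmetic hε hε1 hδ hδ1 hc rfl hD hD1 ((le_div_iff₀ hWp).2 hlow) c1 c2 c3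
    (fun h => by
      rw [← mul_div_assoc, div_le_div_iff_of_pos_right hWp] at h
      have := hreg Q h
      rwa [← mul_div_assoc, ← sub_div, abs_div, abs_of_pos hWp, ← mul_div_assoc,
        div_le_div_iff_of_pos_right hWp])
    (by rwa [← mul_div_assoc, div_le_div_iff_of_pos_right hWp'])
  rwa [← mul_div_assoc, ← sub_div, abs_div, abs_of_pos hWp', ← mul_div_assoc,
        div_le_div_iff_of_pos_right hWp'] at key

end Regularity

end HypReg

namespace HypReg

open Finset

open scoped BigOperators

attribute [local instance 10] Classical.propDecidable

set_option linter.unusedSectionVars false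

section Repair

/-- A map can be modified to have fibres of prescribed sizes by changing few values. -/
theorem exists_prescribed_fibres {U : Type} [Fintype U] (f : U → ℕ) (I : Finset ℕ) (t : ℕ → ℕ)
    (ht : ∑ i ∈ I, t i = Fintype.card U) : ∃ g : U → ℕ, (∀ u, g u ∈ I) ∧
      (∀ i ∈ I, #(univ.filter fun u => g u = i) = t i) ∧
      #(univ.filter fun u => g u ≠ f u) ≤
        #(univ.filter fun u => f u ∉ I) + ∑ i ∈ I, (#(univ.filter fun u => f u = i) - t i) := by
  have h1 : ∀ i, ∃ e : U → ℕ, (∀ u u', f u = i → f u' = i → e u = e u' → u = u') ∧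
      ∀ u, f u = i → e u < #(univ.filter fun u => f u = i) := by
    intro i
    obtain ⟨e⟩ : Nonempty ((univ.filter fun u => f u = i) ≃
      Fin #(univ.filter fun u => f u = i)) := ⟨equivFin _⟩
    refine ⟨fun u => if h : f u = i then (e ⟨u, by simpa using h⟩ : ℕ) else 0,
      fun u u' hu hu' h => ?_, fun u hu => ?_⟩
    · simp only [hu, hu', dif_pos] at h
      have := e.injective (Fin.ext h)
      exact congrArg Subtype.val this
    · simp only [hu, dif_pos, Fin.is_lt]
  choose e he hlt using h1
  obtain ⟨S, hS⟩ : ∃ S, S = univ.filter fun u => f u ∈ I ∧ e (f u) u < t (f u) := ⟨_, rfl⟩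
  obtain ⟨g, hg⟩ := Finset.exists_equiv_extend_of_card_eq
    (t := I.sigma fun i => range (t i)) (s := S) (f := fun u => (⟨f u, e (f u) u⟩ : Σ _ : ℕ, ℕ))
    (by rw [card_sigma, ← ht]; simp)
    (by
      intro p hp
      obtain ⟨u, hu, rfl⟩ := mem_image.1 hp
      rw [hS, mem_filter] at hu
      exact mem_sigma.2 ⟨hu.2.1, mem_range.2 hu.2.2⟩)
    (by
      intro u _ u' _ h
      simp only [Sigma.mk.injEq, heq_eq_eq] at h
      refine he (f u) u u' rfl h.1.symm ?_
      rw [h.2, h.1])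
  refine ⟨fun u => (g u).1.1, fun u => (mem_sigma.1 (g u).2).1, fun i hi => ?_, ?_⟩
  · have h2 : #(univ.filter fun u => (g u).1.1 = i) = #(range (t i)) := by
      refine card_bij (fun u _ => (g u).1.2) (fun u hu => ?_) (fun u hu u' hu' h => ?_)
        fun s hs => ?_
      · have := (mem_sigma.1 (g u).2).2
        rwa [(mem_filter.1 hu).2] at this
      · refine g.injective (Subtype.ext (Sigma.ext ?_ (heq_of_eq h)))
        rw [(mem_filter.1 hu).2, (mem_filter.1 hu').2]
      · refine ⟨g.symm ⟨⟨i, s⟩, mem_sigma.2 ⟨hi, hs⟩⟩, ?_, ?_⟩ <;> simp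
    rw [h2, card_range]
  · have h3 : (univ.filter fun u => (g u).1.1 ≠ f u) ⊆ (univ.filter fun u => f u ∉ I) ∪
        I.biUnion fun i => univ.filter fun u => f u = i ∧ t i ≤ e i u := by
      intro u hu
      rw [mem_filter] at hu
      rw [mem_union, mem_filter, mem_biUnion]
      by_contra hcon
      rw [not_or] at hcon
      have hI : f u ∈ I := by
        by_contra h; exact hcon.1 ⟨mem_univ _, h⟩
      have hlt : e (f u) u < t (f u) := by
        by_contra h
        exact hcon.2 ⟨f u, hI, mem_filter.2 ⟨mem_univ _, rfl, not_lt.1 h⟩⟩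
      refine hu.2 ?_
      have := hg u (by rw [hS, mem_filter]; exact ⟨mem_univ _, hI, hlt⟩)
      rw [this]
    refine (card_le_card h3).trans ((card_union_le _ _).trans (Nat.add_le_add_left ?_ _))
    refine card_biUnion_le.trans (sum_le_sum fun i _ => ?_)
    rw [← Nat.card_Ico]
    refine card_le_card_of_injOn (e i) (fun u hu => ?_) fun u hu u' hu' h => ?_
    · have := (mem_filter.1 (mem_coe.1 hu)).2
      rw [coe_Ico, Set.mem_Ico]
      exact ⟨this.2, hlt i u this.1⟩
    · exact he i u u' (mem_filter.1 (mem_coe.1 hu)).2.1 (mem_filter.1 (mem_coe.1 hu')).2.1 h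

theorem sum_equitable_sizes {n a : ℕ} (ha : 1 ≤ a) :
    ∑ i ∈ Icc 1 a, (n / a + if i ≤ n % a then 1 else 0) = n := by
  have h1 : (Icc 1 a).filter (fun i => i ≤ n % a) = Icc 1 (n % a) := by
    have := Nat.mod_lt n ha
    ext i
    simp only [mem_filter, mem_Icc]
    omega
  rw [sum_add_distrib, ← card_filter, h1]
  simp only [sum_const, Nat.card_Icc, add_tsub_cancel_right, smul_eq_mul]
  exact Nat.div_add_mod n a

variable {I V : Type} [DecidableEq I] [DecidableEq V] {k : ℕ} {a : ℕ → ℕ}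

/-- Adjust a labelling so that the labels of all sets of at least two vertices are in the allowed
range. -/
noncomputable def fixCol (k : ℕ) (a : ℕ → ℕ) (r : Finset I → ℕ) (e : Finset I) : ℕ :=
  if #e = 1 then r e else if 2 ≤ #e ∧ #e ≤ k - 1 ∧ Cross r e then max 1 (min (r e) (a #e)) else 0

theorem fixCol_image (r : Finset V → ℕ) {f : I → V} (hf : Function.Injective f) (D : Finset I) :
    fixCol k a r (D.image f) = fixCol k a (fun D => r (D.image f)) D := by
  have h : Cross r (D.image f) ↔ Cross (fun D => r (D.image f)) D := by
    simp only [Cross, Set.InjOn, mem_coe, forall_mem_image, image_singleton, hf.eq_iff]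
  simp only [fixCol, card_image_of_injective _ hf, h]

theorem fixCol_singleton (r : Finset I → ℕ) (i : I) : fixCol k a r {i} = r {i} := by
  simp [fixCol]

theorem cross_fixCol {r : Finset I → ℕ} {e : Finset I} : Cross (fixCol k a r) e ↔ Cross r e := by
  simp only [Cross, fixCol_singleton]

theorem Core.fixCol_eq {W : Finset V} {ε : ℝ} {d : Addr → ℝ} {ℓ : Finset V → ℕ}
    {H : Finset (Finset V)} (h : Core W k a ε d ℓ H) {e : Finset V} (he : e ⊆ W) :
    fixCol k a ℓ e = ℓ e := by
  unfold fixCol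
  split_ifs with h1 h2
  · rfl
  · have := h.label e he h2.1 h2.2.1 h2.2.2
    omega
  · exact (h.zero e he h1 h2).symm

/-- Truncation of a number to a finite type. -/
def clip (T m : ℕ) : Fin (T + 1) := ⟨min m T, by omega⟩

theorem clip_val {T m : ℕ} (h : m ≤ T) : (clip T m : ℕ) = m := min_eq_left h

theorem clip_self {T : ℕ} (i : Fin (T + 1)) : clip T i = i := Fin.ext (clip_val (by omega))

theorem expect_unit [Fintype V] [Nonempty V] (P : V → Prop) [DecidablePred P] :
    𝔼 ψ : Unit → V, (if P (ψ ()) then (1 : ℝ) else 0) =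
      (#(univ.filter P) : ℝ) / Fintype.card V := by
  rw [Fintype.expect_equiv (Equiv.funUnique Unit V) (fun ψ => if P (ψ ()) then (1 : ℝ) else 0)
    (fun v => if P v then (1 : ℝ) else 0) (fun ψ => rfl), Fintype.expect_eq_sum_div_card, sum_boole]

theorem expect_hits_le [Fintype I] [Fintype V] [Nonempty V] (P : V → Prop) [DecidablePred P] :
    𝔼 ψ : I → V, (if ∃ i, P (ψ i) then (1 : ℝ) else 0) ≤
      Fintype.card I * ((#(univ.filter P) : ℝ) / Fintype.card V) := by
  have h1 : ∀ ψ : I → V, (if ∃ i, P (ψ i) then (1 : ℝ) else 0) ≤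
      ∑ i, if P (ψ i) then (1 : ℝ) else 0 := by
    intro ψ
    split_ifs with h
    · obtain ⟨i, hi⟩ := h
      refine le_trans ?_ (single_le_sum (f := fun i => if P (ψ i) then (1 : ℝ) else 0)
        (fun i _ => by split_ifs <;> norm_num) (mem_univ i))
      rw [if_pos hi]
    · exact sum_nonneg fun i _ => by split_ifs <;> norm_num
  refine (expect_le_expect fun ψ _ => h1 ψ).trans ?_
  rw [expect_sum_comm]
  have h2 : ∀ i : I, 𝔼 ψ : I → V, (if P (ψ i) then (1 : ℝ) else 0) =
      (#(univ.filter P) : ℝ) / Fintype.card V := by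
    intro i
    rw [← expect_unit P]
    exact expect_comp_injective (fun _ : Unit => i) (fun _ _ _ => rfl)
      fun ψ => if P (ψ ()) then (1 : ℝ) else 0
  simp only [h2, sum_const, card_univ, nsmul_eq_mul, le_refl]

theorem abs_expect_sub_le_of_hits [Fintype I] [Fintype V] [Nonempty V] (P : V → Prop)
    [DecidablePred P] (f g : (I → V) → ℝ) (h : ∀ ψ, (∀ i, ¬ P (ψ i)) → f ψ = g ψ)
    (hb : ∀ ψ, |f ψ - g ψ| ≤ 1) : |𝔼 ψ, f ψ - 𝔼 ψ, g ψ| ≤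
      Fintype.card I * ((#(univ.filter P) : ℝ) / Fintype.card V) := by
  rw [← expect_sub_distrib]
  refine (abs_expect_le' _).trans (le_trans (expect_le_expect fun ψ _ => ?_) (expect_hits_le P))
  split_ifs with hψ
  · exact hb ψ
  · rw [h ψ (not_exists.1 hψ), sub_self, abs_zero]

theorem abs_expect_fixCol_sub_le {T M : ℕ} [Fintype V] [Nonempty V] (A : Finset V → Prop)
    (B : Finset V → Fin (T + 1)) (Φ : (Finset (Fin M) → Prop × Fin (T + 1)) → ℝ)
    (h0 : ∀ p, 0 ≤ Φ p) (h1 : ∀ p, Φ p ≤ 1) :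
    |𝔼 ψ : Fin M → V, Φ (pat (fun e => (A e, clip T (fixCol k a (fun e => (B e : ℕ)) e))) ψ) -
      𝔼 ψ : Fin M → V, Φ (fun D => ((pat (fun e => (A e, B e)) ψ D).1,
        clip T (fixCol k a (fun D => ((pat (fun e => (A e, B e)) ψ D).2 : ℕ)) D)))| ≤
      (M : ℝ) ^ 2 / Fintype.card V := by
  have := abs_expect_sub_le_of_injective (R := Fin M) (V := V)
    (fun ψ => Φ (pat (fun e => (A e, clip T (fixCol k a (fun e => (B e : ℕ)) e))) ψ))
    (fun ψ => Φ (fun D => ((pat (fun e => (A e, B e)) ψ D).1,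
        clip T (fixCol k a (fun D => ((pat (fun e => (A e, B e)) ψ D).2 : ℕ)) D))))
    (fun φ hφ => by
      refine congrArg Φ (funext fun D => ?_)
      simp only [pat, fixCol_image _ hφ])
    (fun φ => abs_sub_le_one (h0 _) (h1 _) (h0 _) (h1 _))
  simpa using this

end Repair

end HypReg

namespace HypReg

open Finset

open scoped BigOperators

attribute [local instance 10] Classical.propDecidable

set_option linter.unusedSectionVars false

section Labelling

variable {V : Type} [DecidableEq V] {W W' : Finset V} {k : ℕ} {a : ℕ → ℕ} {ε : ℝ} {d : Addr → ℝ}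
  {ℓ : Finset V → ℕ} {H H' : Finset (Finset V)}

theorem Core.exists_vertex_repair (h : Core W k a ε d ℓ H) {T : ℕ} (ha1 : 1 ≤ a 1) (haT : a 1 ≤ T)
    (hW : W.Nonempty) (hW' : W'.Nonempty) (f : W' → ℕ) {γ : ℝ} (hγ : 0 ≤ γ)
    (hf : ∀ (s : ℕ → Prop) [DecidablePred s], |(#(W.filter fun v => s (ℓ {v})) : ℝ) / #W -
      (#(univ.filter fun w => s (f w)) : ℝ) / #W'| ≤ γ) :
    ∃ g : W' → ℕ, (∀ w, 1 ≤ g w ∧ g w ≤ a 1) ∧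
      (∀ i, 1 ≤ i → i ≤ a 1 → #(univ.filter fun w => g w = i) = #W' / a 1 ∨
        #(univ.filter fun w => g w = i) = #W' / a 1 + 1) ∧
      (#(univ.filter fun w => g w ≠ f w) : ℝ) / #W' ≤ γ + T * (γ + 1 / #W + 1 / #W') := by
  have hn : (0 : ℝ) < #W := by exact_mod_cast hW.card_pos
  have hn' : (0 : ℝ) < #W' := by exact_mod_cast hW'.card_pos
  have hapos : (0 : ℝ) < a 1 := by exact_mod_cast ha1
  obtain ⟨g, hgI, hgs, hgm⟩ := exists_prescribed_fibres f (Icc 1 (a 1))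
    (fun i => #W' / a 1 + if i ≤ #W' % a 1 then 1 else 0)
    (by rw [sum_equitable_sizes ha1, Fintype.card_coe])
  refine ⟨g, fun w => mem_Icc.1 (hgI w), fun i h1 hi => ?_, ?_⟩
  · rw [hgs i (mem_Icc.2 ⟨h1, hi⟩)]
    split_ifs
    · exact Or.inr rfl
    · exact Or.inl rfl
  · have hout : (#(univ.filter fun w => f w ∉ Icc 1 (a 1)) : ℝ) ≤ γ * #W' := by
      have h2 := hf fun i => i ∉ Icc 1 (a 1)
      have h3 : (W.filter fun v => ℓ {v} ∉ Icc 1 (a 1)) = ∅ :=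
        filter_false_of_mem fun v hv => not_not.2 (mem_Icc.2 (h.vertex v hv))
      rw [h3, card_empty, Nat.cast_zero, zero_div, zero_sub, abs_neg, abs_of_nonneg (by positivity),
        div_le_iff₀ hn'] at h2
      exact h2
    have hcls : ∀ i ∈ Icc 1 (a 1), ((#(univ.filter fun w => f w = i) -
        (#W' / a 1 + if i ≤ #W' % a 1 then 1 else 0) : ℕ) : ℝ) ≤
          (γ + 1 / #W + 1 / #W') * #W' := by
      intro i hi
      rw [mem_Icc] at hi
      have h2 := (abs_le.1 (hf fun j => j = i)).1
      have h3 : (#(W.filter fun v => ℓ {v} = i) : ℝ) ≤ #W / a 1 + 1 := by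
        have h4 : #(W.filter fun v => ℓ {v} = i) ≤ #W / a 1 + 1 := by
          have := h.size i hi.1 hi.2
          omega
        calc (#(W.filter fun v => ℓ {v} = i) : ℝ) ≤ ((#W / a 1 + 1 : ℕ) : ℝ) := by exact_mod_cast h4
          _ ≤ _ := by push_cast; gcongr; exact Nat.cast_div_le
      have h5 : (#(W.filter fun v => ℓ {v} = i) : ℝ) / #W ≤ 1 / a 1 + 1 / #W := by
        rw [div_le_iff₀ hn]
        refine h3.trans (le_of_eq ?_)
        field_simp
      have h6 : (#W' : ℝ) / a 1 ≤ ((#W' / a 1 : ℕ) : ℝ) + 1 := by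
        rw [div_le_iff₀ hapos]
        have := (Nat.lt_mul_div_succ #W' ha1).le
        rw [mul_comm] at this
        exact_mod_cast this
      have h7 : (#(univ.filter fun w => f w = i) : ℝ) / #W' ≤ γ + 1 / a 1 + 1 / #W := by
        linarith
      rw [div_le_iff₀ hn'] at h7
      have h8 : (γ + 1 / #W + 1 / #W') * (#W' : ℝ) = (γ + 1 / a 1 + 1 / #W) * #W' - #W' / a 1 + 1 := by
        field_simp
        ring
      have h9 : 0 ≤ (γ + 1 / #W + 1 / #W') * (#W' : ℝ) := by positivity
      rcases le_total #(univ.filter fun w => f w = i)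
        (#W' / a 1 + if i ≤ #W' % a 1 then 1 else 0) with h10 | h10
      · rw [Nat.sub_eq_zero_of_le h10, Nat.cast_zero]
        exact h9
      · rw [Nat.cast_sub h10, h8]
        push_cast
        have h11 : (0 : ℝ) ≤ if i ≤ #W' % a 1 then 1 else 0 := by split_ifs <;> norm_num
        linarith
    have h2 : (#(univ.filter fun w => g w ≠ f w) : ℝ) ≤
        γ * #W' + ∑ i ∈ Icc 1 (a 1), (γ + 1 / #W + 1 / #W') * #W' := by
      refine (Nat.cast_le.2 hgm).trans ?_
      push_cast
      exact add_le_add hout (sum_le_sum hcls)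
    rw [sum_const, Nat.card_Icc, add_tsub_cancel_right, nsmul_eq_mul] at h2
    have h3 : (a 1 : ℝ) * ((γ + 1 / #W + 1 / #W') * #W') ≤ T * ((γ + 1 / #W + 1 / #W') * #W') := by
      gcongr
    rw [div_le_iff₀ hn']
    linarith

/-- The conditions on the labels in `Core`. -/
structure LabelCond (W : Finset V) (k : ℕ) (a : ℕ → ℕ) (ℓ : Finset V → ℕ) : Prop where
  vertex : ∀ v ∈ W, 1 ≤ ℓ {v} ∧ ℓ {v} ≤ a 1
  size : ∀ i, 1 ≤ i → i ≤ a 1 → #(W.filter fun v => ℓ {v} = i) = #W / a 1 ∨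
    #(W.filter fun v => ℓ {v} = i) = #W / a 1 + 1
  label : ∀ J ⊆ W, 2 ≤ #J → #J ≤ k - 1 → Cross ℓ J → 1 ≤ ℓ J ∧ ℓ J ≤ a #J
  zero : ∀ J ⊆ W, #J ≠ 1 → ¬ (2 ≤ #J ∧ #J ≤ k - 1 ∧ Cross ℓ J) → ℓ J = 0

theorem Core.labelCond (h : Core W k a ε d ℓ H) : LabelCond W k a ℓ :=
  ⟨h.vertex, h.size, h.label, h.zero⟩

theorem LabelCond.le {T : ℕ} (h : LabelCond W k a ℓ) (hk : 2 ≤ k)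
    (ha : ∀ j, 1 ≤ j → j ≤ k - 1 → a j ≤ T) {e : Finset V} (he : e ⊆ W) : ℓ e ≤ T := by
  by_cases h1 : #e = 1
  · obtain ⟨v, rfl⟩ := card_eq_one.1 h1
    exact (h.vertex v (he (mem_singleton_self v))).2.trans (ha 1 le_rfl (by omega))
  · by_cases h2 : 2 ≤ #e ∧ #e ≤ k - 1 ∧ Cross ℓ e
    · exact (h.label e he h2.1 h2.2.1 h2.2.2).2.trans (ha _ (by omega) h2.2.1)
    · rw [h.zero e he h1 h2]; exact Nat.zero_le _

theorem labelCond_fixCol {r : Finset V → ℕ} (ha : ∀ j, 1 ≤ j → j ≤ k - 1 → 1 ≤ a j)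
    (hv : ∀ v ∈ W, 1 ≤ r {v} ∧ r {v} ≤ a 1)
    (hs : ∀ i, 1 ≤ i → i ≤ a 1 → #(W.filter fun v => r {v} = i) = #W / a 1 ∨
      #(W.filter fun v => r {v} = i) = #W / a 1 + 1) : LabelCond W k a (fixCol k a r) where
  vertex v hv' := by rw [fixCol_singleton]; exact hv v hv'
  size i h1 hi := by simp only [fixCol_singleton]; exact hs i h1 hi
  label J _ h2 hk hc := by
    rw [cross_fixCol] at hc
    have := ha #J (by omega) hk
    rw [fixCol, if_neg (by omega), if_pos ⟨h2, hk, hc⟩]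
    omega
  zero J _ h1 h2 := by
    rw [cross_fixCol] at h2
    rw [fixCol, if_neg h1, if_neg h2]

end Labelling

end HypReg

namespace HypReg

open Finset

open scoped BigOperators

attribute [local instance 10] Classical.propDecidable

set_option linter.unusedSectionVars false

section Labelling

/-- Override the colours of the singletons. -/
noncomputable def setSingletons {U : Type} {T : ℕ} (g : U → ℕ) (B : Finset U → Fin (T + 1))
    (e : Finset U) : Fin (T + 1) :=
  if h : ∃ u, e = {u} then clip T (g h.choose) else B e

theorem setSingletons_singleton {U : Type} {T : ℕ} (g : U → ℕ) (B : Finset U → Fin (T + 1))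
    (u : U) : setSingletons g B {u} = clip T (g u) := by
  have h : ∃ v, ({u} : Finset U) = {v} := ⟨u, rfl⟩
  rw [setSingletons, dif_pos h]
  congr 2
  exact (singleton_injective h.choose_spec).symm

theorem setSingletons_eq {U : Type} {T : ℕ} {g : U → ℕ} {B : Finset U → Fin (T + 1)}
    {e : Finset U} (h : ∀ u ∈ e, g u = B {u}) : setSingletons g B e = B e := by
  unfold setSingletons
  split_ifs with h1
  · obtain ⟨u, hu⟩ := h1
    subst hu
    have h2 : ∃ v, ({u} : Finset U) = {v} := ⟨u, rfl⟩
    rw [← singleton_injective h2.choose_spec, h u (mem_singleton_self u), clip_self]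
  · rfl

/-- A labelling of one set gives a labelling of any set with nearly the same statistics. -/
theorem exists_labelling (k T M : ℕ) (hk : 2 ≤ k) {γ : ℝ} (hγ : 0 < γ) :
    ∃ (M' : ℕ) (γ' : ℝ) (n₀ : ℕ), 0 < γ' ∧ ∀ (V : Type) [DecidableEq V] (W W' : Finset V),
      n₀ ≤ #W → n₀ ≤ #W' → ∀ (a : ℕ → ℕ) (ε : ℝ) (d : Addr → ℝ) (ℓ : Finset V → ℕ)
      (H H' : Finset (Finset V)), (∀ j, 1 ≤ j → j ≤ k - 1 → 1 ≤ a j ∧ a j ≤ T) →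
      Core W k a ε d ℓ H → Close M' γ' (res W (· ∈ H)) (res W' (· ∈ H')) →
      ∃ ℓ' : Finset V → ℕ, LabelCond W' k a ℓ' ∧ Close M γ
        (res W fun e => (e ∈ H, clip T (ℓ e))) (res W' fun e => (e ∈ H', clip T (ℓ' e))) := by
  obtain ⟨γ₁, hγ₁, hγ₁e⟩ : ∃ γ₁ : ℝ, 0 < γ₁ ∧ γ₁ * (1 + M + M * T) = γ / 2 :=
    ⟨γ / 2 / (1 + M + M * T), by positivity, by field_simp⟩
  obtain ⟨M', γ', n₁, hγ', hlift⟩ := Close.exists_lift Prop (Fin (T + 1)) (k - 1) (M + 1) γ₁ hγ₁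
  obtain ⟨n₂, hn₂⟩ := exists_nat_gt (4 * ((M : ℝ) ^ 2 + M * T) / γ)
  refine ⟨M', γ', n₁ + n₂ + 1, hγ', ?_⟩
  intro V _ W W' hn hn' a ε d ℓ H H' ha hcore hclose
  have hWpos : 0 < #W := by omega
  have hWpos' : 0 < #W' := by omega
  have hW := card_pos.1 hWpos
  have hW' := card_pos.1 hWpos'
  have := hW.to_subtype
  have := hW'.to_subtype
  have hle : ∀ e ⊆ W, ℓ e ≤ T := fun e he => hcore.labelCond.le hk (fun j h1 h2 => (ha j h1 h2).2) he
  obtain ⟨B', -, hB'⟩ := hlift W W' (by simp; omega) (by simp; omega) _ _ hclose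
    (fun e => clip T (res W ℓ e)) (fun e he => by
      have h1 : res W ℓ e = 0 := by
        refine hcore.zero _ (image_val_subset e) ?_ ?_ <;>
        rw [card_image_of_injective _ Subtype.val_injective] <;> omega
      rw [h1]; rfl)
  have hBval : ∀ e, ((clip T (res W ℓ e) : Fin (T + 1)) : ℕ) = res W ℓ e := fun e =>
    clip_val (hle _ (image_val_subset e))
  obtain ⟨g, hgI, hgs, hgm⟩ := hcore.exists_vertex_repair (T := T) (ha 1 le_rfl (by omega)).1
    (ha 1 le_rfl (by omega)).2 hW hW' (fun w => (B' {w} : ℕ)) hγ₁.le (fun s _ => by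
      have h1 := hB'.apply (I := Unit) (by simp)
        (fun p => if s (p {()}).2 then (1 : ℝ) else 0) (fun p => by split_ifs <;> norm_num)
        (fun p => by split_ifs <;> norm_num)
      simp only [pat, image_singleton, hBval] at h1
      rw [expect_unit fun w : W => s (res W ℓ {w}), expect_unit fun w : W' => s (B' {w})] at h1
      have h2 : #(W.filter fun v => s (ℓ {v})) = #(univ.filter fun w : W => s (res W ℓ {w})) := by
        rw [← card_image_of_injective _ Subtype.val_injective]
        congr 1
        ext v
        simp [res, and_comm]
      rw [Fintype.card_coe, Fintype.card_coe] at h1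
      rw [h2]
      exact h1)
  obtain ⟨B₂, hB₂⟩ : ∃ B₂, B₂ = setSingletons g B' := ⟨_, rfl⟩
  have hB₂s : ∀ w, ((B₂ {w} : Fin (T + 1)) : ℕ) = g w := fun w => by
    rw [hB₂, setSingletons_singleton]
    exact clip_val ((hgI w).2.trans (ha 1 le_rfl (by omega)).2)
  obtain ⟨r, hr⟩ : ∃ r, r = unres W' fun e => ((B₂ e : Fin (T + 1)) : ℕ) := ⟨_, rfl⟩
  have hrs : ∀ w : W', r {(w : V)} = g w := fun w => by
    have h1 := unres_image_val (fun e => ((B₂ e : Fin (T + 1)) : ℕ)) {w}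
    rw [image_singleton] at h1
    rw [hr, h1, hB₂s]
  refine ⟨fixCol k a r, labelCond_fixCol (fun j h1 h2 => (ha j h1 h2).1)
    (fun v hv => by rw [hrs ⟨v, hv⟩]; exact hgI _) (fun i h1 hi => ?_), ?_⟩
  · have h2 : #(W'.filter fun v => r {v} = i) = #(univ.filter fun w => g w = i) := by
      rw [← card_image_of_injective _ Subtype.val_injective]
      congr 1
      ext v
      simp only [mem_filter, mem_image, mem_univ, true_and, Subtype.exists, exists_and_right,
        exists_eq_right]
      constructor
      · rintro ⟨hv, h⟩; exact ⟨hv, by rw [← hrs ⟨v, hv⟩]; exact h⟩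
      · rintro ⟨hv, h⟩; exact ⟨hv, by rw [hrs ⟨v, hv⟩]; exact h⟩
    rw [h2]
    exact hgs i h1 hi
  · intro Φ h0 h1
    have e1 : (res W fun e => (e ∈ H, clip T (ℓ e))) = fun e => (res W (· ∈ H) e,
        clip T (fixCol k a (fun e => ((clip T (res W ℓ e) : Fin (T + 1)) : ℕ)) e)) := by
      funext e
      simp only [hBval]
      have h3 := hcore.fixCol_eq (image_val_subset e)
      rw [fixCol_image _ Subtype.val_injective] at h3
      simp only [res]
      rw [h3]
    have e2 : (res W' fun e => (e ∈ H', clip T (fixCol k a r e))) = fun e => (res W' (· ∈ H') e,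
        clip T (fixCol k a (fun e => (B₂ e : ℕ)) e)) := by
      funext e
      simp only [res]
      rw [fixCol_image _ Subtype.val_injective, hr]
      simp only [unres_image_val]
    rw [e1, e2]
    obtain ⟨Ψ, hΨ⟩ : ∃ Ψ : (Finset (Fin M) → Prop × Fin (T + 1)) → ℝ, Ψ = fun p => Φ fun D =>
      ((p D).1, clip T (fixCol k a (fun D => ((p D).2 : ℕ)) D)) := ⟨_, rfl⟩
    have hΨ0 : ∀ p, 0 ≤ Ψ p := fun p => by rw [hΨ]; exact h0 _
    have hΨ1 : ∀ p, Ψ p ≤ 1 := fun p => by rw [hΨ]; exact h1 _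
    have s1 := abs_expect_fixCol_sub_le (k := k) (a := a) (res W (· ∈ H))
      (fun e => clip T (res W ℓ e)) Φ h0 h1
    have s4 := abs_expect_fixCol_sub_le (k := k) (a := a) (res W' (· ∈ H')) B₂ Φ h0 h1
    have s2 := hB'.apply (I := Fin M) (by simp) Ψ hΨ0 hΨ1
    have s3 := abs_expect_sub_le_of_hits (I := Fin M) (V := W') (fun w => g w ≠ B' {w})
      (fun ψ => Ψ (pat (fun e => (res W' (· ∈ H') e, B' e)) ψ))
      (fun ψ => Ψ (pat (fun e => (res W' (· ∈ H') e, B₂ e)) ψ)) (fun ψ hψ => by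
        refine congrArg Ψ (funext fun D => ?_)
        simp only [pat]
        rw [hB₂, setSingletons_eq]
        intro u hu
        obtain ⟨i, -, rfl⟩ := mem_image.1 hu
        exact not_not.1 (hψ i)) (fun ψ => abs_sub_le_one (hΨ0 _) (hΨ1 _) (hΨ0 _) (hΨ1 _))
    simp only [Fintype.card_coe, Fintype.card_fin] at s1 s2 s3 s4
    have hs1 := s1
    have hs4 := s4
    rw [show (fun ψ : Fin M → W => Φ fun D => ((pat (fun e => (res W (· ∈ H) e,
      clip T (res W ℓ e))) ψ D).1, clip T (fixCol k a (fun D => ((pat (fun e => (res W (· ∈ H) e,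
      clip T (res W ℓ e))) ψ D).2 : ℕ)) D))) = fun ψ => Ψ (pat (fun e => (res W (· ∈ H) e,
      clip T (res W ℓ e))) ψ) by rw [hΨ]] at hs1
    rw [show (fun ψ : Fin M → W' => Φ fun D => ((pat (fun e => (res W' (· ∈ H') e,
      B₂ e)) ψ D).1, clip T (fixCol k a (fun D => ((pat (fun e => (res W' (· ∈ H') e,
      B₂ e)) ψ D).2 : ℕ)) D))) = fun ψ => Ψ (pat (fun e => (res W' (· ∈ H') e,
      B₂ e)) ψ) by rw [hΨ]] at hs4
    have hmoved : (M : ℝ) * ((#(univ.filter fun w => g w ≠ B' {w}) : ℝ) / #W') ≤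
        M * (γ₁ + T * (γ₁ + 1 / #W + 1 / #W')) := by gcongr
    obtain ⟨n, hnn⟩ : ∃ n : ℝ, n = (n₂ : ℝ) + 1 := ⟨_, rfl⟩
    have hnpos : 0 < n := by rw [hnn]; positivity
    have hnW : n ≤ #W := by rw [hnn]; exact_mod_cast (by omega : n₂ + 1 ≤ #W)
    have hnW' : n ≤ #W' := by rw [hnn]; exact_mod_cast (by omega : n₂ + 1 ≤ #W')
    have i1 : 1 / (#W : ℝ) ≤ 1 / n := by gcongr
    have i2 : 1 / (#W' : ℝ) ≤ 1 / n := by gcongr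
    have j1 : (M : ℝ) ^ 2 / #W ≤ M ^ 2 / n := by gcongr
    have j2 : (M : ℝ) ^ 2 / #W' ≤ M ^ 2 / n := by gcongr
    have h3 : (M : ℝ) * (γ₁ + T * (γ₁ + 1 / #W + 1 / #W')) ≤ M * (γ₁ + T * (γ₁ + 1 / n + 1 / n)) := by
      gcongr
    have h4 : 2 * ((M : ℝ) ^ 2 / n) + M * T * (1 / n + 1 / n) ≤ γ / 2 := by
      have h5 : 4 * ((M : ℝ) ^ 2 + M * T) / γ < n := by rw [hnn]; linarith
      rw [div_lt_iff₀ hγ] at h5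
      have h6 : 2 * ((M : ℝ) ^ 2 / n) + M * T * (1 / n + 1 / n) = 2 * (M ^ 2 + M * T) / n := by
        field_simp
        ring
      rw [h6, div_le_iff₀ hnpos]
      linarith
    rw [abs_le] at hs1 s2 s3 hs4 ⊢
    constructor <;> nlinarith

end Labelling

end HypReg

namespace HypReg

open Finset

open scoped BigOperators

attribute [local instance 10] Classical.propDecidable

set_option linter.unusedSectionVars false

section Transfer

/-- Equitable labellings pass to hypergraphs with nearly the same statistics. -/
theorem exists_core_transfer (k T : ℕ) (hk : 2 ≤ k) {ε δ c : ℝ} (hε : 0 ≤ ε) (hε1 : ε ≤ 1)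
    (hδ : 0 < δ) (hδ1 : δ ≤ 1) (hc : 0 < c) :
    ∃ (M : ℕ) (γ : ℝ) (n₀ : ℕ), 0 < γ ∧ ∀ (V : Type) [DecidableEq V] (W W' : Finset V),
      n₀ ≤ #W → n₀ ≤ #W' → ∀ (a : ℕ → ℕ) (d : Addr → ℝ) (ℓ : Finset V → ℕ)
      (H H' : Finset (Finset V)), (∀ j, 1 ≤ j → j ≤ k - 1 → 1 ≤ a j ∧ a j ≤ T) →
      DensityFun k a d → Core W k a ε d ℓ H →
      (∀ y, IsAddress k (k - 1) a y → c * (#W : ℝ) ^ k ≤ #(cliqAll W ℓ y)) →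
      Close M γ (res W (· ∈ H)) (res W' (· ∈ H')) →
      ∃ ℓ' : Finset V → ℕ, Core W' k a (ε + δ) d ℓ' H' ∧ AllLabels W' k a ℓ' := by
  obtain ⟨M₁, γ₁, n₁, hγ₁, hreg⟩ := exists_regAt_transfer (Prop × Fin (T + 1)) k hδ hδ1 hc
  obtain ⟨M, γ, n₀, hγ, hlab⟩ := exists_labelling k T (M₁ + k) hk
    (γ := min γ₁ (c / 2)) (by positivity)
  refine ⟨M, γ, n₀ + n₁ + 1, hγ, ?_⟩
  intro V _ W W' hn hn' a d ℓ H H' ha hd hcore hlow hclose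
  have hWpos : 0 < #W := by omega
  have hWpos' : 0 < #W' := by omega
  have hW := card_pos.1 hWpos
  have hW' := card_pos.1 hWpos'
  have hWs := hW.to_subtype
  have hWs' := hW'.to_subtype
  obtain ⟨ℓ', hℓ', hcl⟩ := hlab V W W' (by omega) (by omega) a ε d ℓ H H' ha hcore hclose
  have hval : ∀ e ⊆ W, ((clip T (ℓ e) : Fin (T + 1)) : ℕ) = ℓ e := fun e he =>
    clip_val (hcore.labelCond.le hk (fun j h1 h2 => (ha j h1 h2).2) he)
  have hval' : ∀ e ⊆ W', ((clip T (ℓ' e) : Fin (T + 1)) : ℕ) = ℓ' e := fun e he =>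
    clip_val (hℓ'.le hk (fun j h1 h2 => (ha j h1 h2).2) he)
  have hlabel : ∀ j, 2 ≤ j → j ≤ k - 1 → ∀ x, IsAddress j (j - 1) a x → ∀ b, 1 ≤ b → b ≤ a j →
      c * (#W : ℝ) ^ j ≤ #((cliqAll W ℓ x).filter fun J => ℓ J = b) := fun j h2 hj x hx b hb1 hb =>
    hcore.le_card_label (fun i h1 hi => (ha i h1 hi).1) hWpos hlow h2 hj hx hb1 hb
  have htr := hreg V W W' hW hW' (by omega) (by omega) _ _
    (hcl.mono (by omega) (min_le_left _ _)) (fun z => (z.2 : ℕ))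
  refine ⟨ℓ', ⟨hcore.le_a, hℓ'.vertex, hℓ'.size, hℓ'.label, hℓ'.zero,
    fun j h2 hj x hx b hb1 hb => ?_, fun x hx => ?_⟩, fun j h2 hj x hx b hb1 hb => ?_⟩
  · have haj : (1 : ℝ) ≤ a j := by exact_mod_cast (ha j (by omega) hj).1
    refine htr (fun z => (z.2 : ℕ) = b) ℓ ℓ' (fun J => ℓ J = b) (fun J => ℓ' J = b) hval hval'
      (fun e he => by rw [hval e he]) (fun e he => by rw [hval' e he]) x ε _
      (by rw [hx.1]; omega) hε hε1 (by positivity) ((div_le_one (by linarith)).2 haj) ?_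
      (hcore.reg j h2 hj x hx b hb1 hb)
    rw [hx.1]
    exact (hlabel j h2 hj x hx b hb1 hb).trans (Nat.cast_le.2 (card_filter_le _ _))
  · refine htr (fun z => z.1) ℓ ℓ' (fun J => J ∈ H) (fun J => J ∈ H') hval hval'
      (fun e _ => Iff.rfl) (fun e _ => Iff.rfl) x ε _ (by rw [hx.1]) hε hε1 (hd x hx).1 (hd x hx).2
      ?_ (hcore.regH x hx)
    rw [hx.1]
    exact hlow x hx
  · have h1 := hcl.card_cliq_filter (x := x) (by rw [hx.1]; omega) (fun z => (z.2 : ℕ))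
      (fun _ => True) (fun z => (z.2 : ℕ) = b) (Q := W.powerset) (Q' := W'.powerset)
      (P := fun J => ℓ J = b) (P' := fun J => ℓ' J = b) hval
      (fun e he _ => iff_of_true trivial (mem_powerset.2 he)) (fun e he => by rw [hval e he]) hval'
      (fun e he _ => iff_of_true trivial (mem_powerset.2 he)) (fun e he => by rw [hval' e he])
    rw [cliq_powerset, cliq_powerset, hx.1] at h1
    have hWp : (0 : ℝ) < (#W : ℝ) ^ j := by
      have : (0 : ℝ) < #W := by exact_mod_cast hWpos
      positivity
    have h2 := (le_div_iff₀ hWp).2 (hlabel j h2 hj x hx b hb1 hb)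
    have h3 := (abs_le.1 (h1.trans (min_le_right _ _))).2
    by_contra hcon
    have h4 : ((cliqAll W' ℓ' x).filter fun J => ℓ' J = b) = ∅ :=
      filter_false_of_mem fun J hJ hb => hcon ⟨J, hJ, hb⟩
    rw [h4, card_empty, Nat.cast_zero, zero_div] at h3
    linarith

end Transfer

end HypReg

namespace HypReg

open Finset

open scoped BigOperators

set_option linter.unusedSectionVars false

section Concentration

variable {V : Type} [DecidableEq V]

theorem sum_powersetCard_succ (W : Finset V) (q : ℕ) (f : Finset V → ℝ) :
    ((q : ℝ) + 1) * ∑ Q ∈ W.powersetCard (q + 1), f Q =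
      ∑ x ∈ W, ∑ Q ∈ (W.erase x).powersetCard q, f (insert x Q) := by
  have h1 : ((q : ℝ) + 1) * ∑ Q ∈ W.powersetCard (q + 1), f Q =
      ∑ Q ∈ W.powersetCard (q + 1), ∑ x ∈ Q, f Q := by
    rw [mul_sum]
    refine sum_congr rfl fun Q hQ => ?_
    rw [sum_const, (mem_powersetCard.1 hQ).2, nsmul_eq_mul]
    push_cast; rfl
  rw [h1, sum_comm' (t' := W) (s' := fun x => (W.powersetCard (q + 1)).filter (x ∈ ·))]
  · refine sum_congr rfl fun x hx => sum_bij' (fun Q _ => Q.erase x) (fun Q _ => insert x Q)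
      ?_ ?_ ?_ ?_ ?_
    · intro Q hQ
      rw [mem_filter, mem_powersetCard] at hQ
      rw [mem_powersetCard, card_erase_of_mem hQ.2, hQ.1.2]
      exact ⟨erase_subset_erase _ hQ.1.1, rfl⟩
    · intro Q hQ
      rw [mem_powersetCard] at hQ
      have hxQ : x ∉ Q := fun h => by simpa using hQ.1 h
      rw [mem_filter, mem_powersetCard, card_insert_of_notMem hxQ, hQ.2]
      exact ⟨⟨insert_subset hx (hQ.1.trans (erase_subset _ _)), rfl⟩, mem_insert_self _ _⟩
    · intro Q hQ
      exact insert_erase (mem_filter.1 hQ).2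
    · intro Q hQ
      rw [mem_powersetCard] at hQ
      exact erase_insert fun h => by simpa using hQ.1 h
    · intro Q hQ
      rw [insert_erase (mem_filter.1 hQ).2]
  · intro Q x
    simp only [mem_powersetCard, mem_filter]
    exact ⟨fun h => ⟨h, h.1.1 h.2⟩, fun h => h.1⟩

theorem expect_powersetCard_succ (W : Finset V) (q : ℕ) (hq : q + 1 ≤ #W) (f : Finset V → ℝ) :
    𝔼 Q ∈ W.powersetCard (q + 1), f Q =
      𝔼 x ∈ W, 𝔼 Q ∈ (W.erase x).powersetCard q, f (insert x Q) := by
  have h : 𝔼 x ∈ W, 𝔼 Q ∈ (W.erase x).powersetCard q, f (insert x Q) =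
      (∑ x ∈ W, ∑ Q ∈ (W.erase x).powersetCard q, f (insert x Q)) /
        (#W * (#W - 1).choose q) := by
    rw [expect_eq_sum_div_card, mul_comm (#W : ℝ), ← div_div]
    refine congrArg (· / (#W : ℝ)) ?_
    rw [sum_div]
    refine sum_congr rfl fun x hx => ?_
    rw [expect_eq_sum_div_card, card_powersetCard, card_erase_of_mem hx]
  rw [h, ← sum_powersetCard_succ, expect_eq_sum_div_card, card_powersetCard]
  obtain ⟨m, hm⟩ : ∃ m, #W = m + 1 := ⟨#W - 1, by omega⟩
  rw [hm, Nat.add_sub_cancel]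
  have h1 : ((m : ℝ) + 1) * m.choose q = (m + 1).choose (q + 1) * (q + 1) := by
    exact_mod_cast Nat.add_one_mul_choose_eq m q
  push_cast
  rw [h1, mul_comm ((m + 1).choose (q + 1) : ℝ), mul_div_mul_left _ _ (by positivity)]

theorem abs_expect_insert_sub_le (W : Finset V) (q : ℕ) (g : Finset V → ℝ) {L : ℝ} (hL : 0 ≤ L)
    (hg : ∀ Q ⊆ W, #Q = q + 1 → ∀ x ∈ Q, ∀ y ∈ W, y ∉ Q → |g Q - g (insert y (Q.erase x))| ≤ L)
    (hq : q + 1 ≤ #W) {x y : V} (hx : x ∈ W) (hy : y ∈ W) :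
    |𝔼 Q ∈ (W.erase x).powersetCard q, g (insert x Q) -
      𝔼 Q ∈ (W.erase y).powersetCard q, g (insert y Q)| ≤ L := by
  rcases eq_or_ne x y with rfl | hxy
  · simpa using hL
  have himg : ∀ (u v : V) (Q : Finset V), u ∈ W → v ∈ W →
      Q ∈ (W.erase u).powersetCard q → Q.image (Equiv.swap u v) ∈ (W.erase v).powersetCard q := by
    intro u v Q hu hv hQ
    rw [mem_powersetCard] at hQ ⊢
    refine ⟨fun z hz => ?_, by
      rw [card_image_of_injective _ (Equiv.injective _), hQ.2]⟩
    obtain ⟨w, hw, rfl⟩ := mem_image.1 hz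
    have h2 := mem_erase.1 (hQ.1 hw)
    rcases eq_or_ne w v with rfl | hwv
    · rw [Equiv.swap_apply_right]; exact mem_erase.2 ⟨h2.1.symm, hu⟩
    · rw [Equiv.swap_apply_of_ne_of_ne h2.1 hwv]; exact mem_erase.2 ⟨hwv, h2.2⟩
  have hinv : ∀ (u v : V) (Q : Finset V),
      (Q.image (Equiv.swap u v)).image (Equiv.swap v u) = Q := by
    intro u v Q
    rw [image_image, Equiv.swap_comm v u]
    refine (image_congr fun z _ => ?_).trans image_id
    simp
  rw [← expect_bij' (s := (W.erase x).powersetCard q) (t := (W.erase y).powersetCard q)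
    (f := fun Q => g (insert y (Q.image (Equiv.swap x y)))) (g := fun Q => g (insert y Q))
    (fun Q _ => Q.image (Equiv.swap x y)) (fun Q _ => Q.image (Equiv.swap y x))
    (fun Q hQ => himg x y Q hx hy hQ) (fun Q hQ => himg y x Q hy hx hQ)
    (fun Q _ => hinv x y Q) (fun Q _ => hinv y x Q) (fun Q _ => rfl), ← expect_sub_distrib]
  have hne : ((W.erase x).powersetCard q).Nonempty :=
    powersetCard_nonempty.2 (by rw [card_erase_of_mem hx]; omega)
  refine (abs_expect_le _ _).trans (expect_le hne fun Q hQ => ?_)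
  rw [mem_powersetCard] at hQ
  have hxQ : x ∉ Q := fun h => by simpa using hQ.1 h
  by_cases hyQ : y ∈ Q
  · have : insert y (Q.image (Equiv.swap x y)) = insert x Q := by
      ext z
      simp only [mem_insert, mem_image]
      constructor
      · rintro (rfl | ⟨w, hw, rfl⟩)
        · exact Or.inr hyQ
        · rcases eq_or_ne w y with rfl | hwy
          · simp
          · rw [Equiv.swap_apply_of_ne_of_ne (by rintro rfl; exact hxQ hw) hwy]; exact Or.inr hw
      · rintro (rfl | hz)
        · exact Or.inr ⟨y, hyQ, by simp⟩
        · rcases eq_or_ne z y with rfl | hzy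
          · exact Or.inl rfl
          · exact Or.inr ⟨z, hz,
              Equiv.swap_apply_of_ne_of_ne (by rintro rfl; exact hxQ hz) hzy⟩
    rw [this, sub_self, abs_zero]; exact hL
  · have : Q.image (Equiv.swap x y) = (insert x Q).erase x := by
      rw [erase_insert hxQ]
      refine (image_congr fun z hz => ?_).trans image_id
      exact Equiv.swap_apply_of_ne_of_ne (by rintro rfl; exact hxQ hz) (by rintro rfl; exact hyQ hz)
    rw [this]
    refine hg _ (insert_subset hx (hQ.1.trans (erase_subset _ _)))
      (by rw [card_insert_of_notMem hxQ, hQ.2]) x (mem_insert_self _ _) y hy ?_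
    simp [hxy.symm, hyQ]

/-- The exponential moment of a centred variable bounded by `L`. -/
theorem expect_exp_le_of_bounded (W : Finset V) (hW : W.Nonempty) (D : V → ℝ) {L : ℝ}
    (hL : 0 < L) (hD : ∀ x ∈ W, |D x| ≤ L) (h0 : 𝔼 x ∈ W, D x = 0) (t : ℝ) :
    𝔼 x ∈ W, Real.exp (t * D x) ≤ Real.exp (t ^ 2 * L ^ 2 / 2) := by
  have h1 : ∀ x ∈ W, Real.exp (t * D x) ≤
      Real.cosh (t * L) + D x * (Real.sinh (t * L) / L) := by
    intro x hx
    obtain ⟨h2, h3⟩ := abs_le.1 (hD x hx)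
    have h4 := (convexOn_exp.2 : _) (Set.mem_univ (t * L)) (Set.mem_univ (-(t * L)))
      (a := (L + D x) / (2 * L)) (b := (L - D x) / (2 * L))
      (div_nonneg (by linarith) (by linarith)) (div_nonneg (by linarith) (by linarith))
      (by field_simp; ring)
    have h5 : (L + D x) / (2 * L) * (t * L) + (L - D x) / (2 * L) * (-(t * L)) = t * D x := by
      field_simp; ring
    simp only [smul_eq_mul] at h4
    rw [h5] at h4
    refine h4.trans (le_of_eq ?_)
    rw [Real.cosh_eq, Real.sinh_eq]
    field_simp; ring
  refine (expect_le_expect h1).trans ?_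
  rw [expect_add_distrib, expect_const hW, ← expect_mul, h0, zero_mul, add_zero]
  refine (Real.cosh_le_exp_half_sq _).trans (le_of_eq ?_)
  rw [mul_pow]

theorem expect_exp_le {L : ℝ} (hL : 0 < L) (t : ℝ) (q : ℕ) :
    ∀ (W : Finset V) (g : Finset V → ℝ), q ≤ #W →
    (∀ Q ⊆ W, #Q = q → ∀ x ∈ Q, ∀ y ∈ W, y ∉ Q → |g Q - g (insert y (Q.erase x))| ≤ L) →
    𝔼 Q ∈ W.powersetCard q, Real.exp (t * (g Q - 𝔼 Q' ∈ W.powersetCard q, g Q')) ≤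
      Real.exp (q * (t ^ 2 * L ^ 2 / 2)) := by
  induction q with
  | zero => intro W g _ _; simp
  | succ q ih =>
    intro W g hq hg
    have hW : W.Nonempty := card_pos.1 (by omega)
    obtain ⟨E, hE⟩ : ∃ E : V → ℝ, E = fun x => 𝔼 Q ∈ (W.erase x).powersetCard q, g (insert x Q) :=
      ⟨_, rfl⟩
    have hmean : 𝔼 Q ∈ W.powersetCard (q + 1), g Q = 𝔼 x ∈ W, E x := by
      rw [expect_powersetCard_succ W q hq, hE]
    rw [hmean, expect_powersetCard_succ W q hq]
    have hdiff : ∀ x ∈ W, |E x - 𝔼 y ∈ W, E y| ≤ L := by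
      intro x hx
      have : E x - 𝔼 y ∈ W, E y = 𝔼 y ∈ W, (E x - E y) := by
        rw [expect_sub_distrib, expect_const hW]
      rw [this]
      refine (abs_expect_le _ _).trans (expect_le hW fun y hy => ?_)
      rw [hE]
      exact abs_expect_insert_sub_le W q g hL.le hg hq hx hy
    have hstep : ∀ x ∈ W, 𝔼 Q ∈ (W.erase x).powersetCard q,
        Real.exp (t * (g (insert x Q) - 𝔼 y ∈ W, E y)) ≤
        Real.exp (q * (t ^ 2 * L ^ 2 / 2)) * Real.exp (t * (E x - 𝔼 y ∈ W, E y)) := by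
      intro x hx
      have h1 := ih (W.erase x) (fun Q => g (insert x Q))
        (by rw [card_erase_of_mem hx]; omega) (by
          intro Q hQ hcard u hu v hv hvQ
          have hxQ : x ∉ Q := fun h => by simpa using hQ h
          have hux : u ≠ x := fun h => hxQ (h ▸ hu)
          have hvx : v ≠ x := (mem_erase.1 hv).1
          have := hg (insert x Q) (insert_subset hx (hQ.trans (erase_subset _ _)))
            (by rw [card_insert_of_notMem hxQ, hcard]) u (mem_insert_of_mem hu) v
            (mem_erase.1 hv).2 (by simp [hvx, hvQ])
          rwa [erase_insert_of_ne hux.symm, Finset.insert_comm] at this)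
      have h2 : ∀ Q, Real.exp (t * (g (insert x Q) - 𝔼 y ∈ W, E y)) =
          Real.exp (t * (g (insert x Q) - E x)) * Real.exp (t * (E x - 𝔼 y ∈ W, E y)) := by
        intro Q; rw [← Real.exp_add]; congr 1; ring
      simp_rw [h2]
      rw [← expect_mul]
      refine mul_le_mul_of_nonneg_right ?_ (Real.exp_pos _).le
      rw [hE]
      exact h1
    refine (expect_le_expect hstep).trans ?_
    rw [← mul_expect]
    have h3 := expect_exp_le_of_bounded W hW (fun x => E x - 𝔼 y ∈ W, E y) hL hdiff
      (by rw [expect_sub_distrib, expect_const hW, sub_self]) t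
    refine (mul_le_mul_of_nonneg_left h3 (Real.exp_pos _).le).trans (le_of_eq ?_)
    rw [← Real.exp_add]; congr 1; push_cast; ring

/-- Concentration of swap-Lipschitz functions of a random `q`-subset. -/
theorem card_deviation_le {L : ℝ} (hL : 0 < L) (q : ℕ) (hq0 : 0 < q) (W : Finset V)
    (g : Finset V → ℝ) (hq : q ≤ #W)
    (hg : ∀ Q ⊆ W, #Q = q → ∀ x ∈ Q, ∀ y ∈ W, y ∉ Q → |g Q - g (insert y (Q.erase x))| ≤ L)
    {s : ℝ} (hs : 0 < s) :
    (#((W.powersetCard q).filter fun Q => s < |g Q - 𝔼 Q' ∈ W.powersetCard q, g Q'|) : ℝ) ≤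
      2 * Real.exp (-(s ^ 2 / (2 * q * L ^ 2))) * #(W.powersetCard q) := by
  obtain ⟨m, hm⟩ : ∃ m, m = 𝔼 Q' ∈ W.powersetCard q, g Q' := ⟨_, rfl⟩
  have hq0' : (0 : ℝ) < q := by exact_mod_cast hq0
  obtain ⟨t, ht⟩ : ∃ t, t = s / (q * L ^ 2) := ⟨_, rfl⟩
  have ht0 : 0 < t := by rw [ht]; positivity
  have hcard : (0 : ℝ) < #(W.powersetCard q) := by
    exact_mod_cast card_pos.2 (powersetCard_nonempty.2 hq)
  have h1 := expect_exp_le hL t q W g hq hg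
  have h2 := expect_exp_le hL (-t) q W g hq hg
  rw [← hm, expect_eq_sum_div_card, div_le_iff₀ hcard] at h1 h2
  rw [← hm]
  have h3 : (#((W.powersetCard q).filter fun Q => s < |g Q - m|) : ℝ) * Real.exp (t * s) ≤
      ∑ Q ∈ W.powersetCard q, (Real.exp (t * (g Q - m)) + Real.exp (-t * (g Q - m))) := by
    rw [← nsmul_eq_mul, ← sum_const]
    refine (sum_le_sum fun Q hQ => ?_).trans (sum_le_sum_of_subset_of_nonneg (filter_subset _ _)
      fun _ _ _ => by positivity)
    rcases lt_abs.1 (mem_filter.1 hQ).2 with h | h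
    · have : Real.exp (t * s) ≤ Real.exp (t * (g Q - m)) :=
        Real.exp_le_exp.2 (mul_le_mul_of_nonneg_left h.le ht0.le)
      linarith [Real.exp_pos (-t * (g Q - m))]
    · have : Real.exp (t * s) ≤ Real.exp (-t * (g Q - m)) :=
        Real.exp_le_exp.2 (by nlinarith)
      linarith [Real.exp_pos (t * (g Q - m))]
  rw [sum_add_distrib] at h3
  rw [neg_sq] at h2
  have h4 := h3.trans (add_le_add h1 h2)
  rw [← le_div_iff₀ (Real.exp_pos _)] at h4
  refine h4.trans (le_of_eq ?_)
  rw [div_eq_mul_inv, ← Real.exp_neg, ← two_mul, mul_assoc, mul_assoc, mul_assoc,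
    mul_comm _ (Real.exp (-(t * s))), ← mul_assoc (Real.exp _) (Real.exp _), ← Real.exp_add]
  congr 3
  rw [ht]; field_simp; ring

end Concentration

end HypReg

namespace HypReg

open Finset

open scoped BigOperators

attribute [local instance 10] Classical.propDecidable

set_option linter.unusedSectionVars false

section Sampling

variable {V : Type} [DecidableEq V] {I : Type} [Fintype I] [DecidableEq I]

/-- The average of `G` over the maps from `I` to `Q`. -/
noncomputable def avgOn (G : (I → V) → ℝ) (Q : Finset V) : ℝ :=
  𝔼 ψ : I → ↥Q, G fun i => (ψ i : V)

theorem avgOn_image (G : (I → V) → ℝ) (Q : Finset V) (f : V → V) (hf : Function.Injective f) :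
    avgOn G (Q.image f) = 𝔼 ψ : I → ↥Q, G fun i => f (ψ i) := by
  have hb : Function.Bijective
      (fun v : ↥Q => (⟨f v, mem_image_of_mem f v.2⟩ : ↥(Q.image f))) := by
    refine ⟨fun v w h => Subtype.ext (hf (congrArg Subtype.val h)), fun w => ?_⟩
    obtain ⟨v, hv, h⟩ := mem_image.1 w.2
    exact ⟨⟨v, hv⟩, Subtype.ext h⟩
  exact (Fintype.expect_equiv ((Equiv.refl I).arrowCongr (Equiv.ofBijective _ hb))
    (fun ψ : I → ↥Q => G fun i => f (ψ i)) (fun ψ => G fun i => (ψ i : V)) fun ψ => rfl).symm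

theorem image_swap_eq {Q : Finset V} {x y : V} (hx : x ∈ Q) (hy : y ∉ Q) :
    Q.image (Equiv.swap x y) = insert y (Q.erase x) := by
  conv_lhs => rw [← insert_erase hx]
  rw [image_insert, Equiv.swap_apply_left]
  refine congrArg _ ((image_congr fun z hz => ?_).trans image_id)
  have hz' := mem_erase.1 hz
  exact Equiv.swap_apply_of_ne_of_ne hz'.1 (by rintro rfl; exact hy hz'.2)

theorem abs_avgOn_swap_le (G : (I → V) → ℝ) (h0 : ∀ ψ, 0 ≤ G ψ) (h1 : ∀ ψ, G ψ ≤ 1)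
    {Q : Finset V} {x y : V} (hx : x ∈ Q) (hy : y ∉ Q) :
    |avgOn G Q - avgOn G (insert y (Q.erase x))| ≤ Fintype.card I * (1 / (#Q : ℝ)) := by
  have : Nonempty ↥Q := ⟨⟨x, hx⟩⟩
  rw [← image_swap_eq hx hy, avgOn_image _ _ _ (Equiv.injective _), avgOn, ← expect_sub_distrib]
  have h2 := expect_hits_le (I := I) (V := ↥Q) (fun v => v = ⟨x, hx⟩)
  rw [filter_eq' univ, if_pos (mem_univ _), card_singleton, Fintype.card_coe, Nat.cast_one] at h2
  refine (abs_expect_le' _).trans (le_trans (expect_le_expect fun ψ _ => ?_) h2)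
  split_ifs with hψ
  · exact abs_sub_le_one (h0 _) (h1 _) (h0 _) (h1 _)
  · refine le_of_eq (abs_eq_zero.2 (sub_eq_zero.2 (congrArg G (funext fun i => ?_))))
    refine (Equiv.swap_apply_of_ne_of_ne (fun h => hψ ⟨i, Subtype.ext h⟩) ?_).symm
    rintro rfl; exact hy (ψ i).2

/-- The average of `G` over the permutations of a map to `W`. -/
noncomputable def permAvg (G : (I → V) → ℝ) (W : Finset V) (φ : I → ↥W) : ℝ :=
  𝔼 σ : Equiv.Perm ↥W, G fun i => (σ (φ i) : V)

theorem permAvg_congr {M : ℕ} (G : (Fin M → V) → ℝ) (W : Finset V) (φ φ' : Fin M → ↥W)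
    (hφ : Function.Injective φ) (hφ' : Function.Injective φ') :
    permAvg G W φ = permAvg G W φ' := by
  obtain ⟨τ, hτ⟩ := (Equiv.Perm.isMultiplyPretransitive ↥W M).exists_smul_eq ⟨φ', hφ'⟩ ⟨φ, hφ⟩
  refine Fintype.expect_equiv (Equiv.mulRight τ) _ _ fun σ => congrArg G (funext fun i => ?_)
  have := DFunLike.congr_fun hτ i
  have h2 : τ (φ' i) = φ i := this
  simp [h2]

theorem permAvg_nonneg (G : (I → V) → ℝ) (h0 : ∀ ψ, 0 ≤ G ψ) (W : Finset V) (φ : I → ↥W) :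
    0 ≤ permAvg G W φ := expect_nonneg fun _ _ => h0 _

theorem permAvg_le_one (G : (I → V) → ℝ) (h1 : ∀ ψ, G ψ ≤ 1) (W : Finset V) (φ : I → ↥W) :
    permAvg G W φ ≤ 1 := expect_le univ_nonempty fun _ _ => h1 _

theorem expect_avgOn_perm (G : (I → V) → ℝ) {W Q : Finset V} (hQ : Q ⊆ W) :
    𝔼 σ : Equiv.Perm ↥W, avgOn G (Q.image (Equiv.Perm.ofSubtype σ)) =
      𝔼 ψ : I → ↥Q, permAvg G W fun i => ⟨ψ i, hQ (ψ i).2⟩ := by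
  simp only [permAvg]
  rw [expect_comm]
  refine expect_congr rfl fun σ _ => ?_
  rw [avgOn_image _ _ _ (Equiv.injective _)]
  refine expect_congr rfl fun ψ _ => congrArg G (funext fun i => ?_)
  exact Equiv.Perm.ofSubtype_apply_of_mem σ (hQ (ψ i).2)

theorem image_ofSubtype_mem {W Q : Finset V} {q : ℕ} (σ : Equiv.Perm ↥W)
    (hQ : Q ∈ W.powersetCard q) : Q.image (Equiv.Perm.ofSubtype σ) ∈ W.powersetCard q := by
  rw [mem_powersetCard] at hQ ⊢
  refine ⟨fun v hv => ?_, by rw [card_image_of_injective _ (Equiv.injective _), hQ.2]⟩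
  obtain ⟨w, hw, rfl⟩ := mem_image.1 hv
  rw [Equiv.Perm.ofSubtype_apply_of_mem σ (hQ.1 hw)]
  exact Subtype.property _

theorem expect_avgOn_image (G : (I → V) → ℝ) (W : Finset V) (q : ℕ) (σ : Equiv.Perm ↥W) :
    𝔼 Q ∈ W.powersetCard q, avgOn G (Q.image (Equiv.Perm.ofSubtype σ)) =
      𝔼 Q ∈ W.powersetCard q, avgOn G Q := by
  refine expect_bij' (fun Q _ => Q.image (Equiv.Perm.ofSubtype σ))
    (fun Q _ => Q.image (Equiv.Perm.ofSubtype σ⁻¹)) (fun Q hQ => image_ofSubtype_mem σ hQ)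
    (fun Q hQ => image_ofSubtype_mem σ⁻¹ hQ) ?_ ?_ (fun _ _ => rfl) <;>
  · intro Q _
    rw [image_image]
    refine (image_congr fun z _ => ?_).trans image_id
    simp

theorem abs_expect_permAvg_sub_le {M : ℕ} (G : (Fin M → V) → ℝ) (h0 : ∀ ψ, 0 ≤ G ψ)
    (h1 : ∀ ψ, G ψ ≤ 1) {W Q : Finset V} (hQ : Q ⊆ W) (hne : Q.Nonempty) (φ₀ : Fin M → ↥W)
    (hφ₀ : Function.Injective φ₀) :
    |𝔼 σ : Equiv.Perm ↥W, avgOn G (Q.image (Equiv.Perm.ofSubtype σ)) - permAvg G W φ₀| ≤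
      (M : ℝ) ^ 2 / #Q := by
  have : Nonempty ↥Q := hne.to_subtype
  rw [expect_avgOn_perm G hQ]
  have := abs_expect_sub_le_of_injective (R := Fin M) (V := ↥Q)
    (fun ψ => permAvg G W fun i => ⟨ψ i, hQ (ψ i).2⟩) (fun _ => permAvg G W φ₀)
    (fun φ hφ => permAvg_congr G W _ _
      (fun i j h => hφ (Subtype.ext (Subtype.mk.inj h))) hφ₀)
    (fun φ => abs_sub_le_one (permAvg_nonneg G h0 W _) (permAvg_le_one G h1 W _)
      (permAvg_nonneg G h0 W _) (permAvg_le_one G h1 W _))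
  rwa [Fintype.expect_const, Fintype.card_fin, Fintype.card_coe] at this

theorem abs_expect_avgOn_sub_le {M : ℕ} (G : (Fin M → V) → ℝ) (h0 : ∀ ψ, 0 ≤ G ψ)
    (h1 : ∀ ψ, G ψ ≤ 1) (W : Finset V) {q : ℕ} (hq0 : 0 < q) (hMq : M ≤ q) (hq : q ≤ #W) :
    |𝔼 Q ∈ W.powersetCard q, avgOn G Q - avgOn G W| ≤ 2 * ((M : ℝ) ^ 2 / q) := by
  obtain ⟨e⟩ : Nonempty (Fin M ↪ ↥W) :=
    Function.Embedding.nonempty_of_card_le (by simpa using hMq.trans hq)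
  have hq0' : (0 : ℝ) < q := by exact_mod_cast hq0
  have hne := powersetCard_nonempty.2 hq
  have hW : avgOn G W = 𝔼 σ : Equiv.Perm ↥W, avgOn G (W.image (Equiv.Perm.ofSubtype σ)) := by
    have : ∀ σ : Equiv.Perm ↥W, W.image (Equiv.Perm.ofSubtype σ) = W := by
      intro σ
      have := image_ofSubtype_mem (q := #W) σ (mem_powersetCard.2 ⟨Subset.rfl, rfl⟩)
      rw [mem_powersetCard] at this
      exact eq_of_subset_of_card_le this.1 this.2.ge
    simp_rw [this]
    rw [Fintype.expect_const]
  have hE : 𝔼 Q ∈ W.powersetCard q, avgOn G Q = 𝔼 Q ∈ W.powersetCard q,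
      𝔼 σ : Equiv.Perm ↥W, avgOn G (Q.image (Equiv.Perm.ofSubtype σ)) := by
    rw [expect_comm]
    simp_rw [expect_avgOn_image]
    rw [Fintype.expect_const]
  have hA : |𝔼 Q ∈ W.powersetCard q, avgOn G Q - permAvg G W e| ≤ (M : ℝ) ^ 2 / q := by
    have h2 : 𝔼 Q ∈ W.powersetCard q, avgOn G Q - permAvg G W e = 𝔼 Q ∈ W.powersetCard q,
        (𝔼 σ : Equiv.Perm ↥W, avgOn G (Q.image (Equiv.Perm.ofSubtype σ)) - permAvg G W e) := by
      rw [expect_sub_distrib, expect_const hne, hE]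
    rw [h2]
    refine (abs_expect_le _ _).trans (expect_le hne fun Q hQ => ?_)
    rw [mem_powersetCard] at hQ
    have := abs_expect_permAvg_sub_le G h0 h1 hQ.1 (card_pos.1 (by omega)) e e.injective
    rwa [hQ.2] at this
  have hB : |avgOn G W - permAvg G W e| ≤ (M : ℝ) ^ 2 / q := by
    rw [hW]
    refine (abs_expect_permAvg_sub_le G h0 h1 Subset.rfl (card_pos.1 (by omega)) e
      e.injective).trans ?_
    exact div_le_div_of_nonneg_left (by positivity) hq0' (by exact_mod_cast hq)
  rw [abs_le] at hA hB ⊢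
  constructor <;> linarith [hA.1, hA.2, hB.1, hB.2]

theorem card_avgOn_deviation_le {M : ℕ} (G : (Fin M → V) → ℝ) (h0 : ∀ ψ, 0 ≤ G ψ)
    (h1 : ∀ ψ, G ψ ≤ 1) (W : Finset V) {q : ℕ} (hq0 : 0 < q) (hMq : M ≤ q) (hq : q ≤ #W)
    {s : ℝ} (hs : 0 < s) (hMs : 4 * (M : ℝ) ^ 2 ≤ s * q) :
    (#((W.powersetCard q).filter fun Q => s < |avgOn G W - avgOn G Q|) : ℝ) ≤
      2 * Real.exp (-(s ^ 2 / (8 * ((M : ℝ) + 1) ^ 2) * q)) * #(W.powersetCard q) := by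
  have hq0' : (0 : ℝ) < q := by exact_mod_cast hq0
  have h2 := abs_expect_avgOn_sub_le G h0 h1 W hq0 hMq hq
  have h3 : 2 * ((M : ℝ) ^ 2 / q) ≤ s / 2 := by
    rw [← mul_div_assoc, div_le_iff₀ hq0']; linarith
  have h4 := card_deviation_le (L := ((M : ℝ) + 1) / q) (by positivity) q hq0 W (avgOn G) hq
    (fun Q _ hQ x hx y _ hy => by
      refine (abs_avgOn_swap_le G h0 h1 hx hy).trans ?_
      rw [Fintype.card_fin, hQ, mul_one_div]
      exact div_le_div_of_nonneg_right (by linarith) hq0'.le) (half_pos hs)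
  refine le_trans (Nat.cast_le.2 (card_le_card ?_)) (h4.trans (le_of_eq ?_))
  · intro Q hQ
    rw [mem_filter] at hQ ⊢
    refine ⟨hQ.1, ?_⟩
    have h5 := abs_sub_le (avgOn G W) (𝔼 Q ∈ W.powersetCard q, avgOn G Q) (avgOn G Q)
    rw [abs_sub_comm] at h2
    rw [abs_sub_comm (avgOn G Q)]
    linarith [hQ.2]
  · congr 3
    field_simp
    norm_num

/-- A random `q`-subset has the same statistics as the whole set, with high probability. -/
theorem exists_sampling_close (M : ℕ) {γ : ℝ} (hγ : 0 < γ) :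
    ∃ c : ℝ, 0 < c ∧ ∃ q₀ : ℕ, ∀ q, q₀ ≤ q → ∀ (V : Type) [DecidableEq V] (W : Finset V)
      (Z : Finset V → Prop), q ≤ #W →
      (#((W.powersetCard q).filter fun Q => ¬ Close M γ (res W Z) (res Q Z)) : ℝ) ≤
        Real.exp (-(c * q)) * #(W.powersetCard q) := by
  obtain ⟨N, hN⟩ : ∃ N : ℝ, N = Fintype.card (Finset (Fin M) → Prop) := ⟨_, rfl⟩
  have hN0 : 0 < N := by rw [hN]; exact_mod_cast Fintype.card_pos
  obtain ⟨s, hs⟩ : ∃ s, s = γ / N := ⟨_, rfl⟩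
  have hs0 : 0 < s := by rw [hs]; positivity
  obtain ⟨c, hc⟩ : ∃ c, c = s ^ 2 / (16 * ((M : ℝ) + 1) ^ 2) := ⟨_, rfl⟩
  have hc0 : 0 < c := by rw [hc]; positivity
  refine ⟨c, hc0, M + 1 + ⌈4 * (M : ℝ) ^ 2 / s⌉₊ + ⌈2 * N / c⌉₊, fun q hq V _ W Z hqW => ?_⟩
  have hq1 : 4 * (M : ℝ) ^ 2 ≤ s * q := by
    have : 4 * (M : ℝ) ^ 2 / s ≤ q := (Nat.le_ceil _).trans (Nat.cast_le.2 (by omega))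
    rwa [div_le_iff₀' hs0] at this
  have hq2 : 2 * N ≤ Real.exp (c * q) := by
    have : 2 * N / c ≤ q := (Nat.le_ceil _).trans (Nat.cast_le.2 (by omega))
    rw [div_le_iff₀' hc0] at this
    linarith [Real.add_one_le_exp (c * q)]
  obtain ⟨G, hG⟩ : ∃ G : (Finset (Fin M) → Prop) → (Fin M → V) → ℝ,
      G = fun F ψ => if (fun D => Z (D.image ψ)) = F then 1 else 0 := ⟨_, rfl⟩
  have hGa : ∀ F (Q : Finset V), avgOn (G F) Q =
      𝔼 ψ : Fin M → ↥Q, (if pat (res Q Z) ψ = F then (1 : ℝ) else 0) := by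
    intro F Q
    rw [avgOn, hG]
    refine expect_congr rfl fun ψ _ => ?_
    have : pat (res Q Z) ψ = fun D => Z (D.image fun i => (ψ i : V)) := funext fun D => pat_res ..
    rw [this]
  have hG0 : ∀ F ψ, 0 ≤ G F ψ := by intro F ψ; rw [hG]; dsimp only; split_ifs <;> norm_num
  have hG1 : ∀ F ψ, G F ψ ≤ 1 := by intro F ψ; rw [hG]; dsimp only; split_ifs <;> norm_num
  have hsub : ((W.powersetCard q).filter fun Q => ¬ Close M γ (res W Z) (res Q Z)) ⊆
      (univ : Finset (Finset (Fin M) → Prop)).biUnion fun F =>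
        (W.powersetCard q).filter fun Q => s < |avgOn (G F) W - avgOn (G F) Q| := by
    intro Q hQ
    rw [mem_filter] at hQ
    by_contra h
    refine hQ.2 (Close.of_patterns _ _ (fun F => ?_) hγ.le)
    rw [← hGa, ← hGa, ← hN, ← hs]
    by_contra hF
    exact h (mem_biUnion.2 ⟨F, mem_univ _, mem_filter.2 ⟨hQ.1, not_le.1 hF⟩⟩)
  refine (Nat.cast_le.2 ((card_le_card hsub).trans card_biUnion_le)).trans ?_
  push_cast
  refine (sum_le_sum fun F _ => card_avgOn_deviation_le (G F) (hG0 F) (hG1 F) W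
    (by omega) (by omega) hqW hs0 hq1).trans ?_
  rw [sum_const, card_univ, nsmul_eq_mul, ← hN, ← mul_assoc, ← mul_assoc]
  refine mul_le_mul_of_nonneg_right ?_ (Nat.cast_nonneg _)
  have h5 : s ^ 2 / (8 * ((M : ℝ) + 1) ^ 2) * q = c * q + c * q := by
    rw [hc]; field_simp; ring
  rw [h5, neg_add, Real.exp_add, ← mul_assoc]
  refine mul_le_of_le_one_left (Real.exp_pos _).le ?_
  rw [Real.exp_neg, mul_inv_le_iff₀ (Real.exp_pos _)]
  linarith

end Sampling

end HypReg

namespace HypReg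

open Finset

attribute [local instance 10] Classical.propDecidable

section Partition

theorem res_filter_subset {V : Type} [DecidableEq V] (Q : Finset V) (H : Finset (Finset V)) :
    res Q (· ∈ H.filter fun e => e ⊆ Q) = res Q (· ∈ H) :=
  funext fun e => propext (by simp [res, image_val_subset])

/-- Equitable partitions pass to hypergraphs with nearly the same statistics. -/
theorem exists_isEquitPartition_transfer {k T M n₀ n₁ : ℕ} {eRI : ℕ → ℕ → ℝ} {ε δ c γ : ℝ}
    (hk : 2 ≤ k)
    (hT : ∀ (a : ℕ → ℕ) (d : Addr → ℝ), RegInstance eRI k (2 * ε / 3) a d →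
      (∀ j, 1 ≤ j → j ≤ k - 1 → a j ≤ T) ∧ ∀ (V : Type) [DecidableEq V] (W : Finset V)
        (ℓ : Finset V → ℕ) (H : Finset (Finset V)), n₁ ≤ #W → Core W k a ε d ℓ H →
        ∀ y, IsAddress k (k - 1) a y → c * (#W : ℝ) ^ k ≤ #(cliqAll W ℓ y))
    (htr : ∀ (V : Type) [DecidableEq V] (W W' : Finset V),
      n₀ ≤ #W → n₀ ≤ #W' → ∀ (a : ℕ → ℕ) (d : Addr → ℝ) (ℓ : Finset V → ℕ)
      (H H' : Finset (Finset V)), (∀ j, 1 ≤ j → j ≤ k - 1 → 1 ≤ a j ∧ a j ≤ T) →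
      DensityFun k a d → Core W k a ε d ℓ H →
      (∀ y, IsAddress k (k - 1) a y → c * (#W : ℝ) ^ k ≤ #(cliqAll W ℓ y)) →
      Close M γ (res W (· ∈ H)) (res W' (· ∈ H')) →
      ∃ ℓ', Core W' k a (ε + δ) d ℓ' H' ∧ AllLabels W' k a ℓ')
    {V : Type} [DecidableEq V] {W W' : Finset V} (hW : n₀ ≤ #W) (hW1 : n₁ ≤ #W)
    (hW' : n₀ ≤ #W') (hTW' : T ≤ #W') {a : ℕ → ℕ} {d : Addr → ℝ}
    (hR : RegInstance eRI k (2 * ε / 3) a d) {H H' : Finset (Finset V)}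
    (hcl : Close M γ (res W (· ∈ H)) (res W' (· ∈ H')))
    (h : ∃ F : LabFam V, F.gnd = W ∧ F.IsEquitPartition k a ε d H) :
    ∃ F : LabFam V, F.gnd = W' ∧ F.IsEquitPartition k a (ε + δ) d H' := by
  obtain ⟨F, rfl, hF⟩ := h
  have hcore := hF.core hk
  obtain ⟨haT, hlow⟩ := hT a d hR
  obtain ⟨ℓ', hℓ', hall⟩ := htr V F.gnd W' hW hW' a d (F.lab k) H H'
    (fun j h1 h2 => ⟨hR.2.1 j h1 h2, haT j h1 h2⟩) hR.2.2.2.2 hcore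
    (hlow V F.gnd (F.lab k) H hW1 hcore) hcl
  exact ⟨famOf W' ℓ', rfl,
    hℓ'.isEquitPartition hk ((haT 1 le_rfl (by omega)).trans hTW') hall⟩

end Partition

end HypReg

namespace HypReg

open Finset

attribute [local instance 10] Classical.propDecidable

/-- Main theorem: with high probability, a uniformly random q-subset satisfies the same
regularity instance as the host hypergraph, up to an arbitrarily small additive correction
of the regularity parameter (in both directions). -/
theorem sampling_regularity_instances (eRI : ℕ → ℕ → ℝ) (hERI : GoodERI eRI) :
    ∀ k : ℕ, 2 ≤ k → ∀ ε₀ : ℝ, 0 < ε₀ → ε₀ ≤ 1 →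
    ∃ δ₀ : ℝ, 0 < δ₀ ∧ ∀ δ : ℝ, 0 < δ → δ ≤ δ₀ →
    ∃ c₀ : ℝ, 0 < c₀ ∧ ∀ c : ℝ, 0 < c → c ≤ c₀ →
    ∃ q₀ : ℕ, ∀ q n : ℕ, q₀ ≤ q → q < n →
    ∀ (V : Type) [DecidableEq V], ∀ W : Finset V, W.card = n →
    ∀ (a : ℕ → ℕ) (d : Addr → ℝ), RegInstance eRI k (2 * ε₀ / 3) a d →
    ∀ H : Finset (Finset V), IsKGraph W k H →
    (1 - Real.exp (-(c * q))) * ((W.powersetCard q).card : ℝ) ≤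
      (((W.powersetCard q).filter fun Q =>
        -- (Q1)
        ((∃ F₁ : LabFam V, F₁.gnd = W ∧ F₁.IsEquitPartition k a ε₀ d H) →
          ∃ F₂ : LabFam V, F₂.gnd = Q ∧
            F₂.IsEquitPartition k a (ε₀ + δ) d (H.filter fun e => e ⊆ Q)) ∧
        -- (Q2)
        ((∃ F₂ : LabFam V, F₂.gnd = Q ∧
            F₂.IsEquitPartition k a ε₀ d (H.filter fun e => e ⊆ Q)) →
          ∃ F₁ : LabFam V, F₁.gnd = W ∧ F₁.IsEquitPartition k a (ε₀ + δ) d H)).card : ℝ)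
    := by
  intro k hk ε₀ hε hε1
  obtain ⟨T, n₁, c₁, hc₁, hT⟩ := exists_cliqAll_lower_bound hERI hk hε
  refine ⟨1, one_pos, fun δ hδ hδ1 => ?_⟩
  obtain ⟨M, γ, n₀, hγ, htr⟩ := exists_core_transfer k T hk hε.le hε1 hδ hδ1 hc₁
  obtain ⟨c₀, hc₀, q₁, hs⟩ := exists_sampling_close M hγ
  refine ⟨c₀, hc₀, fun c _ hc => ⟨n₀ + n₁ + T + q₁ + 1, ?_⟩⟩
  intro q n hq hqn V _ W hWn a d hR H _
  have hbad := hs q (by omega) V W (· ∈ H) (by omega)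
  have hexp : Real.exp (-(c₀ * q)) ≤ Real.exp (-(c * q)) :=
    Real.exp_le_exp.2 (neg_le_neg (mul_le_mul_of_nonneg_right hc (Nat.cast_nonneg q)))
  have hsplit := card_filter_add_card_filter_not (s := W.powersetCard q)
    (fun Q => Close M γ (res W (· ∈ H)) (res Q (· ∈ H)))
  have hsplit' : (#((W.powersetCard q).filter fun Q =>
      Close M γ (res W (· ∈ H)) (res Q (· ∈ H))) : ℝ) + #((W.powersetCard q).filter fun Q =>
      ¬ Close M γ (res W (· ∈ H)) (res Q (· ∈ H))) = #(W.powersetCard q) := by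
    exact_mod_cast hsplit
  have hgood : (1 - Real.exp (-(c * q))) * (#(W.powersetCard q) : ℝ) ≤
      #((W.powersetCard q).filter fun Q =>
        Close M γ (res W (· ∈ H)) (res Q (· ∈ H))) := by
    have := mul_le_mul_of_nonneg_right hexp (Nat.cast_nonneg (α := ℝ) #(W.powersetCard q))
    linarith
  refine hgood.trans (Nat.cast_le.2 (card_le_card fun Q hQ => ?_))
  rw [mem_filter] at hQ ⊢
  have hcard := (mem_powersetCard.1 hQ.1).2
  have hcl := hQ.2
  have hne : Nonempty ↥W := (card_pos.1 (by omega : 0 < #W)).to_subtype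
  have hne' : Nonempty ↥Q := (card_pos.1 (by omega : 0 < #Q)).to_subtype
  rw [← res_filter_subset Q H] at hcl
  exact ⟨hQ.1, fun h => exists_isEquitPartition_transfer hk hT htr (by omega) (by omega)
    (by omega) (by omega) hR hcl h, fun h => exists_isEquitPartition_transfer hk hT htr
    (by omega) (by omega) (by omega) (by omega) hR hcl.symm h⟩

end HypReg
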